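/- Let X be S^d, ℝ^d or H^d with d ≥ 2, let K, L ⊊ X be proper closed convex sets with interior points satisfying condition (**); for X = ℝ^d assume one of K, L has an extreme point, and for X = H^d assume additionally condition (***). Suppose that for each pair of orientation-preserving congruences φ, ψ with int((φK) ∩ (ψL)) ≠ ∅ and each x ∈ bd K, y ∈ bd L there exists ε = ε(K,L,x,y) > 0 such that whenever (A) diam((φK) ∩ (ψL)) < ε, (B) (φK) ∩ (ψL) has a unique inball B₀, and (C) bd((φK) ∩ (ψL)) ∩ bd B₀ = {φx, ψy} with φx ∈ int(ψL) and ψy ∈ int(φK) antipodal on bd B₀, the set (φK) ∩ (ψL) is centrally symmetric. Then the connected components of the boundaries of both K and L are congruent spheres (for S^d of radius at most π/2), or paraspheres, or congruent hyperspheres (degeneration to hyperplanes not admitted); and in the case of congruent spheres or paraspheres, either K and L are congruent balls (for S^d of radius at most π/2) or they are paraballs. -/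

import Mathlib

open Metric Set Filter

namespace BallChar

/-- `X` is (isometric to) the `d`-dimensional round sphere of radius 1,
with the intrinsic (great-circle) metric. -/
def IsSphereSpace (X : Type*) [MetricSpace X] (d : ℕ) : Prop :=
  ∃ e : X → EuclideanSpace ℝ (Fin (d + 1)),
    Function.Injective e ∧
    Set.range e = Metric.sphere (0 : EuclideanSpace ℝ (Fin (d + 1))) 1 ∧
    ∀ x y : X, dist x y = Real.arccos (@inner ℝ _ _ (e x) (e y))

/-- `X` is (isometric to) the `d`-dimensional Euclidean space. -/
def IsEuclideanSpaceForm (X : Type*) [MetricSpace X] (d : ℕ) : Prop :=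
  Nonempty (X ≃ᵢ EuclideanSpace ℝ (Fin d))

/-- The Minkowski bilinear form on `ℝ^d × ℝ`. -/
noncomputable def mink (d : ℕ) (u v : EuclideanSpace ℝ (Fin d) × ℝ) : ℝ :=
  @inner ℝ _ _ u.1 v.1 - u.2 * v.2

/-- `X` is (isometric to) the `d`-dimensional hyperbolic space of curvature `-1`
(the hyperboloid model). -/
def IsHyperbolicSpace (X : Type*) [MetricSpace X] (d : ℕ) : Prop :=
  ∃ e : X → EuclideanSpace ℝ (Fin d) × ℝ,
    Function.Injective e ∧
    Set.range e = {u | mink d u u = -1 ∧ 0 < u.2} ∧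
    ∀ x y : X, Real.cosh (dist x y) = - mink d (e x) (e y)

/-- `X` is `S^d`, `ℝ^d` or `H^d`. -/
def IsSpaceForm (X : Type*) [MetricSpace X] (d : ℕ) : Prop :=
  IsSphereSpace X d ∨ IsEuclideanSpaceForm X d ∨ IsHyperbolicSpace X d

variable {X : Type*} [MetricSpace X]

/-- Metric betweenness: `z` lies on a shortest geodesic from `x` to `y`. -/
def Btw (x z y : X) : Prop := dist x z + dist z y = dist x y

/-- `z` is the unique point between `x` and `y` at its distance from `x`. -/
def UniqueBtwPt (x z y : X) : Prop :=
  Btw x z y ∧ ∀ w, Btw x w y → dist x w = dist x z → w = z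

/-- Geodesic convexity (for two antipodal points of a sphere no condition is imposed). -/
def GConvex (K : Set X) : Prop :=
  ∀ x ∈ K, ∀ y ∈ K, ∀ z, UniqueBtwPt x z y → z ∈ K

/-- `p` is a (metric) midpoint of `x` and `y`. -/
def IsMidpoint (p x y : X) : Prop := Btw x p y ∧ dist x p = dist p y

/-- A reflection in a hyperplane: a non-trivial involutive isometry whose
non-fixed locus is disconnected (by the mirror hyperplane). -/
def IsReflection (σ : X ≃ᵢ X) : Prop :=
  σ.trans σ = IsometryEquiv.refl X ∧ σ ≠ IsometryEquiv.refl X ∧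
    ¬ IsPreconnected {x : X | σ x ≠ x}

/-- An orientation preserving congruence: a product of an even number of reflections. -/
def OrientationPreserving (f : X ≃ᵢ X) : Prop :=
  ∃ l : List (X ≃ᵢ X), (∀ σ ∈ l, IsReflection σ) ∧ Even l.length ∧
    f = l.foldr IsometryEquiv.trans (IsometryEquiv.refl X)

/-- Two subsets are congruent if some isometry of the space maps one onto the other. -/
def Congruent (A B : Set X) : Prop := ∃ f : X ≃ᵢ X, ⇑f '' A = B

/-- `S` admits some non-trivial congruence. -/
def AdmitsNontrivialCongruence (S : Set X) : Prop :=
  ∃ f : X ≃ᵢ X, f ≠ IsometryEquiv.refl X ∧ ⇑f '' S = S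

/-- `S` is axially symmetric (symmetric with respect to some reflection). -/
def AxiallySymmetric (S : Set X) : Prop :=
  ∃ σ : X ≃ᵢ X, IsReflection σ ∧ ⇑σ '' S = S

/-- `S` is centrally symmetric: some involutive isometry fixing a point `p`
maps `S` onto itself, `p` being a midpoint of every pair `x`, `σ x` of `S`. -/
def CentrallySymmetric (S : Set X) : Prop :=
  ∃ (σ : X ≃ᵢ X) (p : X), Function.Involutive ⇑σ ∧ σ p = p ∧ ⇑σ '' S = S ∧
    ∀ x ∈ S, IsMidpoint p x (σ x)

/-- `S` is symmetric with respect to the orthogonal bisector hyperplane of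
the segment `[a, b]`, i.e. invariant under the reflection interchanging `a` and `b`. -/
def SymmetricWrtPerpBisector (S : Set X) (a b : X) : Prop :=
  ∃ σ : X ≃ᵢ X, IsReflection σ ∧ σ a = b ∧ ⇑σ '' S = S

/-- A closed half-space: one of the two closed sides of the mirror of a reflection. -/
def IsHalfspace (P : Set X) : Prop :=
  ∃ σ : X ≃ᵢ X, IsReflection σ ∧ IsClosed P ∧
    P ∪ ⇑σ '' P = univ ∧ P ∩ ⇑σ '' P = {x | σ x = x}

/-- A hyperplane: the mirror (fixed point set) of a reflection. -/
def IsHyperplane (B : Set X) : Prop :=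
  ∃ σ : X ≃ᵢ X, IsReflection σ ∧ B = {x | σ x = x}

/-- A paraball (horoball): a sublevel set of a Busemann function. -/
def IsParaball (K : Set X) : Prop :=
  ∃ γ : ℝ → X, Isometry γ ∧
    K = {x | ∃ b ≤ 0, Tendsto (fun t => dist x (γ t) - t) atTop (nhds b)}

/-- A parasphere (horosphere): the boundary of a paraball. -/
def IsParasphere (C : Set X) : Prop := ∃ K : Set X, IsParaball K ∧ C = frontier K

/-- A hypersphere at distance `lam > 0` from its base hyperplane
(degeneration to a hyperplane excluded). -/
def IsHypersphere (C : Set X) (lam : ℝ) : Prop :=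
  0 < lam ∧ (∃ P : Set X, IsHalfspace P ∧ C = frontier {x | infDist x P ≤ lam}) ∧
    ¬ IsHyperplane C

/-- The family of connected components of the boundary of `K`. -/
def bdryComponents (K : Set X) : Set (Set X) :=
  (connectedComponentIn (frontier K)) '' (frontier K)

/-- `closedBall p r` is an inball of `M` (a ball of maximal radius contained in `M`). -/
def IsInball (M : Set X) (p : X) (r : ℝ) : Prop :=
  0 ≤ r ∧ closedBall p r ⊆ M ∧ ∀ (q : X) (s : ℝ), closedBall q s ⊆ M → s ≤ r

/-- `closedBall p r` is the unique inball of `M`. -/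
def HasUniqueInball (M : Set X) (p : X) (r : ℝ) : Prop :=
  IsInball M p r ∧ ∀ (q : X) (s : ℝ), IsInball M q s → q = p

/-- The (geodesic) convex hull of a set. -/
def gconvexHull (Y : Set X) : Set X := ⋂₀ {C : Set X | GConvex C ∧ Y ⊆ C}

/-- `z` lies on the complete geodesic line through `a` and `b`. -/
def OnLine (a b z : X) : Prop := Btw a z b ∨ Btw z a b ∨ Btw a b z

/-- The closed `(d-1)`-ball of radius `ε` centred at `a` in the hyperplane through `a`
orthogonal to the segment `[a, b]`. -/
def perpDisc (a b : X) (ε : ℝ) : Set X :=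
  {x | (∀ z, OnLine a b z → dist x a ≤ dist x z) ∧ dist x a ≤ ε}

/-- The set `D(ε)` associated to the segment `D = [a, b]`: the convex hull of the two
`(d-1)`-balls of radius `ε` orthogonal to `D` at its endpoints. -/
def segCyl (a b : X) (ε : ℝ) : Set X :=
  gconvexHull (perpDisc a b ε ∪ perpDisc b a ε)

/-- `[a, b]` is the unique diametral segment of `M`. -/
def UniqueDiametral (M : Set X) (a b : X) : Prop :=
  a ∈ M ∧ b ∈ M ∧ a ≠ b ∧ dist a b = diam M ∧
    ∀ a' ∈ M, ∀ b' ∈ M, dist a' b' = diam M → (a' = a ∧ b' = b) ∨ (a' = b ∧ b' = a)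

/-- Condition (**): at every boundary point, `K` contains a ball having this point
on its boundary. -/
def CondBallInside (K : Set X) : Prop :=
  ∀ x ∈ frontier K, ∃ ε > 0, ∃ p : X, closedBall p ε ⊆ K ∧ x ∈ sphere p ε

/-- `K` has an extreme point. -/
def HasExtremePoint (K : Set X) : Prop :=
  ∃ x ∈ K, ∀ y ∈ K, ∀ z ∈ K, Btw y x z → x = y ∨ x = z

/-- Condition (***): near every boundary point, `K` is contained in a ball
(resp. in a convex set bounded by a hypersphere, for hyperbolic space) whose boundary
has sectional curvatures bounded below and passes through the given point. -/
def CondCurvBound (d : ℕ) (K : Set X) : Prop :=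
  ∀ x ∈ frontier K, ∃ ε > 0, ∃ B : Set X,
    {y | y ∈ K ∧ dist y x ≤ ε} ⊆ B ∧ x ∈ frontier B ∧
    (IsSphereSpace X d → ∃ (q : X) (R : ℝ), 0 < R ∧ R < Real.pi / 2 ∧
        ε ≤ Real.cos R / Real.sin R ∧ B = closedBall q R) ∧
    (IsEuclideanSpaceForm X d → ∃ (q : X) (R : ℝ), 0 < R ∧ ε ≤ 1 / R ∧ B = closedBall q R) ∧
    (IsHyperbolicSpace X d → ∃ (P : Set X) (lam : ℝ), IsHalfspace P ∧ 0 < lam ∧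
        ε ≤ Real.tanh lam ∧ B = {y | infDist y P ≤ lam})

/-- `K` has a supporting sphere at each of its boundary points
(for the sphere, of radius less than `π/2`). -/
def SupportingSpheres (d : ℕ) (K : Set X) : Prop :=
  ∀ x ∈ frontier K, ∃ (p : X) (R : ℝ), 0 < R ∧ K ⊆ closedBall p R ∧ x ∈ sphere p R ∧
    (IsSphereSpace X d → R < Real.pi / 2)

/-- `K` is `C¹` (smooth): at each boundary point there is a unique supporting half-space. -/
def SmoothBody (K : Set X) : Prop :=
  ∀ x ∈ frontier K, ∃! P : Set X, IsHalfspace P ∧ K ⊆ P ∧ x ∈ frontier P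

/-- A complete geodesic (straight line). -/
def IsGeodesicLine (B : Set X) : Prop := ∃ γ : ℝ → X, Isometry γ ∧ B = Set.range γ

/-- A circle (closed disc) of positive radius. -/
def IsDisc (K : Set X) : Prop := ∃ (p : X) (r : ℝ), 0 < r ∧ K = closedBall p r

/-- The parallel domain of `B` at distance `l`. -/
def parallelDomain (B : Set X) (l : ℝ) : Set X := {x | infDist x B ≤ l}

/-- `K` is the parallel domain of some straight line, at some distance `l > 0`. -/
def IsParallelDomain (K : Set X) : Prop :=
  ∃ (B : Set X) (l : ℝ), IsGeodesicLine B ∧ 0 < l ∧ K = parallelDomain B l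

/-- A convex domain bounded by a (proper) hypercycle. -/
def IsHypercycleDomain (K : Set X) : Prop :=
  ∃ (P : Set X) (l : ℝ), IsHalfspace P ∧ 0 < l ∧ K = {x | infDist x P ≤ l}

/-- `C` is a hypercycle or a straight line (a curve at constant distance `l ≥ 0`
from its base line). -/
def IsHypercycleOrLine (C : Set X) : Prop :=
  ∃ (P : Set X) (l : ℝ), IsHalfspace P ∧ 0 ≤ l ∧ C = frontier {x | infDist x P ≤ l}

/-- `C` is a hypercycle (or straight line) with base line `B`. -/
def HypercycleWithBase (C B : Set X) : Prop :=
  ∃ (P : Set X) (l : ℝ), IsHalfspace P ∧ 0 ≤ l ∧ frontier P = B ∧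
    C = frontier {x | infDist x P ≤ l}


/-! Cases (A)-(E) of Theorem 5 (hyperbolic plane). -/

/-- One of the basic bodies of case (A). -/
def CaseABody (K : Set X) : Prop :=
  IsDisc K ∨ IsParaball K ∨ IsHypercycleDomain K ∨ IsHalfspace K

/-- Case (A) of Theorem 5. -/
def CaseA (K L : Set X) : Prop :=
  CaseABody K ∧ CaseABody L ∧
    ((IsHypercycleDomain K ∨ IsHalfspace K) → IsDisc L ∨ Congruent K L) ∧
    ((IsHypercycleDomain L ∨ IsHalfspace L) → IsDisc K ∨ Congruent L K)

/-- `M` is bounded either by two hypercycles whose base lines coincide, or by a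
hypercycle and its base line. -/
def TwoHypSameBase (M : Set X) : Prop :=
  ∃ (B C₁ C₂ : Set X), IsGeodesicLine B ∧ C₁ ≠ C₂ ∧
    HypercycleWithBase C₁ B ∧ HypercycleWithBase C₂ B ∧ frontier M = C₁ ∪ C₂

/-- Case (B) of Theorem 5. -/
def CaseB (K L : Set X) : Prop :=
  (IsDisc K ∧ TwoHypSameBase L) ∨ (IsDisc L ∧ TwoHypSameBase K)

/-- `M` is bounded by at least two hypercycles or straight lines, with all base lines
different, whose mutual distances are at least `2r`. -/
def MultiHypFarApart (M : Set X) (r : ℝ) : Prop :=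
  (∀ x ∈ frontier M, IsHypercycleOrLine (connectedComponentIn (frontier M) x)) ∧
  (∃ x ∈ frontier M, ∃ y ∈ frontier M,
      connectedComponentIn (frontier M) x ≠ connectedComponentIn (frontier M) y) ∧
  (∀ x ∈ frontier M, ∀ y ∈ frontier M,
      connectedComponentIn (frontier M) x ≠ connectedComponentIn (frontier M) y →
        2 * r ≤ dist x y ∧
        ∀ B₁ B₂ : Set X, HypercycleWithBase (connectedComponentIn (frontier M) x) B₁ →
          HypercycleWithBase (connectedComponentIn (frontier M) y) B₂ → B₁ ≠ B₂)

/-- Case (C) of Theorem 5. -/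
def CaseC (K L : Set X) : Prop :=
  (∃ (p : X) (r : ℝ), 0 < r ∧ K = closedBall p r ∧ MultiHypFarApart L r) ∨
  (∃ (p : X) (r : ℝ), 0 < r ∧ L = closedBall p r ∧ MultiHypFarApart K r)

/-- Case (D) of Theorem 5. -/
def CaseD (K L : Set X) : Prop :=
  (IsParaball K ∧ IsParallelDomain L) ∨ (IsParaball L ∧ IsParallelDomain K)

/-- Case (E) of Theorem 5. -/
def CaseE (K L : Set X) : Prop :=
  Congruent K L ∧ IsParallelDomain K ∧ IsParallelDomain L

/-- All cases of (3) of Theorem 5 together. -/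
def Theorem5Cases (K L : Set X) : Prop :=
  CaseA K L ∨ CaseB K L ∨ CaseC K L ∨ CaseD K L ∨ CaseE K L

/-- Condition (1) of Theorem 5: every intersection of congruent copies admits some
non-trivial congruence. -/
def T5Cond1 (K L : Set X) : Prop :=
  ∀ φ ψ : X ≃ᵢ X, OrientationPreserving φ → OrientationPreserving ψ →
    (interior ((⇑φ '' K) ∩ (⇑ψ '' L))).Nonempty →
    AdmitsNontrivialCongruence ((⇑φ '' K) ∩ (⇑ψ '' L))

/-- Condition (2) of Theorem 5: every intersection of congruent copies is axially
symmetric. -/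
def T5Cond2 (K L : Set X) : Prop :=
  ∀ φ ψ : X ≃ᵢ X, OrientationPreserving φ → OrientationPreserving ψ →
    (interior ((⇑φ '' K) ∩ (⇑ψ '' L))).Nonempty →
    AxiallySymmetric ((⇑φ '' K) ∩ (⇑ψ '' L))

/-- All connected components of the boundary of `K` are hypercycles or straight lines. -/
def BdryHypOrLine (K : Set X) : Prop :=
  ∀ x ∈ frontier K, IsHypercycleOrLine (connectedComponentIn (frontier K) x)

/-- The boundary of `K` has at least two connected components. -/
def AtLeastTwoComponents (K : Set X) : Prop :=
  ∃ x ∈ frontier K, ∃ y ∈ frontier K,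
    connectedComponentIn (frontier K) x ≠ connectedComponentIn (frontier K) y

/-- The boundary of `K` is nonempty and has a single connected component. -/
def SingleComponent (K : Set X) : Prop :=
  (frontier K).Nonempty ∧ ∀ x ∈ frontier K, ∀ y ∈ frontier K,
    connectedComponentIn (frontier K) x = connectedComponentIn (frontier K) y

/-- The associated graph of `K` contains two edges with at least one common endpoint:
`K` has two distinct boundary components which are asymptotic (come arbitrarily close). -/
def TwoAsymptoticComponents (K : Set X) : Prop :=
  ∃ x ∈ frontier K, ∃ y ∈ frontier K,
    connectedComponentIn (frontier K) x ≠ connectedComponentIn (frontier K) y ∧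
    ∀ δ > (0 : ℝ), ∃ p ∈ connectedComponentIn (frontier K) x,
      ∃ q ∈ connectedComponentIn (frontier K) y, dist p q < δ

/-- The associated graph of `K` has only pairwise vertex-disjoint edges: distinct
boundary components of `K` stay at positive distance from each other. -/
def VertexDisjointEdges (K : Set X) : Prop :=
  ∀ x ∈ frontier K, ∀ y ∈ frontier K,
    connectedComponentIn (frontier K) x ≠ connectedComponentIn (frontier K) y →
      ∃ δ > (0 : ℝ), ∀ p ∈ connectedComponentIn (frontier K) x,
        ∀ q ∈ connectedComponentIn (frontier K) y, δ ≤ dist p q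

/-! Conditions of Theorem 6. -/

/-- Condition (1) of Theorem 6. -/
def T6Cond1 (K L : Set X) : Prop :=
  ∃ ε > (0 : ℝ), ∀ φ ψ : X ≃ᵢ X, OrientationPreserving φ → OrientationPreserving ψ →
    (interior ((⇑φ '' K) ∩ (⇑ψ '' L))).Nonempty →
    diam ((⇑φ '' K) ∩ (⇑ψ '' L)) < ε →
    CentrallySymmetric ((⇑φ '' K) ∩ (⇑ψ '' L))

/-- Condition (2) of Theorem 6. -/
def T6Cond2 (K L : Set X) : Prop :=
  ∀ x ∈ frontier K, ∀ y ∈ frontier L, ∃ ε > (0 : ℝ),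
    ∀ φ ψ : X ≃ᵢ X, OrientationPreserving φ → OrientationPreserving ψ →
      (interior ((⇑φ '' K) ∩ (⇑ψ '' L))).Nonempty →
      diam ((⇑φ '' K) ∩ (⇑ψ '' L)) < ε →
      ∀ (p : X) (r : ℝ), HasUniqueInball ((⇑φ '' K) ∩ (⇑ψ '' L)) p r →
        frontier ((⇑φ '' K) ∩ (⇑ψ '' L)) ∩ sphere p r = {φ x, ψ y} →
        φ x ∈ interior (⇑ψ '' L) → ψ y ∈ interior (⇑φ '' K) →
        IsMidpoint p (φ x) (ψ y) →
        CentrallySymmetric ((⇑φ '' K) ∩ (⇑ψ '' L))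

/-- Condition (3) of Theorem 6. -/
def T6Cond3 (K L : Set X) : Prop :=
  ∀ x ∈ frontier K, ∀ y ∈ frontier L, ∃ ε > (0 : ℝ),
    ∀ φ ψ : X ≃ᵢ X, OrientationPreserving φ → OrientationPreserving ψ →
      (interior ((⇑φ '' K) ∩ (⇑ψ '' L))).Nonempty →
      diam ((⇑φ '' K) ∩ (⇑ψ '' L)) < ε →
      ∀ (p : X) (r : ℝ), HasUniqueInball ((⇑φ '' K) ∩ (⇑ψ '' L)) p r →
        frontier ((⇑φ '' K) ∩ (⇑ψ '' L)) ∩ sphere p r = {φ x, ψ y} →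
        φ x ∈ interior (⇑ψ '' L) → ψ y ∈ interior (⇑φ '' K) →
        IsMidpoint p (φ x) (ψ y) →
        SymmetricWrtPerpBisector ((⇑φ '' K) ∩ (⇑ψ '' L)) (φ x) (ψ y)

/-- Condition (4) of Theorem 6. -/
def T6Cond4 (d : ℕ) (K L : Set X) : Prop :=
  (∃ r > (0 : ℝ), (IsSphereSpace X d → r ≤ Real.pi / 2) ∧
      (∀ C ∈ bdryComponents K ∪ bdryComponents L, ∃ p : X, C = sphere p r) ∧
      (∃ p : X, K = closedBall p r) ∧ ∃ q : X, L = closedBall q r) ∨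
  ((∀ C ∈ bdryComponents K ∪ bdryComponents L, IsParasphere C) ∧
      IsParaball K ∧ IsParaball L) ∨
  (∃ lam > (0 : ℝ), ∀ C ∈ bdryComponents K ∪ bdryComponents L, IsHypersphere C lam)

/-! Conditions of Theorems 7 and 8. -/

/-- The pair `φ, ψ` is admissible for hypothesis (****): both are orientation
preserving, and for the sphere `(φ K) ∪ (ψ L)` lies in an open hemisphere. -/
def GoodPair (d : ℕ) (K L : Set X) (φ ψ : X ≃ᵢ X) : Prop :=
  OrientationPreserving φ ∧ OrientationPreserving ψ ∧
    (IsSphereSpace X d → ∃ s : X, (⇑φ '' K) ∪ (⇑ψ '' L) ⊆ ball s (Real.pi / 2))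

/-- The convex hull of the union of the two congruent copies. -/
def hullUnion (K L : Set X) (φ ψ : X ≃ᵢ X) : Set X := gconvexHull ((⇑φ '' K) ∪ (⇑ψ '' L))

/-- Condition (A) of (3) of Theorem 7: the diameter of `M` is sufficiently close to `π`
(sphere), resp. sufficiently large (Euclidean, hyperbolic), as measured by `δ`. -/
def BigDiam (d : ℕ) (X : Type*) [MetricSpace X] (M : Set X) (δ : ℝ) : Prop :=
  (IsSphereSpace X d → Real.pi - δ < diam M) ∧ (¬ IsSphereSpace X d → 1 / δ < diam M)

/-- Condition (1) of Theorem 7. -/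
def T7Cond1 (d : ℕ) (K L : Set X) : Prop :=
  ∀ φ ψ : X ≃ᵢ X, GoodPair d K L φ ψ → CentrallySymmetric (hullUnion K L φ ψ)

/-- Condition (2) of Theorem 7. -/
def T7Cond2 (d : ℕ) (K L : Set X) : Prop :=
  ∀ φ ψ : X ≃ᵢ X, GoodPair d K L φ ψ → ∀ a b : X, UniqueDiametral (hullUnion K L φ ψ) a b →
    SymmetricWrtPerpBisector (hullUnion K L φ ψ) a b

/-- Condition (3) of Theorem 7. -/
def T7Cond3 (d : ℕ) (K L : Set X) : Prop :=
  ∃ δ > (0 : ℝ), ∀ φ ψ : X ≃ᵢ X, GoodPair d K L φ ψ →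
    ∀ x ∈ frontier K, ∀ y ∈ frontier L,
      BigDiam d X (hullUnion K L φ ψ) δ →
      UniqueDiametral (hullUnion K L φ ψ) (φ x) (ψ y) →
      CentrallySymmetric (hullUnion K L φ ψ)

/-- Condition (4) of Theorem 7. -/
def T7Cond4 (d : ℕ) (K L : Set X) : Prop :=
  ∃ δ > (0 : ℝ), ∀ φ ψ : X ≃ᵢ X, GoodPair d K L φ ψ →
    ∀ x ∈ frontier K, ∀ y ∈ frontier L,
      BigDiam d X (hullUnion K L φ ψ) δ →
      UniqueDiametral (hullUnion K L φ ψ) (φ x) (ψ y) →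
      SymmetricWrtPerpBisector (hullUnion K L φ ψ) (φ x) (ψ y)

/-- Condition (5) of Theorem 7. -/
def T7Cond5 (d : ℕ) (K L : Set X) : Prop :=
  ∃ δ > (0 : ℝ), ∀ φ ψ : X ≃ᵢ X, GoodPair d K L φ ψ →
    ∀ x ∈ frontier K, ∀ y ∈ frontier L,
      BigDiam d X (hullUnion K L φ ψ) δ →
      UniqueDiametral (hullUnion K L φ ψ) (φ x) (ψ y) →
      ∃ ε₀ > (0 : ℝ), ∀ ε : ℝ, 0 < ε → ε < ε₀ →
        (IsSphereSpace X d → ∃ s : X, (⇑φ '' K) ∪ (⇑ψ '' L) ⊆ ball s (Real.pi / 2) ∧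
            segCyl (φ x) (ψ y) ε ⊆ ball s (Real.pi / 2)) ∧
        CentrallySymmetric (hullUnion K L φ ψ ∩ segCyl (φ x) (ψ y) ε)

/-- Condition (6) of Theorem 7. -/
def T7Cond6 (d : ℕ) (K L : Set X) : Prop :=
  ∃ δ > (0 : ℝ), ∀ φ ψ : X ≃ᵢ X, GoodPair d K L φ ψ →
    ∀ x ∈ frontier K, ∀ y ∈ frontier L,
      BigDiam d X (hullUnion K L φ ψ) δ →
      UniqueDiametral (hullUnion K L φ ψ) (φ x) (ψ y) →
      ∃ ε₀ > (0 : ℝ), ∀ ε : ℝ, 0 < ε → ε < ε₀ →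
        (IsSphereSpace X d → ∃ s : X, (⇑φ '' K) ∪ (⇑ψ '' L) ⊆ ball s (Real.pi / 2) ∧
            segCyl (φ x) (ψ y) ε ⊆ ball s (Real.pi / 2)) ∧
        SymmetricWrtPerpBisector (hullUnion K L φ ψ ∩ segCyl (φ x) (ψ y) ε) (φ x) (ψ y)

/-- Condition (7) of Theorem 7: `K` and `L` are congruent balls. -/
def T7Cond7 (d : ℕ) (K L : Set X) : Prop :=
  ∃ r > (0 : ℝ), (IsSphereSpace X d → r < Real.pi / 2) ∧
    (∃ p : X, K = closedBall p r) ∧ ∃ q : X, L = closedBall q r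

/-- Condition (1) of Theorem 8. -/
def T8Cond1 (K L : Set X) : Prop :=
  ∀ φ ψ : X ≃ᵢ X, GoodPair 2 K L φ ψ → AxiallySymmetric (hullUnion K L φ ψ)

/-- Condition (2) of Theorem 8. -/
def T8Cond2 (K L : Set X) : Prop :=
  ∀ φ ψ : X ≃ᵢ X, GoodPair 2 K L φ ψ → AdmitsNontrivialCongruence (hullUnion K L φ ψ)

/-- Condition (3) of Theorem 8. -/
def T8Cond3 (K L : Set X) : Prop :=
  ∃ δ > (0 : ℝ), ∀ φ ψ : X ≃ᵢ X, GoodPair 2 K L φ ψ →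
    ∀ x ∈ frontier K, ∀ y ∈ frontier L,
      BigDiam 2 X (hullUnion K L φ ψ) δ →
      UniqueDiametral (hullUnion K L φ ψ) (φ x) (ψ y) →
      AxiallySymmetric (hullUnion K L φ ψ)

/-- Condition (4) of Theorem 8. -/
def T8Cond4 (K L : Set X) : Prop :=
  ∃ δ > (0 : ℝ), ∀ φ ψ : X ≃ᵢ X, GoodPair 2 K L φ ψ →
    ∀ x ∈ frontier K, ∀ y ∈ frontier L,
      BigDiam 2 X (hullUnion K L φ ψ) δ →
      UniqueDiametral (hullUnion K L φ ψ) (φ x) (ψ y) →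
      AdmitsNontrivialCongruence (hullUnion K L φ ψ)

/-- Condition (5) of Theorem 8. -/
def T8Cond5 (K L : Set X) : Prop :=
  ∃ δ > (0 : ℝ), ∀ φ ψ : X ≃ᵢ X, GoodPair 2 K L φ ψ →
    ∀ x ∈ frontier K, ∀ y ∈ frontier L,
      BigDiam 2 X (hullUnion K L φ ψ) δ →
      UniqueDiametral (hullUnion K L φ ψ) (φ x) (ψ y) →
      ∃ ε₀ > (0 : ℝ), ∀ ε : ℝ, 0 < ε → ε < ε₀ →
        (IsSphereSpace X 2 → ∃ s : X, (⇑φ '' K) ∪ (⇑ψ '' L) ⊆ ball s (Real.pi / 2) ∧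
            segCyl (φ x) (ψ y) ε ⊆ ball s (Real.pi / 2)) ∧
        AxiallySymmetric (hullUnion K L φ ψ ∩ segCyl (φ x) (ψ y) ε)

/-- Condition (6) of Theorem 8. -/
def T8Cond6 (K L : Set X) : Prop :=
  ∃ δ > (0 : ℝ), ∀ φ ψ : X ≃ᵢ X, GoodPair 2 K L φ ψ →
    ∀ x ∈ frontier K, ∀ y ∈ frontier L,
      BigDiam 2 X (hullUnion K L φ ψ) δ →
      UniqueDiametral (hullUnion K L φ ψ) (φ x) (ψ y) →
      ∃ ε₀ > (0 : ℝ), ∀ ε : ℝ, 0 < ε → ε < ε₀ →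
        (IsSphereSpace X 2 → ∃ s : X, (⇑φ '' K) ∪ (⇑ψ '' L) ⊆ ball s (Real.pi / 2) ∧
            segCyl (φ x) (ψ y) ε ⊆ ball s (Real.pi / 2)) ∧
        AdmitsNontrivialCongruence (hullUnion K L φ ψ ∩ segCyl (φ x) (ψ y) ε)

/-- Condition (7) of Theorem 8: `K` and `L` are (in general incongruent) circles. -/
def T8Cond7 (K L : Set X) : Prop :=
  ∃ (p q : X) (r s : ℝ), 0 < r ∧ 0 < s ∧
    (IsSphereSpace X 2 → r < Real.pi / 2 ∧ s < Real.pi / 2) ∧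
    K = closedBall p r ∧ L = closedBall q s

/-- The three types of geometry. -/
inductive Geo
  | sph
  | euc
  | hyp

namespace Geo

/-- The curvature. -/
def k : Geo → ℝ
  | sph => 1
  | euc => 0
  | hyp => -1

/-- The generalized cosine. -/
noncomputable def Co : Geo → ℝ → ℝ
  | sph, t => Real.cos t
  | euc, _ => 1
  | hyp, t => Real.cosh t

/-- The generalized sine. -/
noncomputable def Sn : Geo → ℝ → ℝ
  | sph, t => Real.sin t
  | euc, t => t
  | hyp, t => Real.sinh t

/-- The generalized versine. -/
noncomputable def ps : Geo → ℝ → ℝ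
  | sph, t => 1 - Real.cos t
  | euc, t => t ^ 2 / 2
  | hyp, t => Real.cosh t - 1

/-- The admissible distances. -/
def Val (g : Geo) (t : ℝ) : Prop := 0 ≤ t ∧ (g = sph → t ≤ Real.pi)

variable (g : Geo)

theorem Co_eq (t : ℝ) : g.Co t = 1 - g.k * g.ps t := by
  cases g <;> simp [Co, k, ps]

theorem Sn_sq (t : ℝ) : g.Sn t ^ 2 = 2 * g.ps t - g.k * g.ps t ^ 2 := by
  cases g
  · simp only [Sn, k, ps]; nlinarith [Real.sin_sq_add_cos_sq t]
  · simp only [Sn, k, ps]; ring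
  · simp only [Sn, k, ps]; nlinarith [Real.cosh_sq t]

theorem Co_sq_add (t : ℝ) : g.Co t ^ 2 + g.k * g.Sn t ^ 2 = 1 := by
  rw [Co_eq, Sn_sq]
  cases g <;> simp only [k] <;> ring

@[simp] theorem ps_zero : g.ps 0 = 0 := by cases g <;> simp [ps]

@[simp] theorem Sn_zero : g.Sn 0 = 0 := by cases g <;> simp [Sn]

@[simp] theorem Co_zero : g.Co 0 = 1 := by cases g <;> simp [Co]

theorem ps_neg (t : ℝ) : g.ps (-t) = g.ps t := by cases g <;> simp [ps]

theorem Sn_neg (t : ℝ) : g.Sn (-t) = -g.Sn t := by cases g <;> simp [Sn]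

theorem Co_neg (t : ℝ) : g.Co (-t) = g.Co t := by cases g <;> simp [Co]

theorem Sn_add (a b : ℝ) : g.Sn (a + b) = g.Sn a * g.Co b + g.Co a * g.Sn b := by
  cases g
  · exact Real.sin_add a b
  · simp [Sn, Co]
  · exact Real.sinh_add a b

theorem Sn_sub (a b : ℝ) : g.Sn (a - b) = g.Sn a * g.Co b - g.Co a * g.Sn b := by
  rw [sub_eq_add_neg, Sn_add, Sn_neg, Co_neg]; ring

theorem ps_add (a b : ℝ) :
    g.ps (a + b) = g.ps a + g.ps b - g.k * g.ps a * g.ps b + g.Sn a * g.Sn b := by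
  cases g
  · simp only [ps, Sn, k, Real.cos_add]; ring
  · simp only [ps, Sn, k]; ring
  · simp only [ps, Sn, k, Real.cosh_add]; ring

theorem ps_sub (a b : ℝ) :
    g.ps (a - b) = g.ps a + g.ps b - g.k * g.ps a * g.ps b - g.Sn a * g.Sn b := by
  rw [sub_eq_add_neg, ps_add, Sn_neg, ps_neg]; ring

theorem ps_nonneg (t : ℝ) : 0 ≤ g.ps t := by
  cases g
  · simp only [ps]; linarith [Real.cos_le_one t]
  · simp only [ps]; positivity
  · simp only [ps]; linarith [Real.one_le_cosh t]

theorem k_ps_le (t : ℝ) : g.k * g.ps t ≤ 2 := by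
  cases g
  · simp only [ps, k]; linarith [Real.neg_one_le_cos t]
  · simp [ps, k]
  · simp only [ps, k]; linarith [Real.one_le_cosh t]

theorem ps_strictMonoOn : StrictMonoOn g.ps {t | g.Val t} := by
  rintro a ⟨ha, ha'⟩ b ⟨hb, hb'⟩ h
  cases g
  · simp only [ps]
    linarith [Real.cos_lt_cos_of_nonneg_of_le_pi ha (hb' rfl) h]
  · simp only [ps]; nlinarith
  · simp only [ps]
    have := Real.cosh_strictMonoOn ha hb h
    linarith

theorem ps_lt {a b : ℝ} (ha : g.Val a) (hb : g.Val b) : g.ps a < g.ps b ↔ a < b :=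
  g.ps_strictMonoOn.lt_iff_lt ha hb

theorem ps_le {a b : ℝ} (ha : g.Val a) (hb : g.Val b) : g.ps a ≤ g.ps b ↔ a ≤ b :=
  g.ps_strictMonoOn.le_iff_le ha hb

theorem ps_inj {a b : ℝ} (ha : g.Val a) (hb : g.Val b) (h : g.ps a = g.ps b) : a = b :=
  g.ps_strictMonoOn.injOn ha hb h

theorem val_zero : g.Val 0 := ⟨le_rfl, fun _ => Real.pi_pos.le⟩

theorem ps_pos {t : ℝ} (ht : g.Val t) (h : 0 < t) : 0 < g.ps t := by
  have := (g.ps_lt g.val_zero ht).2 h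
  simpa using this

theorem exists_ps {r : ℝ} (h0 : 0 ≤ r) (h2 : g.k * r ≤ 2) : ∃ t, g.Val t ∧ g.ps t = r := by
  cases g
  · simp only [k] at h2
    refine ⟨Real.arccos (1 - r), ⟨Real.arccos_nonneg _, fun _ => Real.arccos_le_pi _⟩, ?_⟩
    simp only [ps]
    rw [Real.cos_arccos (by linarith) (by linarith)]; ring
  · refine ⟨Real.sqrt (2 * r), ⟨Real.sqrt_nonneg _, by simp⟩, ?_⟩
    simp only [ps]
    rw [Real.sq_sqrt (by linarith)]; ring
  · refine ⟨Real.arcosh (1 + r), ⟨Real.arcosh_nonneg (by linarith), by simp⟩, ?_⟩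
    simp only [ps]
    rw [Real.cosh_arcosh (by linarith)]; ring

theorem Sn_pos {t : ℝ} (h : 0 < t) (h' : g = sph → t < Real.pi) : 0 < g.Sn t := by
  cases g
  · exact Real.sin_pos_of_pos_of_lt_pi h (h' rfl)
  · exact h
  · exact Real.sinh_pos_iff.2 h

theorem Sn_nonneg {t : ℝ} (h : g.Val t) : 0 ≤ g.Sn t := by
  cases g
  · exact Real.sin_nonneg_of_nonneg_of_le_pi h.1 (h.2 rfl)
  · exact h.1
  · exact Real.sinh_nonneg_iff.2 h.1

theorem continuous_Co : Continuous g.Co := by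
  cases g
  · exact Real.continuous_cos
  · exact continuous_const
  · exact Real.continuous_cosh

theorem continuous_Sn : Continuous g.Sn := by
  cases g
  · exact Real.continuous_sin
  · exact continuous_id
  · exact Real.continuous_sinh

theorem continuous_ps : Continuous g.ps := by
  cases g
  · exact continuous_const.sub Real.continuous_cos
  · exact (continuous_pow 2).div_const 2
  · exact Real.continuous_cosh.sub continuous_const

theorem k_cases : g.k = 1 ∨ g.k = 0 ∨ g.k = -1 := by cases g <;> simp [k]

theorem k_le_one : g.k ≤ 1 := by cases g <;> simp [k]

theorem neg_one_le_k : -1 ≤ g.k := by cases g <;> simp [k]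

end Geo

/-- The coordinate space of charts. -/
abbrev Vec (d : ℕ) := EuclideanSpace ℝ (Fin d)

/-- Normalized coordinates on a space form: `n` is the spatial part of the quadric model and
`s` is the versine of the distance from the (possibly virtual) origin. -/
structure Chart (g : Geo) (d : ℕ) (X : Type*) [MetricSpace X] where
  n : X → Vec d
  s : X → ℝ
  s_nonneg : ∀ z, 0 ≤ s z
  norm_n : ∀ z, ‖n z‖ ^ 2 = 2 * s z - g.k * s z ^ 2
  surj : ∀ (v : Vec d) (r : ℝ), 0 ≤ r → ‖v‖ ^ 2 = 2 * r - g.k * r ^ 2 → ∃ z, n z = v ∧ s z = r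
  ps_dist : ∀ z w, g.ps (dist z w) = s z + s w - g.k * s z * s w - inner ℝ (n z) (n w)
  le_pi : g = Geo.sph → ∀ z w : X, dist z w ≤ Real.pi

section
variable {g : Geo} {d : ℕ} {X : Type*} [MetricSpace X]

/-- The versine of the distance. -/
noncomputable def qd (g : Geo) {X : Type*} [MetricSpace X] (z w : X) : ℝ := g.ps (dist z w)

theorem qd_comm (z w : X) : qd g z w = qd g w z := by rw [qd, qd, dist_comm]

theorem qd_self (z : X) : qd g z z = 0 := by simp [qd]

theorem qd_nonneg (z w : X) : 0 ≤ qd g z w := g.ps_nonneg _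

theorem qd_isom (f : X ≃ᵢ X) (z w : X) : qd g (f z) (f w) = qd g z w := by
  rw [qd, qd, f.dist_eq]

theorem continuous_qd (z : X) : Continuous (qd g z) :=
  g.continuous_ps.comp (continuous_const.dist continuous_id)

namespace Chart
variable (C : Chart g d X)

theorem qd_eq (z w : X) : qd g z w = C.s z + C.s w - g.k * C.s z * C.s w - inner ℝ (C.n z) (C.n w) :=
  C.ps_dist z w

/-- The generalized cosine of the distance from the origin. -/
noncomputable def t (z : X) : ℝ := 1 - g.k * C.s z

theorem t_def (z : X) : C.t z = 1 - g.k * C.s z := rfl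

theorem t_sq (z : X) : C.t z ^ 2 + g.k * ‖C.n z‖ ^ 2 = 1 := by
  rw [t, C.norm_n]; ring

theorem k_s_le (z : X) : g.k * C.s z ≤ 2 := by
  have h1 := C.norm_n z
  have h2 := C.s_nonneg z
  have h3 := sq_nonneg ‖C.n z‖
  rcases g.k_cases with h | h | h <;> rw [h] at h1 ⊢ <;> nlinarith

include C in
theorem val (z w : X) : g.Val (dist z w) := ⟨dist_nonneg, fun h => C.le_pi h z w⟩

include C in
theorem qd_eq_zero {z w : X} : qd g z w = 0 ↔ z = w := by
  constructor
  · intro h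
    have := g.ps_inj (C.val z w) g.val_zero (by rw [g.ps_zero]; exact h)
    exact dist_eq_zero.1 this
  · rintro rfl; exact qd_self _

include C in
theorem qd_pos {z w : X} (h : z ≠ w) : 0 < qd g z w :=
  lt_of_le_of_ne (qd_nonneg _ _) fun h' => h (C.qd_eq_zero.1 h'.symm)

include C in
theorem dist_eq_of_qd {z w z' w' : X} (h : qd g z w = qd g z' w') : dist z w = dist z' w' :=
  g.ps_inj (C.val z w) (C.val z' w') h

include C in
theorem qd_le_of {z w : X} {r : ℝ} (hr : g.Val r) : qd g z w ≤ g.ps r ↔ dist z w ≤ r :=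
  g.ps_le (C.val z w) hr

include C in
theorem qd_lt_of {z w : X} {r : ℝ} (hr : g.Val r) : qd g z w < g.ps r ↔ dist z w < r :=
  g.ps_lt (C.val z w) hr

theorem norm_sub (z w : X) :
    ‖C.n z - C.n w‖ ^ 2 = 2 * qd g z w - g.k * (C.s z - C.s w) ^ 2 := by
  rw [norm_sub_sq_real, C.norm_n, C.norm_n, C.qd_eq]; ring

theorem ext_pt {z w : X} (hn : C.n z = C.n w) (hs : C.s z = C.s w) : z = w := by
  have := C.norm_sub z w
  rw [hn, hs] at this
  simp at this
  exact C.qd_eq_zero.1 this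

/-- The point with given coordinates. -/
noncomputable def pt (v : Vec d) (r : ℝ) (hr : 0 ≤ r) (h : ‖v‖ ^ 2 = 2 * r - g.k * r ^ 2) : X :=
  (C.surj v r hr h).choose

@[simp] theorem n_pt (v : Vec d) (r : ℝ) (hr : 0 ≤ r) (h) : C.n (C.pt v r hr h) = v :=
  (C.surj v r hr h).choose_spec.1

@[simp] theorem s_pt (v : Vec d) (r : ℝ) (hr : 0 ≤ r) (h) : C.s (C.pt v r hr h) = r :=
  (C.surj v r hr h).choose_spec.2

/-- The isometry matching two charts. -/
noncomputable def equiv (C C' : Chart g d X) : X ≃ᵢ X where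
  toFun z := C.pt (C'.n z) (C'.s z) (C'.s_nonneg z) (C'.norm_n z)
  invFun z := C'.pt (C.n z) (C.s z) (C.s_nonneg z) (C.norm_n z)
  left_inv z := C'.ext_pt (by simp) (by simp)
  right_inv z := C.ext_pt (by simp) (by simp)
  isometry_toFun := by
    refine Isometry.of_dist_eq fun z w => C.dist_eq_of_qd ?_
    rw [C.qd_eq, C'.qd_eq]; simp

@[simp] theorem n_equiv (C' : Chart g d X) (z : X) : C.n (C.equiv C' z) = C'.n z := by
  simp [equiv]

@[simp] theorem s_equiv (C' : Chart g d X) (z : X) : C.s (C.equiv C' z) = C'.s z := by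
  simp [equiv]

/-- Pulling a chart back by an isometry. -/
noncomputable def comp (f : X ≃ᵢ X) : Chart g d X where
  n z := C.n (f z)
  s z := C.s (f z)
  s_nonneg z := C.s_nonneg _
  norm_n z := C.norm_n _
  surj v r hr h := by
    obtain ⟨z, hz, hz'⟩ := C.surj v r hr h
    exact ⟨f.symm z, by simpa using hz, by simpa using hz'⟩
  ps_dist z w := by rw [← C.ps_dist, f.dist_eq]
  le_pi := C.le_pi

/-- Changing the chart by a linear isometry. -/
noncomputable def rot (A : Vec d ≃ₗᵢ[ℝ] Vec d) : Chart g d X where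
  n z := A (C.n z)
  s z := C.s z
  s_nonneg z := C.s_nonneg _
  norm_n z := by rw [A.norm_map]; exact C.norm_n _
  surj v r hr h := by
    obtain ⟨z, hz, hz'⟩ := C.surj (A.symm v) r hr (by rw [A.symm.norm_map]; exact h)
    exact ⟨z, by rw [hz]; simp, hz'⟩
  ps_dist z w := by rw [A.inner_map_map]; exact C.ps_dist z w
  le_pi := C.le_pi

theorem s_eq_zero_iff {p : X} (hp : C.s p = 0) (z : X) : C.s z = qd g p z := by
  have h1 := C.norm_n p
  rw [hp] at h1
  have h2 : C.n p = 0 := by simpa using h1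
  rw [C.qd_eq, hp, h2]; simp

theorem n_zero {p : X} (hp : C.s p = 0) : C.n p = 0 := by
  have h1 := C.norm_n p
  rw [hp] at h1
  simpa using h1

theorem t_zero {p : X} (hp : C.s p = 0) : C.t p = 1 := by rw [t, hp]; ring

/-- The affine-linear function with unit gradient `(a, e)`. -/
noncomputable def hs (a : Vec d) (e : ℝ) (z : X) : ℝ := inner ℝ a (C.n z) + e * C.t z

theorem s_refl_nonneg (a : Vec d) (e : ℝ) (h : ‖a‖ ^ 2 + g.k * e ^ 2 = 1) (z : X) :
    0 ≤ C.s z + 2 * C.hs a e z * e ∧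
    ‖C.n z - (2 * C.hs a e z) • a‖ ^ 2 =
      2 * (C.s z + 2 * C.hs a e z * e) - g.k * (C.s z + 2 * C.hs a e z * e) ^ 2 := by
  have h2 : ‖C.n z - (2 * C.hs a e z) • a‖ ^ 2 =
      2 * (C.s z + 2 * C.hs a e z * e) - g.k * (C.s z + 2 * C.hs a e z * e) ^ 2 := by
    rw [norm_sub_sq_real, inner_smul_right, norm_smul, mul_pow, Real.norm_eq_abs, sq_abs, C.norm_n]
    have h3 : inner ℝ (C.n z) a = C.hs a e z - e * C.t z := by
      rw [hs, real_inner_comm]; ring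
    rw [h3, t]
    have : ‖a‖ ^ 2 = 1 - g.k * e ^ 2 := by linarith
    rw [this]; ring
  refine ⟨?_, h2⟩
  have h3 := sq_nonneg ‖C.n z - (2 * C.hs a e z) • a‖
  rw [h2] at h3
  rcases g.k_cases with hk | hk | hk
  · rw [hk] at h3; nlinarith
  · rw [hk] at h3; nlinarith
  · rw [hk] at h h3
    have h0 := C.s_nonneg z
    have hn := C.norm_n z
    rw [hk] at hn
    have hle := abs_real_inner_le_norm a (C.n z)
    by_contra hneg
    push Not at hneg
    have h9 : C.s z + 2 * C.hs a e z * e ≤ -2 := by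
      by_contra h10
      push Not at h10
      nlinarith
    simp only [hs, t, hk] at h9
    have h5 : |e| * (|inner ℝ a (C.n z)|) ≤ |e| * (‖a‖ * ‖C.n z‖) :=
      mul_le_mul_of_nonneg_left hle (abs_nonneg e)
    have h6 : -(e * inner ℝ a (C.n z)) ≤ |e| * |inner ℝ a (C.n z)| := by
      rw [← abs_mul]; exact neg_le_abs _
    have h7 : 2 * (|e| * ‖a‖) ≤ 1 + 2 * e ^ 2 := by
      nlinarith [sq_nonneg (|e| - ‖a‖), sq_abs e]
    have h8 : |e| * (‖a‖ * ‖C.n z‖) * 2 ≤ (1 + 2 * e ^ 2) * ‖C.n z‖ := by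
      nlinarith [norm_nonneg (C.n z)]
    have hN : ‖C.n z‖ < 1 + C.s z := by
      refine lt_of_pow_lt_pow_left₀ 2 (by linarith) ?_
      nlinarith
    nlinarith [sq_nonneg e]

end Chart
end

section
variable {g : Geo} {d : ℕ} {X : Type*} [MetricSpace X]

namespace Chart
variable (C : Chart g d X)

/-- The origin of the chart. -/
noncomputable def o : X := C.pt 0 0 le_rfl (by simp)

@[simp] theorem s_o : C.s C.o = 0 := by simp [o]
@[simp] theorem n_o : C.n C.o = 0 := by simp [o]
@[simp] theorem t_o : C.t C.o = 1 := by simp [t]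

theorem s_eq (z : X) : C.s z = qd g C.o z := C.s_eq_zero_iff C.s_o z

theorem eq_o {p : X} (h : C.s p = 0) : C.o = p := by
  rw [C.s_eq] at h
  exact C.qd_eq_zero.1 h

theorem continuous_s : Continuous C.s := by
  rw [show C.s = qd g C.o from funext C.s_eq]
  exact continuous_qd _

theorem continuous_t : Continuous C.t := continuous_const.sub (continuous_const.mul C.continuous_s)

theorem continuous_n : Continuous C.n := by
  rw [continuous_iff_continuousAt]
  intro z
  rw [ContinuousAt, tendsto_iff_norm_sub_tendsto_zero]
  have : ∀ w, ‖C.n w - C.n z‖ = Real.sqrt (2 * qd g z w - g.k * (C.s w - C.s z) ^ 2) := by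
    intro w
    rw [qd_comm, ← C.norm_sub, Real.sqrt_sq (norm_nonneg _)]
  simp_rw [this]
  have hc : Continuous fun w => Real.sqrt (2 * qd g z w - g.k * (C.s w - C.s z) ^ 2) := by
    have := continuous_qd (g := g) z
    have := C.continuous_s
    fun_prop
  have h := hc.tendsto z
  simpa [qd_self] using h

theorem continuous_hs (a : Vec d) (e : ℝ) : Continuous (C.hs a e) := by
  have := C.continuous_n
  have := C.continuous_t
  unfold hs
  fun_prop

/-- The point in direction `u` at parameter `r`. -/
noncomputable def polar (u : Vec d) (hu : ‖u‖ = 1) (r : ℝ) : X :=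
  C.pt (g.Sn r • u) (g.ps r) (g.ps_nonneg r) (by
    rw [norm_smul, hu, mul_one, Real.norm_eq_abs, sq_abs, g.Sn_sq])

@[simp] theorem n_polar (u : Vec d) (hu : ‖u‖ = 1) (r : ℝ) :
    C.n (C.polar u hu r) = g.Sn r • u := by simp [polar]

@[simp] theorem s_polar (u : Vec d) (hu : ‖u‖ = 1) (r : ℝ) :
    C.s (C.polar u hu r) = g.ps r := by simp [polar]

@[simp] theorem t_polar (u : Vec d) (hu : ‖u‖ = 1) (r : ℝ) :
    C.t (C.polar u hu r) = g.Co r := by rw [t, s_polar, g.Co_eq]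

section refl
variable (a : Vec d) (e : ℝ) (h : ‖a‖ ^ 2 + g.k * e ^ 2 = 1)

include h in
theorem hs_refl_aux (z : X) :
    inner ℝ a (C.n z - (2 * C.hs a e z) • a) + e * (1 - g.k * (C.s z + 2 * C.hs a e z * e)) =
      - C.hs a e z := by
  have : inner ℝ a (C.n z) = C.hs a e z - e * C.t z := by rw [hs]; ring
  rw [inner_sub_right, inner_smul_right, real_inner_self_eq_norm_sq, this, t]
  have : ‖a‖ ^ 2 = 1 - g.k * e ^ 2 := by linarith
  rw [this]; ring

/-- The chart reflected in the hyperplane `hs a e = 0`. -/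
noncomputable def reflect : Chart g d X where
  n z := C.n z - (2 * C.hs a e z) • a
  s z := C.s z + 2 * C.hs a e z * e
  s_nonneg z := (C.s_refl_nonneg a e h z).1
  norm_n z := (C.s_refl_nonneg a e h z).2
  surj v r hr hv := by
    obtain ⟨w, hw1, hw2⟩ := C.surj v r hr hv
    obtain ⟨h1, h2⟩ := C.s_refl_nonneg a e h w
    have h3 := C.hs_refl_aux a e h w
    refine ⟨C.pt _ _ h1 h2, ?_⟩
    have h4 : C.hs a e (C.pt _ _ h1 h2) = - C.hs a e w := by
      rw [← h3, hs, t, n_pt, s_pt]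
    rw [h4, n_pt, s_pt, ← hw1, ← hw2]
    constructor
    · rw [sub_sub, ← add_smul]; simp
    · ring
  ps_dist z w := by
    rw [C.ps_dist, inner_sub_left, inner_sub_right, inner_sub_right, inner_smul_left,
      inner_smul_right, inner_smul_right, inner_smul_left, real_inner_self_eq_norm_sq,
      real_inner_comm a (C.n z)]
    have h1 : inner ℝ a (C.n z) = C.hs a e z - e * C.t z := by rw [hs]; ring
    have h2 : inner ℝ a (C.n w) = C.hs a e w - e * C.t w := by rw [hs]; ring
    have : ‖a‖ ^ 2 = 1 - g.k * e ^ 2 := by linarith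
    rw [h1, h2, this, t, t]
    simp only [RCLike.conj_to_real]
    ring
  le_pi := C.le_pi

/-- The reflection in the hyperplane `hs a e = 0`. -/
noncomputable def sigma : X ≃ᵢ X := C.equiv (C.reflect a e h)

@[simp] theorem n_sigma (z : X) : C.n (C.sigma a e h z) = C.n z - (2 * C.hs a e z) • a := by
  simp [sigma, reflect]

@[simp] theorem s_sigma (z : X) : C.s (C.sigma a e h z) = C.s z + 2 * C.hs a e z * e := by
  simp [sigma, reflect]

theorem hs_sigma (z : X) : C.hs a e (C.sigma a e h z) = - C.hs a e z := by
  rw [← C.hs_refl_aux a e h z, hs, t, n_sigma, s_sigma]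

theorem sigma_sigma (z : X) : C.sigma a e h (C.sigma a e h z) = z := by
  apply C.ext_pt
  · rw [n_sigma, hs_sigma, n_sigma, sub_sub, ← add_smul]; simp
  · rw [s_sigma, hs_sigma, s_sigma]; ring

theorem qd_sigma (z : X) : qd g z (C.sigma a e h z) = 2 * C.hs a e z ^ 2 := by
  have h1 := C.norm_sub z (C.sigma a e h z)
  rw [n_sigma, s_sigma, sub_sub_cancel, norm_smul, mul_pow, Real.norm_eq_abs, sq_abs] at h1
  nlinarith

theorem sigma_eq_iff (z : X) : C.sigma a e h z = z ↔ C.hs a e z = 0 := by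
  rw [eq_comm, ← C.qd_eq_zero (z := z), qd_sigma]
  simp

include h in
theorem exists_hs_pos : ∃ z, 0 < C.hs a e z := by
  suffices ∃ z, C.hs a e z ≠ 0 by
    obtain ⟨z, hz⟩ := this
    rcases lt_or_gt_of_ne hz with h1 | h1
    · exact ⟨C.sigma a e h z, by rw [hs_sigma]; linarith⟩
    · exact ⟨z, h1⟩
  by_cases he : e = 0
  · subst he
    have ha : ‖a‖ = 1 := by
      have : ‖a‖ ^ 2 = 1 := by linarith
      nlinarith [norm_nonneg a]
    refine ⟨C.polar a ha 1, ?_⟩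
    rw [hs, n_polar, inner_smul_right, real_inner_self_eq_norm_sq, ha]
    have := g.Sn_pos one_pos (fun _ => by linarith [Real.pi_gt_three])
    simp [this.ne']
  · exact ⟨C.o, by simp [hs, he]⟩

include h in
theorem exists_hs_neg : ∃ z, C.hs a e z < 0 := by
  obtain ⟨z, hz⟩ := C.exists_hs_pos a e h
  exact ⟨C.sigma a e h z, by rw [hs_sigma]; linarith⟩

theorem isReflection_sigma : IsReflection (C.sigma a e h) := by
  obtain ⟨z, hz⟩ := C.exists_hs_pos a e h
  obtain ⟨w, hw⟩ := C.exists_hs_neg a e h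
  refine ⟨?_, ?_, ?_⟩
  · ext z; exact C.sigma_sigma a e h z
  · intro h'
    have : C.sigma a e h z = z := by rw [h']; rfl
    rw [sigma_eq_iff] at this
    exact hz.ne' this
  · intro hpre
    have hc := C.continuous_hs a e
    have hS : ∀ z, C.sigma a e h z ≠ z ↔ C.hs a e z ≠ 0 := fun z => (C.sigma_eq_iff a e h z).not
    obtain ⟨u, _, hu1, hu2⟩ := hpre {z | 0 < C.hs a e z} {z | C.hs a e z < 0}
      (isOpen_lt continuous_const hc) (isOpen_lt hc continuous_const)
      (fun x hx => by
        rcases lt_or_gt_of_ne ((hS x).1 hx) with h1 | h1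
        · exact Or.inr h1
        · exact Or.inl h1)
      ⟨z, (hS z).2 hz.ne', hz⟩ ⟨w, (hS w).2 hw.ne, hw⟩
    exact lt_asymm (show 0 < C.hs a e u from hu1) hu2

end refl
end Chart

/-- Half-space functions: normalized differences of versines. -/
def IsHS (g : Geo) {X : Type*} [MetricSpace X] (H : X → ℝ) : Prop :=
  ∃ p p' : X, p ≠ p' ∧ H = fun z => (qd g p' z - qd g p z) / Real.sqrt (2 * qd g p p')

theorem IsHS.comp {H : X → ℝ} (h : IsHS g H) (f : X ≃ᵢ X) : IsHS g (H ∘ f) := by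
  obtain ⟨p, p', hne, rfl⟩ := h
  refine ⟨f.symm p, f.symm p', fun h => hne (f.symm.injective h), ?_⟩
  funext z
  have h1 : ∀ w, qd g (f.symm w) z = qd g w (f z) := fun w => by
    rw [← qd_isom f, f.apply_symm_apply]
  simp [h1, qd_isom]

theorem Chart.isHS_iff (C : Chart g d X) (H : X → ℝ) :
    IsHS g H ↔ ∃ a e, ‖a‖ ^ 2 + g.k * e ^ 2 = 1 ∧ H = C.hs a e := by
  constructor
  · rintro ⟨p, p', hne, rfl⟩
    have hq := C.qd_pos hne
    set D := Real.sqrt (2 * qd g p p') with hD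
    have hD2 : D ^ 2 = 2 * qd g p p' := Real.sq_sqrt (by linarith)
    have hDpos : 0 < D := Real.sqrt_pos.2 (by linarith)
    have hns := C.norm_sub p p'
    refine ⟨D⁻¹ • (C.n p - C.n p'), (C.s p' - C.s p) / D, ?_, ?_⟩
    · rw [norm_smul, mul_pow, hns, Real.norm_eq_abs, sq_abs, ← hD2]
      field_simp
      ring
    · funext z
      rw [Chart.hs, inner_smul_left, inner_sub_left, C.qd_eq, C.qd_eq, Chart.t]
      simp only [RCLike.conj_to_real]
      field_simp
      ring
  · rintro ⟨a, e, h, rfl⟩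
    obtain ⟨p, hp⟩ := C.exists_hs_pos a e h
    refine ⟨p, C.sigma a e h p, ?_, ?_⟩
    · intro h'
      exact hp.ne' ((C.sigma_eq_iff a e h p).1 h'.symm)
    · funext z
      rw [C.qd_sigma]
      have : Real.sqrt (2 * (2 * C.hs a e p ^ 2)) = 2 * C.hs a e p := by
        rw [show 2 * (2 * C.hs a e p ^ 2) = (2 * C.hs a e p) ^ 2 by ring,
          Real.sqrt_sq (by linarith)]
      rw [this, C.qd_eq, C.qd_eq, C.n_sigma, C.s_sigma, inner_sub_left, inner_smul_left]
      simp only [RCLike.conj_to_real]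
      have h1 : C.hs a e z = inner ℝ a (C.n z) + e * (1 - g.k * C.s z) := rfl
      rw [h1]
      field_simp
      ring

theorem Chart.isHS_hs (C : Chart g d X) {a : Vec d} {e : ℝ} (h : ‖a‖ ^ 2 + g.k * e ^ 2 = 1) :
    IsHS g (C.hs a e) := (C.isHS_iff _).2 ⟨a, e, h, rfl⟩

/-- In a chart centred on the hyperplane the function is linear in `n`. -/
theorem Chart.isHS_zero (C : Chart g d X) {p : X} (hp : C.s p = 0) {H : X → ℝ} (hH : IsHS g H)
    (h0 : H p = 0) : ∃ a, ‖a‖ = 1 ∧ ∀ z, H z = inner ℝ a (C.n z) := by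
  obtain ⟨a, e, h, rfl⟩ := (C.isHS_iff H).1 hH
  have he : e = 0 := by
    rw [Chart.hs, C.n_zero hp, C.t_zero hp] at h0
    simpa using h0
  subst he
  refine ⟨a, ?_, fun z => by simp [Chart.hs]⟩
  have : ‖a‖ ^ 2 = 1 := by linarith
  nlinarith [norm_nonneg a]

theorem Chart.isHS_inner (C : Chart g d X) {a : Vec d} (ha : ‖a‖ = 1) :
    IsHS g (fun z => inner ℝ a (C.n z)) := by
  refine (C.isHS_iff _).2 ⟨a, 0, by simp [ha], ?_⟩
  funext z; simp [Chart.hs]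

theorem IsHS.continuous (C : Chart g d X) {H : X → ℝ} (h : IsHS g H) : Continuous H := by
  obtain ⟨a, e, h, rfl⟩ := (C.isHS_iff H).1 h
  exact C.continuous_hs a e

theorem IsHS.neg {H : X → ℝ} (h : IsHS g H) : IsHS g (fun z => - H z) := by
  obtain ⟨p, p', hne, rfl⟩ := h
  refine ⟨p', p, hne.symm, ?_⟩
  funext z
  rw [qd_comm p' p]; ring

end

theorem exists_unit_orth {d : ℕ} (S : Finset (Vec d)) (hS : S.card < d) :
    ∃ w : Vec d, ‖w‖ = 1 ∧ ∀ a ∈ S, inner ℝ w a = 0 := by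
  have h1 : Module.finrank ℝ (Submodule.span ℝ (S : Set (Vec d))) ≤ S.card :=
    finrank_span_finset_le_card S
  have h2 := (Submodule.span ℝ (S : Set (Vec d))).finrank_add_finrank_orthogonal
  rw [finrank_euclideanSpace_fin] at h2
  have h3 : (Submodule.span ℝ (S : Set (Vec d)))ᗮ ≠ ⊥ := by
    intro h
    rw [h, finrank_bot] at h2
    omega
  obtain ⟨v, hv, hv0⟩ := Submodule.exists_mem_ne_zero_of_ne_bot h3
  have hn : ‖v‖ ≠ 0 := norm_ne_zero_iff.2 hv0
  refine ⟨‖v‖⁻¹ • v, ?_, fun a ha => ?_⟩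
  · rw [norm_smul, norm_inv, norm_norm, inv_mul_cancel₀ hn]
  · rw [inner_smul_left, real_inner_comm,
      (Submodule.mem_orthogonal _ _).1 hv a (Submodule.subset_span ha)]
    simp

theorem exists_unit_orth_one {d : ℕ} (hd : 2 ≤ d) (a : Vec d) :
    ∃ w : Vec d, ‖w‖ = 1 ∧ inner ℝ w a = 0 := by
  obtain ⟨w, h1, h2⟩ := exists_unit_orth {a} (by simp; omega)
  exact ⟨w, h1, h2 a (by simp)⟩

theorem exists_unit_orth_two {d : ℕ} (hd : 3 ≤ d) (a b : Vec d) :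
    ∃ w : Vec d, ‖w‖ = 1 ∧ inner ℝ w a = 0 ∧ inner ℝ w b = 0 := by
  classical
  obtain ⟨w, h1, h2⟩ := exists_unit_orth {a, b} (lt_of_le_of_lt Finset.card_le_two (by omega))
  exact ⟨w, h1, h2 a (by simp), h2 b (by simp)⟩

section
variable {g : Geo} {d : ℕ} {X : Type*} [MetricSpace X]

/-- Products of `k` reflections. -/
def RefProd (k : ℕ) (f : X ≃ᵢ X) : Prop :=
  ∃ l : List (X ≃ᵢ X), (∀ σ ∈ l, IsReflection σ) ∧ l.length = k ∧
    f = l.foldr IsometryEquiv.trans (IsometryEquiv.refl X)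

theorem refProd_refl : RefProd 0 (IsometryEquiv.refl X) := ⟨[], by simp, rfl, rfl⟩

theorem RefProd.cons {σ f : X ≃ᵢ X} {k : ℕ} (hσ : IsReflection σ) (h : RefProd k f) :
    RefProd (k + 1) (σ.trans f) := by
  obtain ⟨l, h1, h2, rfl⟩ := h
  exact ⟨σ :: l, by simpa using ⟨hσ, h1⟩, by simp [h2], rfl⟩

theorem RefProd.trans {f f' : X ≃ᵢ X} {j k : ℕ} (h : RefProd j f) (h' : RefProd k f') :
    RefProd (j + k) (f.trans f') := by
  obtain ⟨l, h1, h2, rfl⟩ := h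
  induction l generalizing j with
  | nil => subst h2; rw [List.length_nil, Nat.zero_add]; exact h'
  | cons σ l ih =>
    have := RefProd.cons (h1 σ (by simp)) (ih (fun τ hτ => h1 τ (by simp [hτ])) rfl)
    have hk : l.length + k + 1 = j + k := by rw [← h2, List.length_cons]; ring
    rwa [hk] at this

theorem IsReflection.refProd {σ : X ≃ᵢ X} (h : IsReflection σ) : RefProd 1 σ :=
  RefProd.cons h refProd_refl

theorem orientationPreserving_iff (f : X ≃ᵢ X) :
    OrientationPreserving f ↔ ∃ k, Even k ∧ RefProd k f := by
  constructor
  · rintro ⟨l, h1, h2, h3⟩; exact ⟨_, h2, l, h1, rfl, h3⟩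
  · rintro ⟨k, hk, l, h1, rfl, h3⟩; exact ⟨l, h1, hk, h3⟩

theorem orientationPreserving_refl : OrientationPreserving (IsometryEquiv.refl X) :=
  (orientationPreserving_iff _).2 ⟨0, Even.zero, refProd_refl⟩

/-- A product of reflections can be made orientation preserving by one more reflection. -/
theorem RefProd.fix_parity {f σ : X ≃ᵢ X} {k : ℕ} (h : RefProd k f) (hσ : IsReflection σ) :
    OrientationPreserving f ∨ OrientationPreserving (f.trans σ) := by
  rcases Nat.even_or_odd k with hk | hk
  · exact Or.inl ((orientationPreserving_iff _).2 ⟨k, hk, h⟩)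
  · exact Or.inr ((orientationPreserving_iff _).2 ⟨k + 1, hk.add_one, h.trans hσ.refProd⟩)

namespace Chart
variable (C : Chart g d X)

theorem exists_sigma_swap {p p' : X} (hne : p ≠ p') :
    ∃ a e, ∃ h : ‖a‖ ^ 2 + g.k * e ^ 2 = 1, C.sigma a e h p = p' := by
  have hq := C.qd_pos hne
  set D := Real.sqrt (2 * qd g p p') with hD
  have hD2 : D ^ 2 = 2 * qd g p p' := Real.sq_sqrt (by linarith)
  have hDpos : 0 < D := Real.sqrt_pos.2 (by linarith)
  have hns := C.norm_sub p p'
  have h : ‖D⁻¹ • (C.n p - C.n p')‖ ^ 2 + g.k * ((C.s p' - C.s p) / D) ^ 2 = 1 := by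
    rw [norm_smul, mul_pow, hns, Real.norm_eq_abs, sq_abs, ← hD2]
    field_simp
    ring
  refine ⟨D⁻¹ • (C.n p - C.n p'), (C.s p' - C.s p) / D, h, ?_⟩
  have hH : C.hs (D⁻¹ • (C.n p - C.n p')) ((C.s p' - C.s p) / D) p = D / 2 := by
    rw [C.qd_eq] at hD2
    rw [Chart.hs, inner_smul_left, inner_sub_left, real_inner_self_eq_norm_sq, C.norm_n, Chart.t]
    simp only [RCLike.conj_to_real]
    rw [real_inner_comm]
    field_simp
    rw [hD2]; ring
  apply C.ext_pt
  · rw [n_sigma, hH, smul_smul]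
    have : 2 * (D / 2) * D⁻¹ = 1 := by field_simp
    rw [this]; simp
  · rw [s_sigma, hH]; field_simp; ring

include C in
/-- Every point is the origin of some chart. -/
theorem exists_at (p : X) : ∃ C' : Chart g d X, C'.s p = 0 := by
  by_cases h : p = C.o
  · exact ⟨C, by rw [h]; simp⟩
  · obtain ⟨a, e, ha, hs⟩ := C.exists_sigma_swap h
    exact ⟨C.comp (C.sigma a e ha), (congrArg C.s hs).trans C.s_o⟩

theorem sigma_zero_fix {p : X} (hp : C.s p = 0) {a : Vec d} (h : ‖a‖ ^ 2 + g.k * 0 ^ 2 = 1) :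
    C.sigma a 0 h p = p := by
  rw [sigma_eq_iff, hs, C.n_zero hp]; simp

include C in
/-- Any two flags (point, half-space function vanishing there) are related by
an orientation preserving congruence. -/
theorem exists_flag_map (hd : 2 ≤ d) {x y : X} {H H' : X → ℝ} (hH : IsHS g H) (hx : H x = 0)
    (hH' : IsHS g H') (hy : H' y = 0) :
    ∃ f : X ≃ᵢ X, OrientationPreserving f ∧ f x = y ∧ ∀ z, H' (f z) = H z := by
  obtain ⟨C, hC⟩ := C.exists_at y
  obtain ⟨a', ha', hHa'⟩ := C.isHS_zero hC hH' hy
  have unit : ∀ {a : Vec d}, ‖a‖ = 1 → ‖a‖ ^ 2 + g.k * 0 ^ 2 = 1 := fun h => by simp [h]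
  obtain ⟨k, f, hf, hfx, hfH⟩ : ∃ k, ∃ f : X ≃ᵢ X, RefProd k f ∧ f x = y ∧ ∀ z, H' (f z) = H z := by
    obtain ⟨k, f1, hf1, hfx⟩ : ∃ k, ∃ f : X ≃ᵢ X, RefProd k f ∧ f x = y := by
      by_cases hxy : x = y
      · exact ⟨0, _, refProd_refl, hxy⟩
      · obtain ⟨a, e, ha, hs⟩ := C.exists_sigma_swap hxy
        exact ⟨1, _, (C.isReflection_sigma a e ha).refProd, hs⟩
    have hH1 : IsHS g (H ∘ f1.symm) := hH.comp _
    obtain ⟨a1, ha1, hHa1⟩ := C.isHS_zero hC hH1 (by simp [← hfx, hx])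
    by_cases haa : a1 = a'
    · refine ⟨k, f1, hf1, hfx, fun z => ?_⟩
      have := hHa1 (f1 z)
      rw [haa, ← hHa'] at this
      simpa using this.symm
    · have hn : ‖a1 - a'‖ ≠ 0 := norm_ne_zero_iff.2 (sub_ne_zero.2 haa)
      set u := ‖a1 - a'‖⁻¹ • (a1 - a') with hu
      have hu1 : ‖u‖ = 1 := by rw [hu, norm_smul, norm_inv, norm_norm, inv_mul_cancel₀ hn]
      refine ⟨k + 1, f1.trans (C.sigma u 0 (unit hu1)), hf1.trans (C.isReflection_sigma _ _ _).refProd,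
        ?_, fun z => ?_⟩
      · rw [IsometryEquiv.trans_apply, hfx, C.sigma_zero_fix hC]
      · rw [IsometryEquiv.trans_apply, hHa', n_sigma, inner_sub_right, inner_smul_right]
        have h1 := hHa1 (f1 z)
        rw [Function.comp_apply, f1.symm_apply_apply] at h1
        rw [h1, hs, hu, inner_smul_left, inner_smul_right, inner_sub_left, inner_sub_right,
          real_inner_self_eq_norm_sq, ha']
        have h2 : ‖a1 - a'‖ ^ 2 = 2 - 2 * inner ℝ a' a1 := by
          rw [norm_sub_sq_real, ha1, ha', real_inner_comm]; ring
        simp only [RCLike.conj_to_real]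
        have h3 : inner ℝ a' a1 = 1 - ‖a1 - a'‖ ^ 2 / 2 := by linarith
        rw [h3]
        field_simp
        ring
  obtain ⟨w, hw1, hw2⟩ := exists_unit_orth_one hd a'
  rcases hf.fix_parity (C.isReflection_sigma w 0 (unit hw1)) with h | h
  · exact ⟨f, h, hfx, hfH⟩
  · refine ⟨_, h, ?_, fun z => ?_⟩
    · rw [IsometryEquiv.trans_apply, hfx, C.sigma_zero_fix hC]
    · rw [IsometryEquiv.trans_apply, ← hfH, hHa', hHa', n_sigma, inner_sub_right, inner_smul_right,
        real_inner_comm w a', hw2]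
      simp

/-- In dimension at least three the stabilizer of a flag acts transitively on the points with the
same distances. -/
theorem exists_flag_rotation (hd : 3 ≤ d) {y : X} (hC : C.s y = 0) {a : Vec d} {z z' : X}
    (hs : C.s z = C.s z') (ha : inner ℝ a (C.n z) = inner ℝ a (C.n z')) :
    ∃ f : X ≃ᵢ X, OrientationPreserving f ∧ f y = y ∧ (∀ w, inner ℝ a (C.n (f w)) = inner ℝ a (C.n w)) ∧
      f z = z' := by
  have unit : ∀ {a : Vec d}, ‖a‖ = 1 → ‖a‖ ^ 2 + g.k * 0 ^ 2 = 1 := fun h => by simp [h]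
  by_cases hz : z = z'
  · exact ⟨_, orientationPreserving_refl, rfl, fun _ => rfl, hz⟩
  have hne : C.n z ≠ C.n z' := fun h => hz (C.ext_pt h hs)
  have hn : ‖C.n z - C.n z'‖ ≠ 0 := norm_ne_zero_iff.2 (sub_ne_zero.2 hne)
  set u := ‖C.n z - C.n z'‖⁻¹ • (C.n z - C.n z') with hu
  have hu1 : ‖u‖ = 1 := by rw [hu, norm_smul, norm_inv, norm_norm, inv_mul_cancel₀ hn]
  have hua : inner ℝ a u = 0 := by
    rw [hu, inner_smul_right, inner_sub_right, ha]; simp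
  have key : ∀ {v : Vec d} (hv : ‖v‖ = 1), inner ℝ a v = 0 → ∀ w,
      inner ℝ a (C.n (C.sigma v 0 (unit hv) w)) = inner ℝ a (C.n w) := by
    intro v hv hva w
    rw [n_sigma, inner_sub_right, inner_smul_right, hva]; simp
  have hfz : C.sigma u 0 (unit hu1) z = z' := by
    apply C.ext_pt
    · rw [n_sigma, Chart.hs, hu, inner_smul_left, inner_sub_left, real_inner_self_eq_norm_sq, smul_smul]
      have h2 : ‖C.n z - C.n z'‖ ^ 2 = 2 * (‖C.n z‖ ^ 2 - inner ℝ (C.n z') (C.n z)) := by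
        rw [norm_sub_sq_real, C.norm_n, C.norm_n, hs, real_inner_comm]; ring
      simp only [RCLike.conj_to_real]
      have h3 : ‖C.n z‖ ^ 2 - inner ℝ (C.n z') (C.n z) = ‖C.n z - C.n z'‖ ^ 2 / 2 := by linarith
      rw [h3]
      have : 2 * (‖C.n z - C.n z'‖⁻¹ * (‖C.n z - C.n z'‖ ^ 2 / 2) + 0 * C.t z) * ‖C.n z - C.n z'‖⁻¹
        = 1 := by field_simp; ring
      rw [this]; simp
    · rw [s_sigma, hs]; ring
  obtain ⟨w, hw1, hw2, hw3⟩ := exists_unit_orth_two hd a (C.n z')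
  rcases (C.isReflection_sigma u 0 (unit hu1)).refProd.fix_parity
    (C.isReflection_sigma w 0 (unit hw1)) with h | h
  · exact ⟨_, h, C.sigma_zero_fix hC _, key hu1 hua, hfz⟩
  · refine ⟨_, h, ?_, fun v => ?_, ?_⟩
    · rw [IsometryEquiv.trans_apply, C.sigma_zero_fix hC, C.sigma_zero_fix hC]
    · rw [IsometryEquiv.trans_apply, key hw1 (by rw [real_inner_comm]; exact hw2), key hu1 hua]
    · rw [IsometryEquiv.trans_apply, hfz, sigma_eq_iff, Chart.hs, hw3]; simp

end Chart
end

section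
variable {d : ℕ} {X : Type*} [MetricSpace X]

theorem inner_castSucc (x y : Vec (d + 1)) :
    inner ℝ x y = inner ℝ (WithLp.toLp 2 (fun i : Fin d => x i.castSucc) : Vec d)
      (WithLp.toLp 2 (fun i : Fin d => y i.castSucc)) + x (Fin.last d) * y (Fin.last d) := by
  rw [PiLp.inner_apply, PiLp.inner_apply, Fin.sum_univ_castSucc]
  simp [mul_comm]

theorem exists_chart_sph (h : IsSphereSpace X d) : Nonempty (Chart Geo.sph d X) := by
  obtain ⟨e, hinj, hran, hdist⟩ := h
  have hnorm : ∀ z, ‖e z‖ = 1 := fun z => by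
    have : e z ∈ Metric.sphere (0 : Vec (d + 1)) 1 := hran ▸ Set.mem_range_self z
    simpa using this
  have hn : ∀ z, ‖(WithLp.toLp 2 (fun i : Fin d => e z i.castSucc) : Vec d)‖ ^ 2 =
      1 - e z (Fin.last d) ^ 2 := fun z => by
    have h1 := inner_castSucc (e z) (e z)
    rw [real_inner_self_eq_norm_sq, real_inner_self_eq_norm_sq, hnorm] at h1
    linarith
  refine ⟨{ n := fun z => WithLp.toLp 2 (fun i : Fin d => e z i.castSucc)
            s := fun z => 1 - e z (Fin.last d)
            s_nonneg := fun z => ?_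
            norm_n := fun z => ?_
            surj := fun v r hr hv => ?_
            ps_dist := fun z w => ?_
            le_pi := fun _ z w => ?_ }⟩
  · have := hn z
    nlinarith [sq_nonneg ‖(WithLp.toLp 2 (fun i : Fin d => e z i.castSucc) : Vec d)‖]
  · rw [hn]; simp only [Geo.k]; ring
  · simp only [Geo.k] at hv
    have hmem : (WithLp.toLp 2 (Fin.snoc (α := fun _ => ℝ) (fun i => v i) (1 - r)) : Vec (d + 1)) ∈
        Set.range e := by
      rw [hran, mem_sphere_zero_iff_norm]
      have h1 := inner_castSucc
        (WithLp.toLp 2 (Fin.snoc (α := fun _ => ℝ) (fun i => v i) (1 - r)) : Vec (d + 1))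
        (WithLp.toLp 2 (Fin.snoc (α := fun _ => ℝ) (fun i => v i) (1 - r)))
      simp only [Fin.snoc_castSucc, Fin.snoc_last] at h1
      rw [real_inner_self_eq_norm_sq, real_inner_self_eq_norm_sq] at h1
      have h2 : (WithLp.toLp 2 (fun i : Fin d => v i) : Vec d) = v := rfl
      rw [h2, hv] at h1
      have h3 : ‖(WithLp.toLp 2 (Fin.snoc (α := fun _ => ℝ) (fun i => v i) (1 - r)) : Vec (d + 1))‖ ^ 2
        = 1 ^ 2 := by rw [h1]; ring
      exact (pow_left_inj₀ (norm_nonneg _) zero_le_one two_ne_zero).1 h3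
    obtain ⟨z, hz⟩ := hmem
    refine ⟨z, ?_, ?_⟩
    · ext i; simp [hz]
    · simp [hz]
  · simp only [Geo.ps, Geo.k]
    have h1 := abs_le.1 (abs_real_inner_le_norm (e z) (e w))
    rw [hnorm, hnorm] at h1
    rw [hdist, Real.cos_arccos (by linarith [h1.1]) (by linarith [h1.2]), inner_castSucc]
    ring
  · rw [hdist]; exact Real.arccos_le_pi _

theorem exists_chart_euc (h : IsEuclideanSpaceForm X d) :
    ∃ C : Chart Geo.euc d X, ∀ z w, dist z w = ‖C.n z - C.n w‖ := by
  obtain ⟨e⟩ := h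
  refine ⟨{ n := fun z => e z
            s := fun z => ‖e z‖ ^ 2 / 2
            s_nonneg := fun z => by positivity
            norm_n := fun z => by simp only [Geo.k]; ring
            surj := fun v r hr hv => ⟨e.symm v, by simp, by
              simp only [Geo.k] at hv
              simp only [IsometryEquiv.apply_symm_apply]
              rw [hv]; ring⟩
            ps_dist := fun z w => ?_
            le_pi := fun h => by cases h }, fun z w => ?_⟩
  · simp only [Geo.ps, Geo.k]
    rw [← e.dist_eq, dist_eq_norm, norm_sub_sq_real]; ring
  · simp only [← dist_eq_norm, e.dist_eq]

theorem exists_chart_hyp (h : IsHyperbolicSpace X d) : Nonempty (Chart Geo.hyp d X) := by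
  obtain ⟨e, hinj, hran, hdist⟩ := h
  have hm : ∀ z, mink d (e z) (e z) = -1 ∧ 0 < (e z).2 := fun z => by
    have : e z ∈ Set.range e := Set.mem_range_self z
    rw [hran] at this
    exact this
  have hn : ∀ z, ‖(e z).1‖ ^ 2 = (e z).2 ^ 2 - 1 := fun z => by
    have h1 := (hm z).1
    rw [mink, real_inner_self_eq_norm_sq] at h1
    linarith
  refine ⟨{ n := fun z => (e z).1
            s := fun z => (e z).2 - 1
            s_nonneg := fun z => ?_
            norm_n := fun z => ?_
            surj := fun v r hr hv => ?_
            ps_dist := fun z w => ?_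
            le_pi := fun h => by cases h }⟩
  · nlinarith [hn z, (hm z).2, sq_nonneg ‖(e z).1‖]
  · rw [hn]; simp only [Geo.k]; ring
  · simp only [Geo.k] at hv
    have hmem : ((v, r + 1) : Vec d × ℝ) ∈ Set.range e := by
      rw [hran]
      refine ⟨?_, by show (0 : ℝ) < r + 1; linarith⟩
      rw [mink, real_inner_self_eq_norm_sq, hv]; ring
    obtain ⟨z, hz⟩ := hmem
    exact ⟨z, by simp [hz], by simp [hz]⟩
  · simp only [Geo.ps, Geo.k]
    rw [hdist, mink]; ring

theorem not_isSphereSpace (hd : 1 ≤ d) {g : Geo} (hg : g ≠ Geo.sph) (C : Chart g d X) :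
    ¬ IsSphereSpace X d := by
  rintro ⟨e, -, -, hdist⟩
  obtain ⟨w, hw, -⟩ := exists_unit_orth (∅ : Finset (Vec d)) (by simp; omega)
  have hv : g.Val 4 := ⟨by norm_num, fun h => absurd h hg⟩
  have h1 : dist C.o (C.polar w hw 4) = 4 := by
    refine g.ps_inj (C.val _ _) hv ?_
    have := C.s_eq (C.polar w hw 4)
    rw [C.s_polar] at this
    exact this.symm
  have h2 : dist C.o (C.polar w hw 4) ≤ Real.pi := by rw [hdist]; exact Real.arccos_le_pi _
  linarith [Real.pi_lt_four]

end

theorem Geo.eventually_small (g : Geo) (c : ℝ) :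
    ∀ᶠ r in nhdsWithin (0 : ℝ) (Ioi 0), 0 < r ∧ g.Val r ∧ 0 < g.Sn r ∧ 0 < g.Co r ∧
      c * g.ps r < g.Sn r := by
  have h1 : ∀ᶠ r in nhds (0 : ℝ), 0 < g.Co r ∧ |c| * g.Sn r < 1 ∧ r < 1 := by
    refine ((g.continuous_Co.tendsto 0).eventually_const_lt (by simp)).and
      (((continuous_const.mul g.continuous_Sn).tendsto 0).eventually_lt_const (by simp) |>.and ?_)
    exact eventually_lt_nhds one_pos
  filter_upwards [self_mem_nhdsWithin, nhdsWithin_le_nhds h1] with r hr h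
  obtain ⟨h2, h3, h4⟩ := h
  have hr' : 0 < r := hr
  have hS := g.Sn_pos hr' (fun _ => by linarith [Real.pi_gt_three])
  refine ⟨hr', ⟨hr'.le, fun _ => by linarith [Real.pi_gt_three]⟩, hS, h2, ?_⟩
  have h5 : g.ps r * (1 + g.Co r) = g.Sn r ^ 2 := by rw [g.Sn_sq, g.Co_eq]; ring
  have h6 := g.ps_nonneg r
  have h7 : c * g.ps r ≤ |c| * g.ps r := mul_le_mul_of_nonneg_right (le_abs_self c) h6
  have h8 : g.ps r ≤ g.Sn r ^ 2 := by nlinarith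
  have h9 : |c| * g.ps r ≤ |c| * g.Sn r ^ 2 := mul_le_mul_of_nonneg_left h8 (abs_nonneg c)
  nlinarith

theorem Geo.exists_small (g : Geo) (c : ℝ) {δ : ℝ} (hδ : 0 < δ) : ∃ r, 0 < r ∧ r < δ ∧ g.Val r ∧
    0 < g.Sn r ∧ 0 < g.Co r ∧ c * g.ps r < g.Sn r := by
  have h1 : ∀ᶠ r in nhdsWithin (0 : ℝ) (Ioi 0), r < δ :=
    nhdsWithin_le_nhds (eventually_lt_nhds hδ)
  obtain ⟨r, ⟨h2, h3, h4, h5, h6⟩, h7⟩ := ((g.eventually_small c).and h1).exists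
  exact ⟨r, h2, h7, h3, h4, h5, h6⟩

section
variable {g : Geo} {d : ℕ} {X : Type*} [MetricSpace X]

/-- `z` is represented by the linear combination `α z₁ + β z₂`. -/
def Comb (g : Geo) {X : Type*} [MetricSpace X] (α β : ℝ) (z₁ z₂ z : X) : Prop :=
  ∀ H : X → ℝ, IsHS g H → H z = α * H z₁ + β * H z₂

namespace Chart
variable (C : Chart g d X)

theorem comb_of {α β : ℝ} {z₁ z₂ z : X} (hn : C.n z = α • C.n z₁ + β • C.n z₂)
    (ht : C.t z = α * C.t z₁ + β * C.t z₂) : Comb g α β z₁ z₂ z := by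
  intro H hH
  obtain ⟨a, e, -, rfl⟩ := (C.isHS_iff H).1 hH
  rw [hs, hn, ht, hs, hs, inner_add_right, inner_smul_right, inner_smul_right]; ring

theorem _root_.BallChar.Comb.n {α β : ℝ} {z₁ z₂ z : X} (h : Comb g α β z₁ z₂ z) :
    C.n z = α • C.n z₁ + β • C.n z₂ := by
  have key : ∀ a : Vec d, ‖a‖ = 1 → inner ℝ a (C.n z - (α • C.n z₁ + β • C.n z₂)) = 0 := by
    intro a ha
    have := h _ (C.isHS_inner ha)
    rw [inner_sub_right, inner_add_right, inner_smul_right, inner_smul_right, this]; ring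
  by_contra hne
  have h0 : ‖C.n z - (α • C.n z₁ + β • C.n z₂)‖ ≠ 0 := norm_ne_zero_iff.2 (sub_ne_zero.2 hne)
  set v := C.n z - (α • C.n z₁ + β • C.n z₂)
  have := key (‖v‖⁻¹ • v) (by rw [norm_smul, norm_inv, norm_norm, inv_mul_cancel₀ h0])
  rw [inner_smul_left, real_inner_self_eq_norm_sq] at this
  simp at this
  exact h0 (by rw [this]; simp)

theorem _root_.BallChar.Comb.t (hd : 1 ≤ d) {α β : ℝ} {z₁ z₂ z : X} (h : Comb g α β z₁ z₂ z) :
    C.t z = α * C.t z₁ + β * C.t z₂ := by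
  obtain ⟨w, hw, -⟩ := exists_unit_orth (∅ : Finset (Vec d)) (by simp; omega)
  have hk : 0 ≤ 1 - g.k := by linarith [g.k_le_one]
  have h1 := h _ (C.isHS_hs (a := Real.sqrt (1 - g.k) • w) (e := 1) (by
    rw [norm_smul, hw, mul_one, Real.norm_eq_abs, sq_abs, Real.sq_sqrt hk]; ring))
  have h2 := h.n C
  rw [hs, hs, hs, h2, inner_add_right, inner_smul_right, inner_smul_right] at h1
  linarith

include C in
theorem uniqueBtwPt_of_comb (hd : 1 ≤ d) {α β : ℝ} (hα : 0 < α) (hβ : 0 < β) {z₁ z₂ z : X}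
    (h : Comb g α β z₁ z₂ z) : UniqueBtwPt z₁ z z₂ := by
  obtain ⟨C, hC⟩ := C.exists_at z
  have hn := h.n C
  have ht := h.t C hd
  rw [C.n_zero hC] at hn
  rw [C.t_zero hC] at ht
  set a := dist z₁ z with ha
  set b := dist z z₂ with hb
  have hs1 : C.s z₁ = g.ps a := by rw [C.s_eq_zero_iff hC, qd_comm]; rfl
  have hs2 : C.s z₂ = g.ps b := by rw [C.s_eq_zero_iff hC]; rfl
  have va : g.Val a := C.val _ _
  have vb : g.Val b := C.val _ _
  have ht1 : C.t z₁ = g.Co a := by rw [t, hs1, g.Co_eq]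
  have ht2 : C.t z₂ = g.Co b := by rw [t, hs2, g.Co_eq]
  rw [ht1, ht2] at ht
  have hn1 : ‖C.n z₁‖ = g.Sn a := by
    rw [← sq_eq_sq₀ (norm_nonneg _) (g.Sn_nonneg va), C.norm_n, hs1, g.Sn_sq]
  have hn2 : ‖C.n z₂‖ = g.Sn b := by
    rw [← sq_eq_sq₀ (norm_nonneg _) (g.Sn_nonneg vb), C.norm_n, hs2, g.Sn_sq]
  have hn' : C.n z₂ = (-(α / β)) • C.n z₁ := by
    have h1 : β • C.n z₂ = (-α) • C.n z₁ := by
      rw [neg_smul]; exact (neg_eq_of_add_eq_zero_right hn.symm).symm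
    calc C.n z₂ = β⁻¹ • (β • C.n z₂) := by rw [smul_smul, inv_mul_cancel₀ hβ.ne', one_smul]
      _ = _ := by rw [h1, smul_smul]; congr 1; field_simp
  have hrel : α * g.Sn a = β * g.Sn b := by
    have := congrArg norm hn'
    rw [norm_smul, norm_neg, Real.norm_of_nonneg (by positivity), hn1, hn2] at this
    rw [this]; field_simp
  have hinner : inner ℝ (C.n z₁) (C.n z₂) = -(g.Sn a * g.Sn b) := by
    rw [hn', inner_smul_right, real_inner_self_eq_norm_sq, hn1]
    have : g.Sn b = α / β * g.Sn a := by field_simp; linarith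
    rw [this]; ring
  have hq : qd g z₁ z₂ = g.ps (a + b) := by
    rw [C.qd_eq, hs1, hs2, hinner, g.ps_add]; ring
  have hval : g.Val (a + b) := by
    refine ⟨add_nonneg va.1 vb.1, ?_⟩
    rintro rfl
    by_contra hlt
    push Not at hlt
    simp only [Geo.Sn, Geo.Co] at ht hrel
    have h1 : β * Real.sin (a + b) = Real.sin a := by
      rw [Real.sin_add]
      linear_combination (-Real.sin a) * ht - Real.cos a * hrel
    have h2 : 0 ≤ Real.sin a := Real.sin_nonneg_of_nonneg_of_le_pi va.1 (va.2 rfl)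
    have h3 : Real.sin (a + b - Real.pi) ≤ 0 := by
      rw [Real.sin_sub_pi]; nlinarith
    by_cases h4 : a + b - Real.pi < Real.pi
    · linarith [Real.sin_pos_of_pos_of_lt_pi (x := a + b - Real.pi) (by linarith) h4]
    · have h5 : a = Real.pi := by linarith [va.2 rfl, vb.2 rfl]
      have h6 : b = Real.pi := by linarith [va.2 rfl, vb.2 rfl]
      rw [h5, h6] at ht
      simp at ht
      linarith
  have hdist : dist z₁ z₂ = a + b := g.ps_inj (C.val _ _) hval hq
  refine ⟨hdist.symm, fun w hw hw' => ?_⟩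
  have hwb : dist w z₂ = b := by
    have : dist z₁ w + dist w z₂ = dist z₁ z₂ := hw
    linarith
  have e1 : qd g z₁ w = g.ps a := by rw [qd, hw']
  have e2 : qd g z₂ w = g.ps b := by rw [qd, dist_comm, hwb]
  rw [C.qd_eq, hs1] at e1
  rw [C.qd_eq, hs2] at e2
  have e3 : α * inner ℝ (C.n z₁) (C.n w) + β * inner ℝ (C.n z₂) (C.n w) = 0 := by
    rw [hn', inner_smul_left]
    simp only [RCLike.conj_to_real]
    field_simp
    ring
  have e4 : C.s w = 0 := by
    rw [g.Co_eq, g.Co_eq] at ht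
    linear_combination α * e1 + β * e2 + e3 + C.s w * ht
  have := C.eq_o e4
  rw [← this, C.eq_o hC]

theorem _root_.BallChar.GConvex.comb_mem {K : Set X} (hK : GConvex K) (C : Chart g d X) (hd : 1 ≤ d)
    {α β : ℝ} (hα : 0 < α) (hβ : 0 < β) {z₁ z₂ z : X} (h : Comb g α β z₁ z₂ z)
    (h₁ : z₁ ∈ K) (h₂ : z₂ ∈ K) : z ∈ K :=
  hK _ h₁ _ h₂ _ (C.uniqueBtwPt_of_comb hd hα hβ h)

/-- Points on the ray from the origin through `z`. -/
theorem comb_polar {u : Vec d} (hu : ‖u‖ = 1) {r r' : ℝ} (hr : g.Sn r ≠ 0) {z : X}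
    (hz : C.n z = g.Sn r • u) (hzt : C.s z = g.ps r) :
    Comb g (g.Sn (r - r') / g.Sn r) (g.Sn r' / g.Sn r) C.o z (C.polar u hu r') := by
  apply C.comb_of
  · rw [n_polar, n_o, hz, smul_zero, zero_add, smul_smul, div_mul_cancel₀ _ hr]
  · rw [t_polar, t_o, t, hzt, ← g.Co_eq, g.Sn_sub]
    field_simp
    ring

/-- Polar coordinates. -/
theorem exists_polar (z : X) (hz : C.n z ≠ 0) : ∃ u : Vec d, ∃ r : ℝ, ‖u‖ = 1 ∧ 0 < r ∧
    r = dist C.o z ∧ g.Val r ∧ (g = Geo.sph → r < Real.pi) ∧ 0 < g.Sn r ∧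
    C.n z = g.Sn r • u ∧ C.s z = g.ps r := by
  have hn : ‖C.n z‖ ≠ 0 := norm_ne_zero_iff.2 hz
  have hval := C.val C.o z
  have hs : C.s z = g.ps (dist C.o z) := C.s_eq z
  have hS : g.Sn (dist C.o z) = ‖C.n z‖ := by
    rw [← sq_eq_sq₀ (g.Sn_nonneg hval) (norm_nonneg _), C.norm_n, hs, g.Sn_sq]
  have hpos : 0 < dist C.o z := by
    refine dist_pos.2 fun h => ?_
    rw [← h] at hz; simp at hz
  refine ⟨‖C.n z‖⁻¹ • C.n z, dist C.o z, ?_, hpos, rfl, hval, ?_, ?_, ?_, hs⟩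
  · rw [norm_smul, norm_inv, norm_norm, inv_mul_cancel₀ hn]
  · rintro rfl
    refine lt_of_le_of_ne (hval.2 rfl) fun h => hn ?_
    rw [← hS, h]; simp [Geo.Sn]
  · rw [hS]; positivity
  · rw [hS, smul_smul, mul_inv_cancel₀ hn, one_smul]

theorem _root_.BallChar.GConvex.polar_mem {K : Set X} (hK : GConvex K) (C : Chart g d X) (hd : 1 ≤ d)
    (ho : C.o ∈ K) {u : Vec d} (hu : ‖u‖ = 1) {r r' : ℝ} (hr0 : 0 < r') (hr : r' < r)
    (hS : g.Val r) {z : X} (hSr : 0 < g.Sn r) (hz : z ∈ K)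
    (hzn : C.n z = g.Sn r • u) (hzs : C.s z = g.ps r) : C.polar u hu r' ∈ K := by
  have h1 : 0 < g.Sn (r - r') := g.Sn_pos (by linarith) (fun h => by linarith [hS.2 h])
  have h2 : 0 < g.Sn r' := g.Sn_pos hr0 (fun h => by linarith [hS.2 h])
  exact hK.comb_mem C hd (div_pos h1 hSr) (div_pos h2 hSr)
    (C.comb_polar hu hSr.ne' hzn hzs) ho hz

/-- A sphere-like function in normal form at one of its zeros. -/
theorem rebase {f₀ β : ℝ} {G : Vec d} {Λ : ℝ} (hΛ : 0 < Λ)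
    (hΛ2 : Λ ^ 2 = ‖G‖ ^ 2 + 2 * β * f₀ - g.k * f₀ ^ 2) {z₀ : X}
    (h0 : f₀ - β * C.s z₀ + inner ℝ G (C.n z₀) = 0) :
    ∃ H : X → ℝ, IsHS g H ∧ H z₀ = 0 ∧ ∀ z, f₀ - β * C.s z + inner ℝ G (C.n z) =
      Λ * (H z - (β - g.k * f₀) / Λ * qd g z₀ z) := by
  set c := (β - g.k * f₀) / Λ with hc
  have hcΛ : β = c * Λ + g.k * f₀ := by rw [hc]; field_simp; ring
  have hform : ∀ z, f₀ - β * C.s z + inner ℝ G (C.n z) =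
      Λ * (C.hs (Λ⁻¹ • G - c • C.n z₀) (f₀ / Λ + c * C.s z₀) z - c * qd g z₀ z) := by
    intro z
    rw [hs, C.qd_eq, inner_sub_left, inner_smul_left, inner_smul_left, t, hcΛ]
    simp only [RCLike.conj_to_real]
    field_simp
    ring
  refine ⟨_, C.isHS_hs (a := Λ⁻¹ • G - c • C.n z₀) (e := f₀ / Λ + c * C.s z₀) ?_, ?_, hform⟩
  · rw [norm_sub_sq_real, norm_smul, norm_smul, inner_smul_left, inner_smul_right, mul_pow, mul_pow,
      C.norm_n, Real.norm_eq_abs, Real.norm_eq_abs, sq_abs, sq_abs]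
    simp only [RCLike.conj_to_real]
    have h1 : inner ℝ G (C.n z₀) = β * C.s z₀ - f₀ := by linarith
    have h2 : ‖G‖ ^ 2 = Λ ^ 2 - 2 * β * f₀ + g.k * f₀ ^ 2 := by linarith
    rw [h1, h2, hcΛ]
    field_simp
    ring
  · have := hform z₀
    rw [h0, qd_self] at this
    rcases mul_eq_zero.1 this.symm with h | h
    · exact absurd h hΛ.ne'
    · linarith

/-- Expansion of a sphere-like function at the origin of a chart. -/
theorem expand {H : X → ℝ} (hH : IsHS g H) {y : X} (hy : H y = 0) (c : ℝ) :
    ∃ G : Vec d, (∀ z, H z - c * qd g y z = (H C.o - c * qd g y C.o)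
      - (c + g.k * (H C.o - c * qd g y C.o)) * C.s z + inner ℝ G (C.n z)) ∧
      ‖G‖ ^ 2 + 2 * c * (H C.o - c * qd g y C.o) + g.k * (H C.o - c * qd g y C.o) ^ 2 = 1 := by
  obtain ⟨a, e, ha, rfl⟩ := (C.isHS_iff H).1 hH
  have h1 : inner ℝ a (C.n y) = - e * C.t y := by rw [hs] at hy; linarith
  have h2 : C.hs a e C.o - c * qd g y C.o = e - c * C.s y := by
    rw [hs, C.qd_eq]; simp
  rw [h2]
  refine ⟨a + c • C.n y, fun z => ?_, ?_⟩
  · rw [hs, C.qd_eq, inner_add_left, inner_smul_left, t]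
    simp only [RCLike.conj_to_real]
    ring
  · rw [norm_add_sq_real, inner_smul_right, h1, norm_smul, mul_pow, C.norm_n, Real.norm_eq_abs,
      sq_abs, t]
    linear_combination ha

include C in
/-- A ball contained in the positive side of a sphere-like function. -/
theorem ball_lower_bound (hd : 1 ≤ d) {H : X → ℝ} (hH : IsHS g H) {y : X} (hy : H y = 0) {c : ℝ}
    (hc : 0 ≤ c) {z : X} {r : ℝ} (hr : g.Val r)
    (hball : ∀ w, qd g z w ≤ g.ps r → 0 ≤ H w - c * qd g y w) :
    g.Sn r - c * g.ps r ≤ H z - c * qd g y z := by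
  obtain ⟨C, hC⟩ := C.exists_at z
  have ho := C.eq_o hC
  obtain ⟨G, hG1, hG2⟩ := C.expand hH hy c
  rw [ho] at hG1 hG2
  set f := H z - c * qd g y z with hf
  have hf0 : 0 ≤ f := hball z (by rw [qd_self]; exact g.ps_nonneg _)
  obtain ⟨u, hu, hGu⟩ : ∃ u : Vec d, ‖u‖ = 1 ∧ inner ℝ G u = -‖G‖ := by
    by_cases hG : G = 0
    · obtain ⟨w, hw, -⟩ := exists_unit_orth (∅ : Finset (Vec d)) (by simp; omega)
      exact ⟨w, hw, by simp [hG]⟩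
    · have hn : ‖G‖ ≠ 0 := norm_ne_zero_iff.2 hG
      refine ⟨-(‖G‖⁻¹ • G), ?_, ?_⟩
      · rw [norm_neg, norm_smul, norm_inv, norm_norm, inv_mul_cancel₀ hn]
      · rw [inner_neg_right, inner_smul_right, real_inner_self_eq_norm_sq]; field_simp
  have h1 := hball (C.polar u hu r) (by rw [← C.s_eq_zero_iff hC, s_polar])
  rw [hG1, s_polar, n_polar, inner_smul_right, hGu] at h1
  have hS := g.Sn_nonneg hr
  have hS2 := g.Sn_sq r
  have hCo := g.Co_eq r
  have hp := g.ps_nonneg r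
  have h2 : 0 ≤ g.Sn r * ‖G‖ := mul_nonneg hS (norm_nonneg _)
  have h3 : g.Sn r * ‖G‖ ≤ f * g.Co r - c * g.ps r := by rw [hCo]; linarith
  have h4 : (g.Sn r * ‖G‖) ^ 2 ≤ (f * g.Co r - c * g.ps r) ^ 2 := pow_le_pow_left₀ h2 h3 2
  have h5 : g.Sn r ^ 2 ≤ (f + c * g.ps r) ^ 2 := by
    have h6 : ‖G‖ ^ 2 = 1 - 2 * c * f - g.k * f ^ 2 := by linarith
    rw [mul_pow, h6, hCo] at h4
    have h7 : g.Sn r ^ 2 * (1 - 2 * c * f - g.k * f ^ 2) =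
      g.Sn r ^ 2 - (2 * g.ps r - g.k * g.ps r ^ 2) * (2 * c * f + g.k * f ^ 2) := by
      rw [hS2]; ring
    rw [h7] at h4
    linarith
  have h6 := abs_le_of_sq_le_sq' h5 (by positivity)
  linarith [h6.2]

include C in
/-- A sphere-like function takes both signs near each of its zeros. -/
theorem both_signs {H : X → ℝ} (hH : IsHS g H) {y : X} (hy : H y = 0) (c : ℝ) {δ : ℝ}
    (hδ : 0 < δ) : (∃ z, qd g y z < δ ∧ 0 < H z - c * qd g y z) ∧
      ∃ z, qd g y z < δ ∧ H z - c * qd g y z < 0 := by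
  obtain ⟨C, hC⟩ := C.exists_at y
  obtain ⟨a, ha, hHa⟩ := C.isHS_zero hC hH hy
  have h1 : ∀ᶠ r in nhdsWithin (0 : ℝ) (Ioi 0), g.ps r < δ :=
    nhdsWithin_le_nhds ((g.continuous_ps.tendsto 0).eventually_lt_const (by simpa using hδ))
  obtain ⟨r, ⟨⟨hr, hv, hS, -, h2⟩, ⟨-, -, -, -, h3⟩⟩, h4⟩ :=
    (((g.eventually_small c).and (g.eventually_small (-c))).and h1).exists
  refine ⟨⟨C.polar a ha r, ?_, ?_⟩, ⟨C.polar a ha (-r), ?_, ?_⟩⟩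
  · rwa [← C.s_eq_zero_iff hC, s_polar]
  · rw [hHa, ← C.s_eq_zero_iff hC, s_polar, n_polar, inner_smul_right, real_inner_self_eq_norm_sq, ha]
    linarith
  · rwa [← C.s_eq_zero_iff hC, s_polar, g.ps_neg]
  · rw [hHa, ← C.s_eq_zero_iff hC, s_polar, n_polar, inner_smul_right, real_inner_self_eq_norm_sq, ha,
      g.ps_neg, g.Sn_neg]
    linarith

theorem _root_.BallChar.IsHS.sq_le {H : X → ℝ} (hH : IsHS g H) (C : Chart g d X) {y : X} (hy : H y = 0)
    (z : X) : H z ^ 2 ≤ 2 * qd g y z - g.k * qd g y z ^ 2 := by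
  obtain ⟨C, hC⟩ := C.exists_at y
  obtain ⟨a, ha, hHa⟩ := C.isHS_zero hC hH hy
  have h1 := abs_real_inner_le_norm a (C.n z)
  rw [ha, one_mul] at h1
  rw [hHa, ← C.s_eq_zero_iff hC, ← C.norm_n, ← sq_abs]
  exact pow_le_pow_left₀ (abs_nonneg _) h1 2

end Chart
end

section
variable {g : Geo} {d : ℕ} {X : Type*} [MetricSpace X]

namespace Chart
variable (C : Chart g d X)

include C in
theorem closedBall_eq (p : X) {r : ℝ} (hr : g.Val r) : closedBall p r = {z | qd g p z ≤ g.ps r} := by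
  ext z
  rw [mem_closedBall, dist_comm, mem_ofPred_eq, C.qd_le_of hr]

include C in
theorem sphere_eq (p : X) {r : ℝ} (hr : g.Val r) : sphere p r = {z | qd g p z = g.ps r} := by
  ext z
  rw [mem_sphere, dist_comm, mem_ofPred_eq]
  exact ⟨fun h => by rw [qd, h], fun h => g.ps_inj (C.val p z) hr h⟩

include C in
theorem exists_qd_lt {ε : ℝ} (hε : 0 < ε) : ∃ δ > 0, ∀ z w : X, qd g z w < δ → dist z w < ε := by
  have hv : g.Val (min ε 1) :=
    ⟨le_min hε.le zero_le_one, fun _ => (min_le_right _ _).trans (by linarith [Real.pi_gt_three])⟩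
  refine ⟨g.ps (min ε 1), g.ps_pos hv (lt_min hε one_pos), fun z w h => ?_⟩
  exact ((C.qd_lt_of hv).1 h).trans_le (min_le_left _ _)

include C in
theorem mem_nhds_iff {z : X} {U : Set X} :
    U ∈ nhds z ↔ ∃ δ > 0, ∀ w, qd g z w < δ → w ∈ U := by
  constructor
  · intro h
    obtain ⟨ε, hε, hU⟩ := Metric.mem_nhds_iff.1 h
    obtain ⟨δ, hδ, h'⟩ := C.exists_qd_lt hε
    exact ⟨δ, hδ, fun w hw => hU (by rw [mem_ball, dist_comm]; exact h' z w hw)⟩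
  · rintro ⟨δ, hδ, h⟩
    refine mem_of_superset ?_ (fun w hw => h w hw)
    exact (isOpen_lt (continuous_qd z) continuous_const).mem_nhds (by simpa [qd_self] using hδ)

include C in
theorem mem_interior_iff {z : X} {U : Set X} :
    z ∈ interior U ↔ ∃ δ > 0, ∀ w, qd g z w < δ → w ∈ U := by
  rw [mem_interior_iff_mem_nhds, C.mem_nhds_iff]

include C in
theorem isCompact_qd_le (p : X) (M : ℝ) : IsCompact {z : X | qd g p z ≤ M} := by
  obtain ⟨C, hC⟩ := C.exists_at p
  have hs : {z : X | qd g p z ≤ M} = {z | C.s z ≤ M} := by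
    ext z; simp [C.s_eq_zero_iff hC]
  rw [hs, isCompact_iff_isSeqCompact]
  intro u hu
  have hcpt : IsCompact ((closedBall (0 : Vec d) (2 * |M| + |M| ^ 2 + 1)) ×ˢ Icc (0 : ℝ) M) :=
    (isCompact_closedBall _ _).prod isCompact_Icc
  have hmem : ∀ k, ((C.n (u k), C.s (u k)) : Vec d × ℝ) ∈
      (closedBall (0 : Vec d) (2 * |M| + |M| ^ 2 + 1)) ×ˢ Icc (0 : ℝ) M := by
    intro k
    have h0 := C.s_nonneg (u k)
    have h1 : C.s (u k) ≤ M := hu k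
    have hM : |M| = M := abs_of_nonneg (h0.trans h1)
    refine ⟨?_, h0, h1⟩
    rw [mem_closedBall_zero_iff, hM]
    have h2 := C.norm_n (u k)
    have h3 := g.neg_one_le_k
    have h4 : ‖C.n (u k)‖ ^ 2 ≤ 2 * M + M ^ 2 := by nlinarith [sq_nonneg (C.s (u k))]
    nlinarith [norm_nonneg (C.n (u k)), sq_nonneg (‖C.n (u k)‖ - 1)]
  obtain ⟨⟨v, r⟩, -, φ, hφ, hlim⟩ := hcpt.isSeqCompact hmem
  have hl1 : Tendsto (fun k => C.n (u (φ k))) atTop (nhds v) := (continuous_fst.tendsto _).comp hlim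
  have hl2 : Tendsto (fun k => C.s (u (φ k))) atTop (nhds r) := (continuous_snd.tendsto _).comp hlim
  have hr : 0 ≤ r := ge_of_tendsto' hl2 fun k => C.s_nonneg _
  have hrM : r ≤ M := le_of_tendsto' hl2 fun k => hu _
  have hvr : ‖v‖ ^ 2 = 2 * r - g.k * r ^ 2 := by
    have e1 : Tendsto (fun k => ‖C.n (u (φ k))‖ ^ 2) atTop (nhds (‖v‖ ^ 2)) := (hl1.norm).pow 2
    have e2 : Tendsto (fun k => 2 * C.s (u (φ k)) - g.k * C.s (u (φ k)) ^ 2) atTop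
        (nhds (2 * r - g.k * r ^ 2)) := (hl2.const_mul 2).sub ((hl2.pow 2).const_mul g.k)
    simp_rw [C.norm_n] at e1
    exact tendsto_nhds_unique e1 e2
  refine ⟨C.pt v r hr hvr, by simpa using hrM, φ, hφ, ?_⟩
  have e3 : Tendsto (fun k => qd g (C.pt v r hr hvr) (u (φ k))) atTop (nhds 0) := by
    have : Tendsto (fun k => r + C.s (u (φ k)) - g.k * r * C.s (u (φ k)) - inner ℝ v (C.n (u (φ k))))
        atTop (nhds (r + r - g.k * r * r - inner ℝ v v)) :=
      (((tendsto_const_nhds.add hl2).sub (hl2.const_mul _))).sub (tendsto_const_nhds.inner hl1)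
    rw [real_inner_self_eq_norm_sq, hvr] at this
    simp_rw [C.qd_eq, C.s_pt, C.n_pt]
    convert this using 2
    ring
  rw [Metric.tendsto_nhds]
  intro ε hε
  obtain ⟨δ, hδ, h⟩ := C.exists_qd_lt hε
  filter_upwards [e3.eventually_lt_const hδ] with k hk
  rw [Function.comp_apply, dist_comm]
  exact h _ _ hk

include C in
theorem exists_nearest {K : Set X} (hK : IsClosed K) (hne : K.Nonempty) (v : X) :
    ∃ y ∈ K, ∀ z ∈ K, qd g v y ≤ qd g v z := by
  obtain ⟨k, hk⟩ := hne
  obtain ⟨y, ⟨hy1, hy2⟩, hy⟩ := ((C.isCompact_qd_le v (qd g v k)).inter_left hK).exists_isMinOn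
    ⟨k, hk, le_refl (qd g v k)⟩ (continuous_qd v).continuousOn
  refine ⟨y, hy1, fun z hz => ?_⟩
  by_cases h : qd g v z ≤ qd g v k
  · exact hy (show z ∈ K ∩ {z | qd g v z ≤ qd g v k} from ⟨hz, h⟩)
  · exact (show qd g v y ≤ qd g v k from hy2).trans (not_le.1 h).le

include C in
/-- Separation of a point from a convex set by the hyperplane at a nearest point. -/
theorem exists_separating (hd : 1 ≤ d) {K : Set X} (hK : GConvex K) {v y : X} (hv : v ∉ K)
    (hy : y ∈ K) (hmin : ∀ z ∈ K, qd g v y ≤ qd g v z) (hpi : g = Geo.sph → dist y v < Real.pi) :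
    ∃ H : X → ℝ, IsHS g H ∧ H y = 0 ∧ (∀ z ∈ K, 0 ≤ H z) ∧ H v < 0 := by
  obtain ⟨C, hC⟩ := C.exists_at y
  have ho := C.eq_o hC
  have hvy : y ≠ v := fun h => hv (h ▸ hy)
  have hnv : C.n v ≠ 0 := by
    intro h
    have h1 := C.norm_n v
    rw [h, norm_zero] at h1
    have h2 : C.s v = g.ps (dist y v) := C.s_eq_zero_iff hC v
    have h3 := g.Sn_sq (dist y v)
    rw [← h2] at h3
    have h4 := g.Sn_pos (dist_pos.2 hvy) hpi
    nlinarith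
  obtain ⟨a, r, ha, hr, -, hvr, hrpi, hSr, hvn, hvs⟩ := C.exists_polar v hnv
  refine ⟨fun z => inner ℝ (-a) (C.n z), C.isHS_inner (by rwa [norm_neg]), ?_, fun z hz => ?_, ?_⟩
  · simp only [C.n_zero hC, inner_zero_right]
  · by_contra hneg
    push Not at hneg
    have hnz : C.n z ≠ 0 := fun h => by simp [h] at hneg
    obtain ⟨u, r', hu, hr', -, hzv, -, hSr', hzn, hzs⟩ := C.exists_polar z hnz
    have hau : 0 < inner ℝ a u := by
      rw [hzn, inner_smul_right, inner_neg_left] at hneg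
      by_contra h
      push Not at h
      nlinarith
    obtain ⟨σ, hσ, hσr, -, hSσ, -, hσ2⟩ := g.exists_small (g.Co r / (g.Sn r * inner ℝ a u)) hr'
    have hmem := hK.polar_mem C hd (ho ▸ hy) hu hσ hσr hzv hSr' hz hzn hzs
    have h1 := hmin _ hmem
    rw [C.qd_eq, C.qd_eq, C.n_zero hC, hC, s_polar, n_polar, hvs, hvn, inner_smul_left,
      inner_smul_right] at h1
    simp only [inner_smul_left, RCLike.conj_to_real, inner_zero_right] at h1
    rw [div_mul_eq_mul_div, div_lt_iff₀ (by positivity)] at hσ2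
    rw [g.Co_eq] at hσ2
    nlinarith
  · show inner ℝ (-a) (C.n v) < 0
    rw [hvn, inner_smul_right, inner_neg_left, real_inner_self_eq_norm_sq, ha]
    nlinarith

include C in
theorem pos_of_mem_interior {K : Set X} {H : X → ℝ} (hH : IsHS g H) (hK : ∀ z ∈ K, 0 ≤ H z) {z : X}
    (hz : z ∈ interior K) : 0 < H z := by
  rcases (hK z (interior_subset hz)).lt_or_eq with h | h
  · exact h
  · obtain ⟨δ, hδ, h1⟩ := C.mem_interior_iff.1 hz
    obtain ⟨-, w, hw, hw'⟩ := C.both_signs hH h.symm 0 hδ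
    have := hK w (h1 w hw)
    linarith

include C in
/-- Points strictly between an interior point and another point are interior. -/
theorem comb_mem_interior (hd : 1 ≤ d) {K : Set X} (hKc : IsClosed K) (hK : GConvex K) {w z x : X}
    (hw : w ∈ interior K) (hz : z ∈ K) {α β : ℝ} (hα : 0 < α) (hβ : 0 < β)
    (h : Comb g α β w z x) : x ∈ interior K := by
  by_contra hx
  have hxK : x ∈ K := hK.comb_mem C hd hα hβ h (interior_subset hw) hz
  obtain ⟨δ, hδ, hball⟩ := C.mem_interior_iff.1 hw
  obtain ⟨ρ, ⟨hρ, hρv, hSρ, -⟩, hρδ⟩ : ∃ ρ, (0 < ρ ∧ g.Val ρ ∧ 0 < g.Sn ρ ∧ 0 < g.Co ρ ∧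
      0 * g.ps ρ < g.Sn ρ) ∧ g.ps ρ < δ := by
    have h1 : ∀ᶠ r in nhdsWithin (0 : ℝ) (Ioi 0), g.ps r < δ :=
      nhdsWithin_le_nhds ((g.continuous_ps.tendsto 0).eventually_lt_const (by simpa using hδ))
    exact ((g.eventually_small 0).and h1).exists
  set η := α * g.Sn ρ with hη
  have hηpos : 0 < η := mul_pos hα hSρ
  have hopen : {v | 2 * qd g x v + qd g x v ^ 2 < η ^ 2} ∈ nhds x := by
    refine (isOpen_lt ?_ continuous_const).mem_nhds (by simpa [qd_self] using pow_pos hηpos 2)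
    have := continuous_qd (g := g) x
    fun_prop
  obtain ⟨ε, hε, hεU⟩ := Metric.mem_nhds_iff.1 hopen
  obtain ⟨v, hv, hvK⟩ : ∃ v, dist v x < min (ε / 2) 1 ∧ v ∉ K := by
    by_contra hcon
    push Not at hcon
    exact hx (mem_interior_iff_mem_nhds.2 (Metric.mem_nhds_iff.2 ⟨min (ε / 2) 1,
      lt_min (by linarith) one_pos, fun v hv => hcon v hv⟩))
  obtain ⟨y, hy, hmin⟩ := C.exists_nearest hKc ⟨x, hxK⟩ v
  have hvy : dist v y ≤ dist v x := (g.ps_le (C.val _ _) (C.val _ _)).1 (hmin x hxK)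
  obtain ⟨H, hH, hHy, hHK, -⟩ := C.exists_separating hd hK hvK hy hmin (fun _ => by
    rw [dist_comm]
    linarith [Real.pi_gt_three, hv.trans_le (min_le_right _ _)])
  have h1 := C.ball_lower_bound hd hH hHy le_rfl (z := w) hρv (fun u hu => by
    have := hHK u (hball u (hu.trans_lt hρδ)); linarith)
  have h2 := h H hH
  have h3 := hHK z hz
  have h4 : η ≤ H x := by rw [h2, hη]; nlinarith
  have h5 := hH.sq_le C hHy x
  have h6 : 2 * qd g x y + qd g x y ^ 2 < η ^ 2 := by
    refine hεU ?_
    rw [mem_ball]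
    have := dist_triangle y v x
    rw [dist_comm y v] at this
    linarith [hv.trans_le (min_le_left _ _)]
  rw [qd_comm y x] at h5
  nlinarith [g.neg_one_le_k, sq_nonneg (qd g x y)]

end Chart

/-- `H` is an inner support function of `K` at `x`, with an inner tangent ball. -/
structure Supp (g : Geo) (K : Set X) (x : X) (H : X → ℝ) (c : ℝ) : Prop where
  isHS : IsHS g H
  zero : H x = 0
  nonneg : ∀ z ∈ K, 0 ≤ H z
  pos : 0 < c
  inner : ∀ z, c * qd g x z ≤ H z → z ∈ K

theorem Supp.mem {K : Set X} {x : X} {H : X → ℝ} {c : ℝ} (h : Supp g K x H c) : x ∈ K :=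
  h.inner x (by rw [qd_self, h.zero]; simp)

theorem Supp.mem_frontier (C : Chart g d X) {K : Set X} {x : X} {H : X → ℝ} {c : ℝ}
    (h : Supp g K x H c) : x ∈ frontier K := by
  refine ⟨subset_closure h.mem, fun hx => ?_⟩
  have := C.pos_of_mem_interior h.isHS h.nonneg hx
  rw [h.zero] at this
  exact lt_irrefl _ this

theorem Supp.image {K : Set X} {x : X} {H : X → ℝ} {c : ℝ} (h : Supp g K x H c) (f : X ≃ᵢ X) :
    Supp g (f '' K) (f x) (H ∘ f.symm) c where
  isHS := h.isHS.comp _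
  zero := by simp [h.zero]
  nonneg := by rintro _ ⟨z, hz, rfl⟩; simpa using h.nonneg z hz
  pos := h.pos
  inner z hz := ⟨f.symm z, h.inner _ (by
    rw [← qd_isom f, f.apply_symm_apply]; exact hz), by simp⟩

/-- Tangent hyperplanes are unique. -/
theorem Chart.tangent_unique (C : Chart g d X) {H H' : X → ℝ} (hH : IsHS g H) (hH' : IsHS g H')
    {x : X} (hx : H x = 0) (hx' : H' x = 0) {c c' δ : ℝ} (hδ : 0 < δ)
    (h : ∀ z, qd g x z < δ → c * qd g x z ≤ H z → c' * qd g x z ≤ H' z) : H = H' := by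
  obtain ⟨C, hC⟩ := C.exists_at x
  obtain ⟨a, ha, hHa⟩ := C.isHS_zero hC hH hx
  obtain ⟨a', ha', hHa'⟩ := C.isHS_zero hC hH' hx'
  by_cases haa : a = a'
  · funext z; rw [hHa, hHa', haa]
  exfalso
  have hn : 0 < ‖a - a'‖ := norm_pos_iff.2 (sub_ne_zero.2 haa)
  have h2 : ‖a - a'‖ ^ 2 = 2 - 2 * inner ℝ a a' := by
    rw [norm_sub_sq_real, ha, ha']; ring
  set u := ‖a - a'‖⁻¹ • (a - a') with hu
  have hu1 : ‖u‖ = 1 := by rw [hu, norm_smul, norm_inv, norm_norm, inv_mul_cancel₀ hn.ne']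
  have e1 : inner ℝ a u = ‖a - a'‖ / 2 := by
    rw [hu, inner_smul_right, inner_sub_right, real_inner_self_eq_norm_sq, ha]
    field_simp; linarith
  have e2 : inner ℝ a' u = -(‖a - a'‖ / 2) := by
    rw [hu, inner_smul_right, inner_sub_right, real_inner_self_eq_norm_sq, ha', real_inner_comm]
    field_simp; linarith
  set m := ‖a - a'‖ / 2 with hm
  have hmpos : 0 < m := by positivity
  have h1 : ∀ᶠ r in nhdsWithin (0 : ℝ) (Ioi 0), g.ps r < δ :=
    nhdsWithin_le_nhds ((g.continuous_ps.tendsto 0).eventually_lt_const (by simpa using hδ))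
  obtain ⟨r, ⟨⟨hr, hv, hS, -, h3⟩, ⟨-, -, -, -, h4⟩⟩, h5⟩ :=
    (((g.eventually_small (c / m)).and (g.eventually_small (-c' / m))).and h1).exists
  have hq : qd g x (C.polar u hu1 r) = g.ps r := by rw [← C.s_eq_zero_iff hC, C.s_polar]
  have h6 := h (C.polar u hu1 r) (by rwa [hq]) (by
    rw [hq, hHa, C.n_polar, inner_smul_right, e1]
    rw [div_mul_eq_mul_div, div_lt_iff₀ hmpos] at h3
    exact h3.le)
  rw [hq, hHa', C.n_polar, inner_smul_right, e2] at h6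
  rw [div_mul_eq_mul_div, div_lt_iff₀ hmpos] at h4
  linarith

theorem Supp.unique (C : Chart g d X) {K : Set X} {x : X} {H H' : X → ℝ} {c c' : ℝ}
    (h : Supp g K x H c) (h' : Supp g K x H' c') : H = H' :=
  C.tangent_unique h.isHS h'.isHS h.zero h'.zero (c := c) (c' := 0) one_pos
    fun z _ hz => by have := h'.nonneg z (h.inner z hz); linarith

/-- Bodies satisfying the inner ball condition have support functions at all boundary points. -/
theorem Chart.exists_supp (C : Chart g d X) (hd : 1 ≤ d) {K : Set X} (hKc : IsClosed K)
    (hK : GConvex K) (hKb : CondBallInside K) {x : X} (hx : x ∈ frontier K) :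
    ∃ H c, Supp g K x H c := by
  obtain ⟨ε, hε, p, hball, hxp⟩ := hKb x hx
  obtain ⟨C, hC⟩ := C.exists_at x
  have ho := C.eq_o hC
  have hpx : dist x p = ε := hxp
  have hεv : g.Val ε := hpx ▸ C.val _ _
  rw [C.closedBall_eq p hεv] at hball
  have hsp : C.s p = g.ps ε := by rw [C.s_eq_zero_iff hC, qd, hpx]
  have hnp : C.n p ≠ 0 := by
    intro h0
    have h1 := C.norm_n p
    rw [h0, norm_zero, hsp] at h1
    have hpos := g.ps_pos hεv hε
    have h2 : g.k * g.ps ε = 2 := by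
      have : g.ps ε * (2 - g.k * g.ps ε) = 0 := by nlinarith
      rcases mul_eq_zero.1 this with h | h
      · exact absurd h hpos.ne'
      · linarith
    refine hx.2 (C.mem_interior_iff.2 ⟨1, one_pos, fun w _ => hball ?_⟩)
    have h3 := g.k_ps_le (dist p w)
    have hk : 0 < g.k := by
      by_contra h
      push Not at h
      nlinarith
    have : g.k * g.ps (dist p w) ≤ g.k * g.ps ε := by rw [h2]; exact h3
    exact le_of_mul_le_mul_left this hk
  obtain ⟨a, r, ha, hr, hrd, -, -, hSr, hpn, -⟩ := C.exists_polar p hnp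
  rw [ho, hpx] at hrd
  subst hrd
  have hmem : ∀ z, g.Co r * C.s z ≤ g.Sn r * inner ℝ a (C.n z) → z ∈ K := by
    intro z hz
    refine hball ?_
    rw [mem_ofPred_eq, C.qd_eq, hsp, hpn, inner_smul_left]
    rw [g.Co_eq] at hz
    simp only [RCLike.conj_to_real]
    linarith
  have hHS := C.isHS_inner (g := g) ha
  refine ⟨fun z => inner ℝ a (C.n z), max (g.Co r / g.Sn r) 1, hHS,
    by simp [C.n_zero hC], fun z hz => ?_, by positivity, fun z hz => ?_⟩
  · by_contra hneg
    push Not at hneg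
    have hnz : C.n z ≠ 0 := fun h => by simp [h] at hneg
    obtain ⟨u, r', hu, hr', -, hzv, hrpi, hSr', hzn, hzs⟩ := C.exists_polar z hnz
    have hau : inner ℝ a u < 0 := by
      rw [hzn, inner_smul_right] at hneg
      by_contra h
      push Not at h
      nlinarith
    obtain ⟨θ, hθ, hθπ⟩ : ∃ θ > 0, g = Geo.sph → θ ≤ Real.pi - r' := by
      by_cases hg : g = Geo.sph
      · exact ⟨Real.pi - r', by linarith [hrpi hg], fun _ => le_rfl⟩
      · exact ⟨1, one_pos, fun h => absurd h hg⟩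
    obtain ⟨σ, hσ, hσr, hσv, hSσ, -, hσ2⟩ := g.exists_small (g.Co r / (g.Sn r * -inner ℝ a u)) hθ
    rw [div_mul_eq_mul_div, div_lt_iff₀ (by nlinarith)] at hσ2
    have hu' : ‖-u‖ = 1 := by rwa [norm_neg]
    have hw : C.polar (-u) hu' σ ∈ interior K := by
      rw [mem_interior_iff_mem_nhds]
      have hop : IsOpen {z | g.Co r * C.s z < g.Sn r * inner ℝ a (C.n z)} :=
        isOpen_lt (continuous_const.mul C.continuous_s)
          (continuous_const.mul (continuous_const.inner C.continuous_n))
      refine mem_of_superset (hop.mem_nhds ?_) (fun z hz => hmem z (le_of_lt hz))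
      rw [mem_ofPred_eq, C.s_polar, C.n_polar, inner_smul_right, inner_neg_right]
      linarith
    have hS : 0 < g.Sn (r' + σ) := g.Sn_pos (by linarith) (fun h => by linarith [hθπ h])
    have hcomb : Comb g (g.Sn r' / g.Sn (r' + σ)) (g.Sn σ / g.Sn (r' + σ)) (C.polar (-u) hu' σ) z x := by
      apply C.comb_of
      · rw [C.n_zero hC, C.n_polar, hzn, smul_smul, smul_smul, smul_neg, ← sub_eq_neg_add, ← sub_smul]
        have : g.Sn σ / g.Sn (r' + σ) * g.Sn r' - g.Sn r' / g.Sn (r' + σ) * g.Sn σ = 0 := by ring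
        rw [this, zero_smul]
      · rw [C.t_zero hC, C.t_polar, Chart.t, hzs, ← g.Co_eq]
        rw [g.Sn_add] at hS ⊢
        field_simp
    exact hx.2 (C.comb_mem_interior hd hKc hK hw hz (div_pos hSr' hS) (div_pos hSσ hS) hcomb)
  · refine hmem z ?_
    rw [← C.s_eq_zero_iff hC] at hz
    have h1 : g.Co r / g.Sn r * C.s z ≤ inner ℝ a (C.n z) :=
      (mul_le_mul_of_nonneg_right (le_max_left _ _) (C.s_nonneg z)).trans hz
    rw [div_mul_eq_mul_div, div_le_iff₀ hSr] at h1
    linarith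

/-- `K` is locally contained in the sphere of curvature `c` with inner normal function `H`. -/
def OutC (g : Geo) (K : Set X) (x : X) (H : X → ℝ) (c : ℝ) : Prop :=
  ∃ δ > 0, ∀ z ∈ K, qd g x z < δ → c * qd g x z ≤ H z

/-- `K` locally contains the sphere of curvature `c` with inner normal function `H`. -/
def InC (g : Geo) (K : Set X) (x : X) (H : X → ℝ) (c : ℝ) : Prop :=
  ∃ δ > 0, ∀ z, qd g x z < δ → c * qd g x z < H z → z ∈ K

end

section
variable {g : Geo} {d : ℕ} {X : Type*} [MetricSpace X]

theorem Btw.image {x z y : X} (h : Btw x z y) (f : X ≃ᵢ X) : Btw (f x) (f z) (f y) := by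
  simpa [Btw, f.dist_eq] using h

theorem GConvex.image {K : Set X} (h : GConvex K) (f : X ≃ᵢ X) : GConvex (f '' K) := by
  rintro _ ⟨x, hx, rfl⟩ _ ⟨y, hy, rfl⟩ z hz
  refine ⟨f.symm z, h x hx y hy _ ⟨?_, fun w hw hwz => ?_⟩, by simp⟩
  · simpa using hz.1.image f.symm
  · have := hz.2 (f w) (hw.image f) (by rw [f.dist_eq, hwz, ← f.dist_eq]; simp)
    rw [← this]; simp

theorem IsReflection.conj {σ : X ≃ᵢ X} (h : IsReflection σ) (f : X ≃ᵢ X) :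
    IsReflection ((f.symm.trans σ).trans f) := by
  obtain ⟨h1, h2, h3⟩ := h
  have h1' : ∀ z, σ (σ z) = z := fun z => congrArg (fun e : X ≃ᵢ X => e z) h1
  refine ⟨?_, ?_, ?_⟩
  · ext z; simp only [IsometryEquiv.trans_apply, f.symm_apply_apply, h1', f.apply_symm_apply]; rfl
  · intro hc
    apply h2
    ext z
    have h4 := congrArg (fun e : X ≃ᵢ X => e (f z)) hc
    simp only [IsometryEquiv.trans_apply, f.symm_apply_apply] at h4
    exact f.injective h4
  · intro hc
    apply h3
    have := hc.image f.symm f.symm.continuous.continuousOn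
    convert this using 1
    ext z
    constructor
    · intro hz
      refine ⟨f z, ?_, by simp⟩
      simpa using hz
    · rintro ⟨w, hw, rfl⟩ hz
      apply hw
      simp only [IsometryEquiv.trans_apply]
      rw [hz]; simp

theorem OrientationPreserving.conj {ρ : X ≃ᵢ X} (h : OrientationPreserving ρ) (f : X ≃ᵢ X) :
    OrientationPreserving ((f.symm.trans ρ).trans f) := by
  obtain ⟨k, hk, hr⟩ := (orientationPreserving_iff _).1 h
  refine (orientationPreserving_iff _).2 ⟨k, hk, ?_⟩
  clear h hk
  obtain ⟨l, hl, rfl, rfl⟩ := hr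
  induction l with
  | nil =>
    have h : (f.symm.trans (IsometryEquiv.refl X)).trans f = IsometryEquiv.refl X := by
      ext z; exact f.apply_symm_apply z
    change RefProd 0 ((f.symm.trans (IsometryEquiv.refl X)).trans f)
    rw [h]
    exact refProd_refl
  | cons σ l ih =>
    convert ((hl σ (by simp)).conj f).refProd.trans (ih fun τ hτ => hl τ (by simp [hτ])) using 1
    · simp [add_comm]
    · ext z; simp

theorem OrientationPreserving.trans {ρ τ : X ≃ᵢ X} (h : OrientationPreserving ρ)
    (h' : OrientationPreserving τ) : OrientationPreserving (ρ.trans τ) := by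
  obtain ⟨k, hk, hr⟩ := (orientationPreserving_iff _).1 h
  obtain ⟨k', hk', hr'⟩ := (orientationPreserving_iff _).1 h'
  exact (orientationPreserving_iff _).2 ⟨k + k', hk.add hk', hr.trans hr'⟩

/-- Two convex sets in a position where their intersection is a small lens around
the origin of the chart, with an inball touching the boundary in `x` and `y`. -/
structure Lens (C : Chart g d X) (a : Vec d) (r c c₁ c₂ σ₁ : ℝ) (K L : Set X) (x y : X) :
    Prop where
  ha : ‖a‖ = 1
  r_pos : 0 < r
  val : g.Val r
  Sn_pos : 0 < g.Sn r
  Co_pos : 0 < g.Co r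
  nx : C.n x = g.Sn r • a
  sx : C.s x = g.ps r
  ny : C.n y = -(g.Sn r • a)
  sy : C.s y = g.ps r
  suppK : Supp g K x (C.hs (-(g.Co r • a)) (g.Sn r)) c₁
  suppL : Supp g L y (C.hs (g.Co r • a) (g.Sn r)) c₂
  out : ∀ z ∈ K, C.s z ≤ σ₁ → c * qd g x z ≤ C.hs (-(g.Co r • a)) (g.Sn r) z
  c_pos : 0 < c
  small_one : c₁ * g.Sn r < g.Co r
  small_two : c₂ * g.Sn r < g.Co r
  small_out : c * g.Sn r < g.Co r
  small_ball : 0 < 2 * g.k * g.Sn r * g.Co r - g.k * c * g.Sn r ^ 2 + c * g.Co r ^ 2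
  σ_pos : 0 < σ₁
  k_σ : g.k * σ₁ ≤ 2
  small_lens : g.Sn r * (1 - g.k * σ₁) * (2 * g.Co r - c * g.Sn r) < c * g.Co r ^ 2 * σ₁
  r_lt : g.ps r < σ₁
  convK : GConvex K
  convL : GConvex L

namespace Lens
variable {C : Chart g d X} {a : Vec d} {r c c₁ c₂ σ₁ : ℝ} {K L : Set X} {x y : X}
  (D : Lens C a r c c₁ c₂ σ₁ K L x y)
include D

theorem qd_x (z : X) : qd g x z = g.ps r + g.Co r * C.s z - g.Sn r * inner ℝ a (C.n z) := by
  rw [C.qd_eq, D.nx, D.sx, inner_smul_left, RCLike.conj_to_real, g.Co_eq]; ring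

theorem qd_y (z : X) : qd g y z = g.ps r + g.Co r * C.s z + g.Sn r * inner ℝ a (C.n z) := by
  rw [C.qd_eq, D.ny, D.sy, inner_neg_left, inner_smul_left, RCLike.conj_to_real, g.Co_eq]; ring

omit D in
theorem hs_one (z : X) : C.hs (-(g.Co r • a)) (g.Sn r) z =
    -(g.Co r * inner ℝ a (C.n z)) + g.Sn r * (1 - g.k * C.s z) := by
  rw [Chart.hs, inner_neg_left, inner_smul_left, RCLike.conj_to_real, Chart.t]

omit D in
theorem hs_two (z : X) : C.hs (g.Co r • a) (g.Sn r) z =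
    g.Co r * inner ℝ a (C.n z) + g.Sn r * (1 - g.k * C.s z) := by
  rw [Chart.hs, inner_smul_left, RCLike.conj_to_real, Chart.t]

theorem key_one (z : X) : g.Sn r * C.hs (-(g.Co r • a)) (g.Sn r) z =
    g.Co r * qd g x z + (g.ps r - C.s z) := by
  rw [D.qd_x, hs_one]
  have h1 := g.Sn_sq r
  have h2 := g.Co_eq r
  linear_combination (1 - g.k * C.s z) * h1 - (g.ps r + C.s z * (g.Co r + (1 - g.k * g.ps r))) * h2

theorem key_two (z : X) : g.Sn r * C.hs (g.Co r • a) (g.Sn r) z =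
    g.Co r * qd g y z + (g.ps r - C.s z) := by
  rw [D.qd_y, hs_two]
  have h1 := g.Sn_sq r
  have h2 := g.Co_eq r
  linear_combination (1 - g.k * C.s z) * h1 - (g.ps r + C.s z * (g.Co r + (1 - g.k * g.ps r))) * h2

theorem symm_aux {K' : Set X} {x' : X} {b : Vec d} {e : ℝ} {c' : ℝ}
    (hS : Supp g K' x' (C.hs b e) c')
    (hkey : ∀ z, g.Sn r * C.hs b e z = g.Co r * qd g x' z + (g.ps r - C.s z))
    (hc : c' * g.Sn r < g.Co r) {z : X} (hz : C.s z ≤ g.ps r) :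
    z ∈ K' ∧ (z ≠ x' → z ∈ interior K') := by
  have h0 : 0 < g.Sn r := D.Sn_pos
  have h1 := hkey z
  have h2 := qd_nonneg (g := g) x' z
  have h3 := hS.pos
  refine ⟨hS.inner z ?_, fun hne => ?_⟩
  · by_contra! hc
    nlinarith
  · have h4 := C.qd_pos hne.symm
    have hop : IsOpen {z | c' * qd g x' z < C.hs b e z} :=
      isOpen_lt (continuous_const.mul (continuous_qd _)) (C.continuous_hs b e)
    refine mem_interior.2 ⟨_, fun w hw => hS.inner w (le_of_lt hw), hop, ?_⟩
    change c' * qd g x' z < C.hs b e z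
    by_contra! hc
    nlinarith

theorem ball_subset {z : X} (hz : C.s z ≤ g.ps r) : z ∈ K ∩ L :=
  ⟨(D.symm_aux D.suppK D.key_one D.small_one hz).1, (D.symm_aux D.suppL D.key_two D.small_two hz).1⟩

theorem closedBall_subset : closedBall C.o r ⊆ K ∩ L := by
  rw [C.closedBall_eq _ D.val]
  intro z hz
  rw [Set.mem_ofPred_eq, ← C.s_eq] at hz
  exact D.ball_subset hz

theorem o_mem : C.o ∈ K ∩ L := D.ball_subset (by rw [C.s_o]; exact g.ps_nonneg _)

theorem o_mem_interior : C.o ∈ interior (K ∩ L) :=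
  mem_interior.2 ⟨ball C.o r, ball_subset_closedBall.trans D.closedBall_subset, isOpen_ball,
    mem_ball_self D.r_pos⟩

theorem ne : x ≠ y := by
  intro h
  have h1 := D.nx
  rw [h, D.ny] at h1
  have h2 := congrArg (inner ℝ a) h1
  rw [inner_neg_right, inner_smul_right, real_inner_self_eq_norm_sq, D.ha] at h2
  have := D.Sn_pos
  linarith

theorem x_mem_interior : x ∈ interior L :=
  (D.symm_aux D.suppL D.key_two D.small_two D.sx.le).2 D.ne

theorem y_mem_interior : y ∈ interior K :=
  (D.symm_aux D.suppK D.key_one D.small_one D.sy.le).2 D.ne.symm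

theorem frontier_inter : frontier (K ∩ L) ∩ sphere C.o r = {x, y} := by
  rw [C.sphere_eq _ D.val]
  ext z
  simp only [mem_inter_iff, Set.mem_ofPred_eq, mem_insert_iff, mem_singleton_iff, ← C.s_eq]
  constructor
  · rintro ⟨h1, h2⟩
    by_contra! h
    apply h1.2
    rw [interior_inter]
    exact ⟨(D.symm_aux D.suppK D.key_one D.small_one h2.le).2 h.1,
      (D.symm_aux D.suppL D.key_two D.small_two h2.le).2 h.2⟩
  · rintro (rfl | rfl)
    · refine ⟨⟨subset_closure (D.ball_subset D.sx.le), fun h => ?_⟩, D.sx⟩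
      exact (D.suppK.mem_frontier C).2 (interior_mono inter_subset_left h)
    · refine ⟨⟨subset_closure (D.ball_subset D.sy.le), fun h => ?_⟩, D.sy⟩
      exact (D.suppL.mem_frontier C).2 (interior_mono inter_subset_right h)

theorem s_ne_of_mem {z : X} (hz : z ∈ K ∩ L) : C.s z ≠ σ₁ := by
  intro hs
  have h1 := D.out z hz.1 hs.le
  have h2 := D.suppL.nonneg z hz.2
  rw [hs_two, hs] at h2
  rw [D.qd_x, hs_one, hs] at h1
  have h3 := D.small_lens
  have h4 := D.small_out
  have h5 := mul_nonneg (mul_nonneg D.c_pos.le D.Co_pos.le) (g.ps_nonneg r)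
  have h6 := mul_nonneg (sub_pos.2 h4).le h2
  have h7 := mul_le_mul_of_nonneg_left h1 D.Co_pos.le
  nlinarith

theorem s_lt_of_mem (hd : 1 ≤ d) {z : X} (hz : z ∈ K ∩ L) : C.s z < σ₁ := by
  by_contra! h
  have hlt : σ₁ < C.s z := lt_of_le_of_ne h (D.s_ne_of_mem hz).symm
  have hn : C.n z ≠ 0 := by
    intro hn
    have h1 := C.norm_n z
    rw [hn, norm_zero] at h1
    have h2 : g.k * C.s z = 2 := by
      have : C.s z * (2 - g.k * C.s z) = 0 := by linarith
      rcases mul_eq_zero.1 this with h | h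
      · linarith [D.σ_pos]
      · linarith
    have h3 := D.suppL.nonneg z hz.2
    rw [hs_two, hn, inner_zero_right, h2] at h3
    linarith [D.Sn_pos]
  obtain ⟨u, R, hu, hR, -, hRv, -, hSR, hzn, hzs⟩ := C.exists_polar z hn
  obtain ⟨ρ, hρ, hρs⟩ := g.exists_ps D.σ_pos.le D.k_σ
  have hρ0 : 0 < ρ := by
    rcases hρ.1.lt_or_eq with h | h
    · exact h
    · rw [← h, g.ps_zero] at hρs
      linarith [D.σ_pos]
  have hρR : ρ < R := by
    rw [← g.ps_lt hρ hRv, hρs, ← hzs]; exact hlt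
  refine D.s_ne_of_mem (z := C.polar u hu ρ) ⟨?_, ?_⟩ (by rw [C.s_polar, hρs])
  · exact D.convK.polar_mem C hd D.o_mem.1 hu hρ0 hρR hRv hSR hz.1 hzn hzs
  · exact D.convL.polar_mem C hd D.o_mem.2 hu hρ0 hρR hRv hSR hz.2 hzn hzs

theorem eq_of_closedBall (hd : 1 ≤ d) {q : X} (hq : closedBall q r ⊆ K ∩ L) : q = C.o := by
  rw [C.closedBall_eq _ D.val] at hq
  have h1 := C.ball_lower_bound hd D.suppL.isHS D.suppL.zero le_rfl (z := q) D.val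
    (fun w hw => by simpa using D.suppL.nonneg w (hq hw).2)
  have h2 := C.ball_lower_bound hd D.suppK.isHS D.suppK.zero D.c_pos.le (z := q) D.val
    (fun w hw => sub_nonneg.2 (D.out w (hq hw).1 (D.s_lt_of_mem hd (hq hw)).le))
  rw [hs_two] at h1
  rw [hs_one, D.qd_x] at h2
  have h3 := D.small_ball
  have h4 := mul_le_mul_of_nonneg_left h1 (sub_pos.2 D.small_out).le
  have h5 := mul_le_mul_of_nonneg_left h2 D.Co_pos.le
  have h6 := C.s_nonneg q
  have h7 : C.s q * (2 * g.k * g.Sn r * g.Co r - g.k * c * g.Sn r ^ 2 + c * g.Co r ^ 2) ≤ 0 := by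
    nlinarith
  exact (C.eq_o (by nlinarith)).symm

theorem dist_o_x : dist C.o x = r := by
  have h1 : x ∈ sphere C.o r := by
    rw [C.sphere_eq _ D.val, Set.mem_ofPred_eq, ← C.s_eq]; exact D.sx
  rwa [dist_comm]

theorem dist_o_y : dist C.o y = r := by
  have h1 : y ∈ sphere C.o r := by
    rw [C.sphere_eq _ D.val, Set.mem_ofPred_eq, ← C.s_eq]; exact D.sy
  rwa [dist_comm]

theorem le_of_closedBall (hd : 1 ≤ d) {q : X} {s : ℝ} (hq : closedBall q s ⊆ K ∩ L) : s ≤ r := by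
  by_contra! h
  have h1 := D.eq_of_closedBall hd ((closedBall_subset_closedBall h.le).trans hq)
  subst h1
  apply (D.suppL.mem_frontier C).2
  refine mem_interior.2 ⟨ball C.o s, ball_subset_closedBall.trans (hq.trans inter_subset_right),
    isOpen_ball, ?_⟩
  rw [mem_ball, dist_comm, D.dist_o_y]
  exact h

theorem hasUniqueInball (hd : 1 ≤ d) : HasUniqueInball (K ∩ L) C.o r := by
  refine ⟨⟨D.r_pos.le, D.closedBall_subset, fun q s h => D.le_of_closedBall hd h⟩, ?_⟩
  rintro q s ⟨-, h1, h2⟩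
  exact D.eq_of_closedBall hd ((closedBall_subset_closedBall (h2 _ _ D.closedBall_subset)).trans h1)

theorem isMidpoint (hd : 1 ≤ d) : IsMidpoint C.o x y := by
  have h0 := D.Co_pos
  refine ⟨(C.uniqueBtwPt_of_comb hd (α := 1 / (2 * g.Co r)) (β := 1 / (2 * g.Co r)) (by positivity)
    (by positivity) (C.comb_of ?_ ?_)).1, ?_⟩
  · rw [D.nx, D.ny, C.n_o]; simp
  · rw [Chart.t, Chart.t, Chart.t, C.s_o, D.sx, D.sy, ← g.Co_eq]
    field_simp
    ring
  · rw [dist_comm, D.dist_o_x, D.dist_o_y]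

omit D in
theorem n_of_isMidpoint {z w : X} (h : IsMidpoint C.o z w) : C.n w = -C.n z ∧ C.s w = C.s z := by
  have hs : C.s w = C.s z := by
    rw [C.s_eq, C.s_eq, qd, qd, ← h.2, dist_comm]
  refine ⟨?_, hs⟩
  have h1 : dist z w = dist C.o z + dist C.o z := by
    rw [← h.1, ← h.2, dist_comm C.o z]
  have h2 := C.norm_sub z w
  have h3 : g.ps (dist C.o z) = C.s z := (C.s_eq z).symm
  have h4 : qd g z w = 2 * (2 * C.s z - g.k * C.s z ^ 2) := by
    rw [qd, h1, g.ps_add, h3, ← sq, g.Sn_sq, h3]; ring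
  rw [h4, hs] at h2
  have h5 := C.norm_n z
  have h6 := C.norm_n w
  rw [hs] at h6
  have h7 := parallelogram_law_with_norm ℝ (C.n z) (C.n w)
  have h8 : ‖C.n z + C.n w‖ = 0 := by nlinarith
  rw [norm_eq_zero] at h8
  exact (eq_neg_of_add_eq_zero_right h8)

theorem diam_lt (hd : 1 ≤ d) {ε : ℝ} (hε : 0 < ε)
    (h : ∀ z w : X, qd g z w < σ₁ → dist z w < ε / 3) : diam (K ∩ L) < ε := by
  refine lt_of_le_of_lt (diam_le_of_forall_dist_le (C := 2 * (ε / 3)) (by positivity) ?_)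
    (by linarith)
  intro z hz w hw
  have h1 := h C.o z (by rw [← C.s_eq]; exact D.s_lt_of_mem hd hz)
  have h2 := h C.o w (by rw [← C.s_eq]; exact D.s_lt_of_mem hd hw)
  have h3 := dist_triangle_left z w C.o
  linarith

theorem mem_of_centrallySymmetric (hd : 1 ≤ d) (h : CentrallySymmetric (K ∩ L)) {z w : X}
    (hz : z ∈ K ∩ L) (hn : C.n w = -C.n z) (hs : C.s w = C.s z) : w ∈ K ∩ L := by
  obtain ⟨σ, p, -, hp, hσ, hm⟩ := h
  have h1 : closedBall (σ C.o) r ⊆ K ∩ L := by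
    rw [← σ.image_closedBall]
    exact (image_mono D.closedBall_subset).trans hσ.le
  have h2 := D.eq_of_closedBall hd h1
  have h3 := hm _ D.o_mem
  rw [h2] at h3
  have h4 : p = C.o := by
    have h5 : dist C.o p + dist p C.o = dist C.o C.o := h3.1
    rw [dist_self] at h5
    exact dist_eq_zero.1 (le_antisymm (by linarith [dist_nonneg (x := C.o) (y := p)]) dist_nonneg)
  have h6 := hm z hz
  rw [h4] at h6
  obtain ⟨h7, h8⟩ := n_of_isMidpoint h6
  have : w = σ z := C.ext_pt (by rw [hn, h7]) (by rw [hs, h8])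
  rw [this, ← hσ]
  exact mem_image_of_mem σ hz

end Lens
end

section
variable {g : Geo} {d : ℕ} {X : Type*} [MetricSpace X]

theorem Geo.eventually_pos {F : ℝ → ℝ} (hF : Continuous F) (h0 : 0 < F 0) :
    ∀ᶠ r in nhdsWithin (0 : ℝ) (Ioi 0), 0 < F r :=
  nhdsWithin_le_nhds ((hF.tendsto 0).eventually_const_lt h0)

/-- The radii for which the lens construction works. -/
theorem Geo.exists_lens_radius (g : Geo) (c₁ c₂ : ℝ) {c σ η : ℝ} (hc : 0 < c) (hσ : 0 < σ)
    (hη : 0 < η) : ∃ r, 0 < r ∧ r < η ∧ g.Val r ∧ 0 < g.Sn r ∧ 0 < g.Co r ∧ c₁ * g.Sn r < g.Co r ∧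
    c₂ * g.Sn r < g.Co r ∧ c * g.Sn r < g.Co r ∧
    0 < 2 * g.k * g.Sn r * g.Co r - g.k * c * g.Sn r ^ 2 + c * g.Co r ^ 2 ∧
    g.Sn r * (1 - g.k * σ) * (2 * g.Co r - c * g.Sn r) < c * g.Co r ^ 2 * σ ∧ g.ps r < σ := by
  have hC := g.continuous_Co
  have hS := g.continuous_Sn
  have hp := g.continuous_ps
  have e0 := g.eventually_small 0
  have e1 := Geo.eventually_pos (F := fun r => g.Co r - c₁ * g.Sn r) (by fun_prop) (by simp)
  have e2 := Geo.eventually_pos (F := fun r => g.Co r - c₂ * g.Sn r) (by fun_prop) (by simp)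
  have e3 := Geo.eventually_pos (F := fun r => g.Co r - c * g.Sn r) (by fun_prop) (by simp)
  have e4 := Geo.eventually_pos (F := fun r => 2 * g.k * g.Sn r * g.Co r - g.k * c * g.Sn r ^ 2
    + c * g.Co r ^ 2) (by fun_prop) (by simpa using hc)
  have e5 := Geo.eventually_pos (F := fun r => c * g.Co r ^ 2 * σ -
    g.Sn r * (1 - g.k * σ) * (2 * g.Co r - c * g.Sn r)) (by fun_prop) (by simpa using mul_pos hc hσ)
  have e6 := Geo.eventually_pos (F := fun r => σ - g.ps r) (by fun_prop) (by simpa using hσ)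
  have e7 := Geo.eventually_pos (F := fun r => η - r) (by fun_prop) (by simpa using hη)
  obtain ⟨r, ⟨h1, h2, h3, h4, -⟩, h5, h6, h7, h8, h9, h10, h11⟩ := (e0.and (e1.and (e2.and (e3.and
    (e4.and (e5.and (e6.and e7))))))).exists
  exact ⟨r, h1, sub_pos.1 h11, h2, h3, h4, sub_pos.1 h5, sub_pos.1 h6, sub_pos.1 h7, h8, sub_pos.1 h9,
    sub_pos.1 h10⟩

/-- Central symmetry of small intersections transports the boundary germs. -/
theorem Chart.germ_aux (C₀ : Chart g d X) (hd : 2 ≤ d) {K L : Set X} (hK : GConvex K)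
    (hL : GConvex L) {x y : X} {H₁ H₂ : X → ℝ} {c₁ c₂ c : ℝ} (hx : Supp g K x H₁ c₁)
    (hy : Supp g L y H₂ c₂) (hc : 0 < c) (hout : OutC g K x H₁ c) (h2 : T6Cond2 K L) :
    ∃ x' H', IsHS g H' ∧ H' x' = 0 ∧ ∃ ι : X ≃ᵢ X, ι y = x' ∧ (∀ z, H' (ι z) = H₂ z) ∧
      ∃ δ > 0, ∀ φ : X ≃ᵢ X, OrientationPreserving φ → φ x = x' → (∀ z, H' (φ z) = H₁ z) →
        ∀ z, qd g y z < δ → (z ∈ L ↔ ι z ∈ φ '' K) := by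
  obtain ⟨ε, hε, h2⟩ := h2 x (hx.mem_frontier C₀) y (hy.mem_frontier C₀)
  obtain ⟨δ₀, hδ₀, hout⟩ := hout
  obtain ⟨δ₁, hδ₁, hd₁⟩ := C₀.exists_qd_lt (ε := ε / 3) (by positivity)
  obtain ⟨η, hη, hηp⟩ : ∃ η > 0, ∀ t : ℝ, |t| < η → g.ps t < δ₀ := by
    have h1 : ∀ᶠ t in nhds (0 : ℝ), g.ps t < δ₀ :=
      (g.continuous_ps.tendsto 0).eventually_lt_const (by simpa using hδ₀)
    obtain ⟨η, hη, h⟩ := Metric.eventually_nhds_iff.1 h1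
    exact ⟨η, hη, fun t ht => h (by simpa using ht)⟩
  obtain ⟨δ₂, hδ₂, hd₂⟩ := C₀.exists_qd_lt (ε := η / 2) (by positivity)
  obtain ⟨σ, hσ, hσ1, hσ2, hσ3⟩ : ∃ σ > 0, σ ≤ δ₁ ∧ σ < δ₂ ∧ σ ≤ 1 :=
    ⟨min δ₁ (min δ₂ 1) / 2, by positivity,
      by linarith [min_le_left δ₁ (min δ₂ 1), lt_min hδ₁ (lt_min hδ₂ one_pos)],
      by linarith [(min_le_right δ₁ (min δ₂ 1)).trans (min_le_left _ _), lt_min hδ₁ (lt_min hδ₂ one_pos)],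
      by linarith [(min_le_right δ₁ (min δ₂ 1)).trans (min_le_right _ _), lt_min hδ₁ (lt_min hδ₂ one_pos)]⟩
  obtain ⟨r, hr, hrη, hv, hS, hC, s1, s2, s3, s4, s5, s6⟩ :=
    g.exists_lens_radius c₁ c₂ hc hσ (half_pos hη)
  obtain ⟨a, ha, -⟩ := exists_unit_orth_one hd (0 : Vec d)
  have hna : ‖-a‖ = 1 := by rwa [norm_neg]
  have haa : ‖g.Co r • a‖ ^ 2 + g.k * g.Sn r ^ 2 = 1 := by
    rw [norm_smul, ha, mul_one, Real.norm_eq_abs, sq_abs, g.Co_sq_add]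
  have haa' : ‖-(g.Co r • a)‖ ^ 2 + g.k * g.Sn r ^ 2 = 1 := by rwa [norm_neg]
  have hz1 : C₀.hs (g.Co r • a) (g.Sn r) (C₀.polar (-a) hna r) = 0 := by
    rw [Chart.hs, C₀.n_polar, C₀.t_polar, inner_smul_left, inner_smul_right, inner_neg_right,
      real_inner_self_eq_norm_sq, ha, RCLike.conj_to_real]
    ring
  obtain ⟨f, -, hfy, hfH⟩ := C₀.exists_flag_map hd hy.isHS hy.zero (C₀.isHS_hs haa) hz1
  set C := C₀.comp f with hCdef
  have hCn : ∀ z, C.n z = C₀.n (f z) := fun z => rfl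
  have hCs : ∀ z, C.s z = C₀.s (f z) := fun z => rfl
  have hCh : ∀ z, C.hs (g.Co r • a) (g.Sn r) z = H₂ z := fun z => hfH z
  have hH2 : H₂ = C.hs (g.Co r • a) (g.Sn r) := (funext hCh).symm
  have ny : C.n y = -(g.Sn r • a) := by rw [hCn, hfy, C₀.n_polar, smul_neg]
  have sy : C.s y = g.ps r := by rw [hCs, hfy, C₀.s_polar]
  set x' := C.polar a ha r with hx'
  have nx : C.n x' = g.Sn r • a := C.n_polar _ _ _
  have sx : C.s x' = g.ps r := C.s_polar _ _ _
  have hz2 : C.hs (-(g.Co r • a)) (g.Sn r) x' = 0 := by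
    rw [Lens.hs_one, nx, sx, inner_smul_right, real_inner_self_eq_norm_sq, ha, g.Co_eq]
    ring
  set ι : X ≃ᵢ X := C.equiv (C.rot (LinearIsometryEquiv.neg ℝ)) with hι
  have ιn : ∀ z, C.n (ι z) = -C.n z := fun z => C.n_equiv _ z
  have ιs : ∀ z, C.s (ι z) = C.s z := fun z => C.s_equiv _ z
  have ιι : ∀ z, ι (ι z) = z := fun z =>
    C.ext_pt (by rw [ιn, ιn, neg_neg]) (by rw [ιs, ιs])
  have ιy : ι y = x' := C.ext_pt (by rw [ιn, ny, nx, neg_neg]) (by rw [ιs, sy, sx])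
  refine ⟨x', C.hs (-(g.Co r • a)) (g.Sn r), C.isHS_hs haa', hz2, ι, ιy, fun z => ?_, ?_⟩
  · rw [← hCh, Lens.hs_one, Lens.hs_two, ιn, ιs, inner_neg_right]; ring
  have hqxy : qd g x' y = 2 * g.Sn r ^ 2 := by
    rw [C.qd_eq, nx, ny, sx, sy, inner_neg_right, inner_smul_left, inner_smul_right,
      real_inner_self_eq_norm_sq, ha, RCLike.conj_to_real]
    nlinarith [g.Sn_sq r]
  have hop1 : {z | c₁ * qd g x' z < C.hs (-(g.Co r • a)) (g.Sn r) z} ∈ nhds y := by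
    refine (isOpen_lt (continuous_const.mul (continuous_qd _)) (C.continuous_hs _ _)).mem_nhds ?_
    change c₁ * qd g x' y < C.hs (-(g.Co r • a)) (g.Sn r) y
    rw [hqxy, Lens.hs_one, ny, sy, inner_neg_right, inner_smul_right, real_inner_self_eq_norm_sq, ha,
      ← g.Co_eq]
    nlinarith [mul_pos hS (sub_pos.2 s1)]
  have hop2 : {z | c₂ * qd g y z < C.hs (g.Co r • a) (g.Sn r) z} ∈ nhds x' := by
    refine (isOpen_lt (continuous_const.mul (continuous_qd _)) (C.continuous_hs _ _)).mem_nhds ?_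
    change c₂ * qd g y x' < C.hs (g.Co r • a) (g.Sn r) x'
    rw [qd_comm, hqxy, Lens.hs_two, nx, sx, inner_smul_right, real_inner_self_eq_norm_sq, ha,
      ← g.Co_eq]
    nlinarith [mul_pos hS (sub_pos.2 s2)]
  obtain ⟨δ₃, hδ₃, hb₃⟩ := C₀.mem_nhds_iff.1 hop1
  obtain ⟨δ₄, hδ₄, hb₄⟩ := C₀.mem_nhds_iff.1 hop2
  refine ⟨min δ₃ δ₄, lt_min hδ₃ hδ₄, fun φ hφ hφx hφH => ?_⟩
  have hφs : C.hs (-(g.Co r • a)) (g.Sn r) = H₁ ∘ φ.symm := by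
    funext z
    rw [Function.comp_apply, ← hφH, φ.apply_symm_apply]
  have hsK : Supp g (φ '' K) x' (C.hs (-(g.Co r • a)) (g.Sn r)) c₁ := by
    rw [hφs, ← hφx]; exact hx.image φ
  have D : Lens C a r c c₁ c₂ σ (φ '' K) L x' y := by
    refine ⟨ha, hr, hv, hS, hC, nx, sx, ny, sy, hsK, hH2 ▸ hy, ?_, hc, s1, s2, s3, s4, hσ, ?_, s5,
      s6, hK.image φ, hL⟩
    · rintro _ ⟨z, hz, rfl⟩ hzs
      rw [hφH, ← hφx, qd_isom]
      apply hout z hz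
      have h3 : dist C.o (φ z) < η / 2 := hd₂ _ _ (by rw [← C.s_eq]; linarith)
      have h4 : dist C.o x' ≤ r := (C.qd_le_of hv).1 (by rw [← C.s_eq, sx])
      apply hηp
      rw [abs_of_nonneg dist_nonneg, ← φ.dist_eq, hφx]
      linarith [dist_triangle_left x' (φ z) C.o]
    · nlinarith [g.k_le_one]
  have hd1 : 1 ≤ d := by omega
  have hsym : CentrallySymmetric (φ '' K ∩ L) := by
    have := h2 φ (IsometryEquiv.refl X) hφ orientationPreserving_refl
    have hr1 : ⇑(IsometryEquiv.refl X) = id := rfl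
    rw [hr1, image_id, id, hφx] at this
    exact this ⟨_, D.o_mem_interior⟩ (D.diam_lt hd1 hε fun z w h => hd₁ z w (h.trans_le hσ1)) C.o r
      (D.hasUniqueInball hd1) D.frontier_inter D.x_mem_interior D.y_mem_interior (D.isMidpoint hd1)
  intro z hz
  constructor
  · intro hzL
    have h5 : z ∈ φ '' K := hsK.inner z (le_of_lt (hb₃ z (hz.trans_le (min_le_left _ _))))
    exact (D.mem_of_centrallySymmetric hd1 hsym ⟨h5, hzL⟩ (ιn z) (ιs z)).1
  · intro hzK
    have h5 : ι z ∈ L := hy.inner _ (by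
      rw [hH2]
      exact le_of_lt (hb₄ (ι z) (by rw [← ιy, qd_isom]; exact hz.trans_le (min_le_right _ _))))
    exact (D.mem_of_centrallySymmetric hd1 hsym ⟨hzK, h5⟩ (by rw [ιn, neg_neg]) (ιs z).symm).2

theorem Chart.germ (C : Chart g d X) (hd : 2 ≤ d) {K L : Set X} (hK : GConvex K)
    (hL : GConvex L) {x y : X} {H₁ H₂ : X → ℝ} {c₁ c₂ c : ℝ} (hx : Supp g K x H₁ c₁)
    (hy : Supp g L y H₂ c₂) (hc : 0 < c) (hout : OutC g K x H₁ c) (h2 : T6Cond2 K L) :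
    (∃ θ : X ≃ᵢ X, θ y = x ∧ (∀ z, H₁ (θ z) = H₂ z) ∧
      ∃ δ > 0, ∀ z, qd g y z < δ → (z ∈ L ↔ θ z ∈ K)) ∧
    ∃ δ > 0, ∀ ρ : X ≃ᵢ X, OrientationPreserving ρ → ρ y = y → (∀ z, H₂ (ρ z) = H₂ z) →
      ∀ z, qd g y z < δ → (z ∈ L ↔ ρ z ∈ L) := by
  obtain ⟨x', H', hH', h0, ι, ιy, ιH, δ, hδ, h⟩ := C.germ_aux hd hK hL hx hy hc hout h2
  obtain ⟨φ, hφ, hφx, hφH⟩ := C.exists_flag_map hd hx.isHS hx.zero hH' h0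
  refine ⟨⟨ι.trans φ.symm, ?_, fun z => ?_, δ, hδ, fun z hz => ?_⟩, δ, hδ, fun ρ hρ hρy hρH z hz => ?_⟩
  · rw [IsometryEquiv.trans_apply, ιy, ← hφx, φ.symm_apply_apply]
  · rw [IsometryEquiv.trans_apply, ← hφH, φ.apply_symm_apply, ιH]
  · rw [h φ hφ hφx hφH z hz]
    constructor
    · rintro ⟨w, hw, hwz⟩
      rw [IsometryEquiv.trans_apply, ← hwz, φ.symm_apply_apply]; exact hw
    · intro hw
      exact ⟨_, hw, by simp⟩
  · have hρ' := hφ.trans (hρ.conj ι)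
    have hz' : qd g y (ρ z) < δ := by rw [← hρy, qd_isom]; exact hz
    rw [h φ hφ hφx hφH z hz, h _ hρ' ?_ ?_ _ hz']
    · constructor
      · rintro ⟨w, hw, hwz⟩
        exact ⟨w, hw, by simp [hwz]⟩
      · rintro ⟨w, hw, hwz⟩
        have h3 : ι.symm (φ w) = z := by simpa using hwz
        exact ⟨w, hw, by rw [← h3, ι.apply_symm_apply]⟩
    · simp only [IsometryEquiv.trans_apply]
      rw [hφx, ← ιy, ι.symm_apply_apply, hρy]
    · intro w
      simp only [IsometryEquiv.trans_apply]
      rw [ιH, hρH, ← ιH, ι.apply_symm_apply, hφH]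

end

section
variable {g : Geo} {d : ℕ} {X : Type*} [MetricSpace X]

theorem OutC.mem_frontier (C : Chart g d X) {L : Set X} {z : X} {H : X → ℝ} {c : ℝ}
    (h : OutC g L z H c) (hH : IsHS g H) (h0 : H z = 0) (hz : z ∈ L) : z ∈ frontier L := by
  refine ⟨subset_closure hz, fun hi => ?_⟩
  obtain ⟨δ, hδ, hout⟩ := h
  obtain ⟨δ', hδ', h1⟩ := C.mem_interior_iff.1 hi
  obtain ⟨-, w, hw, hw'⟩ := C.both_signs hH h0 c (lt_min hδ hδ')
  have := hout w (h1 w (hw.trans_le (min_le_right _ _))) (hw.trans_le (min_le_left _ _))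
  linarith

theorem InC.mem (C : Chart g d X) {L : Set X} (hL : IsClosed L) {z : X} {H : X → ℝ} {c : ℝ}
    (h : InC g L z H c) (hH : IsHS g H) (h0 : H z = 0) : z ∈ L := by
  obtain ⟨δ, hδ, hin⟩ := h
  by_contra hz
  obtain ⟨δ', hδ', h1⟩ := C.mem_nhds_iff.1 (hL.isOpen_compl.mem_nhds hz)
  obtain ⟨⟨w, hw, hw'⟩, -⟩ := C.both_signs hH h0 c (lt_min hδ hδ')
  exact h1 w (hw.trans_le (min_le_right _ _))
    (hin w (hw.trans_le (min_le_left _ _)) (by linarith))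

namespace Chart
variable (C : Chart g d X)

theorem touch_out {L : Set X} {f₀ Λ : ℝ} {G : Vec d} (hΛ : 0 < Λ)
    (hΛ2 : Λ ^ 2 = ‖G‖ ^ 2 + 2 * f₀ - g.k * f₀ ^ 2) {z₀ : X}
    (h0 : f₀ - C.s z₀ + inner ℝ G (C.n z₀) = 0) {U : Set X} (hU : U ∈ nhds z₀)
    (h : ∀ z ∈ L, z ∈ U → 0 ≤ f₀ - C.s z + inner ℝ G (C.n z)) :
    ∃ H : X → ℝ, IsHS g H ∧ H z₀ = 0 ∧ OutC g L z₀ H ((1 - g.k * f₀) / Λ) := by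
  obtain ⟨H, hH, hz, hr⟩ := C.rebase (f₀ := f₀) (β := 1) (G := G) (Λ := Λ) (z₀ := z₀) hΛ
    (by rw [hΛ2]; ring) (by rw [one_mul]; exact h0)
  obtain ⟨δ, hδ, hb⟩ := C.mem_nhds_iff.1 hU
  refine ⟨H, hH, hz, δ, hδ, fun z hzL hzδ => ?_⟩
  have h1 := h z hzL (hb z hzδ)
  have h2 := hr z
  rw [one_mul] at h2
  rw [h2] at h1
  exact sub_nonneg.1 (nonneg_of_mul_nonneg_right h1 hΛ)

theorem touch_in {L : Set X} {f₀ Λ : ℝ} {G : Vec d} (hΛ : 0 < Λ)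
    (hΛ2 : Λ ^ 2 = ‖G‖ ^ 2 + 2 * f₀ - g.k * f₀ ^ 2) {z₀ : X}
    (h0 : f₀ - C.s z₀ + inner ℝ G (C.n z₀) = 0) {U : Set X} (hU : U ∈ nhds z₀)
    (h : ∀ z ∈ U, 0 < f₀ - C.s z + inner ℝ G (C.n z) → z ∈ L) :
    ∃ H : X → ℝ, IsHS g H ∧ H z₀ = 0 ∧ InC g L z₀ H ((1 - g.k * f₀) / Λ) := by
  obtain ⟨H, hH, hz, hr⟩ := C.rebase (f₀ := f₀) (β := 1) (G := G) (Λ := Λ) (z₀ := z₀) hΛ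
    (by rw [hΛ2]; ring) (by rw [one_mul]; exact h0)
  obtain ⟨δ, hδ, hb⟩ := C.mem_nhds_iff.1 hU
  refine ⟨H, hH, hz, δ, hδ, fun z hzδ hzH => h z (hb z hzδ) ?_⟩
  have h2 := hr z
  rw [one_mul] at h2
  rw [h2]
  exact mul_pos hΛ (sub_pos.2 hzH)

end Chart

/-- A cap of `L` cut off by the half-space `0 ≤ P`, whose base is a ball around `o`. -/
structure Cap (C : Chart g d X) (L : Set X) (b : Vec d) (ρ : ℝ) : Prop where
  hb : ‖b‖ = 1
  closed : IsClosed L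
  convex : GConvex L
  o_mem : C.o ∈ interior L
  ρ_pos : 0 < ρ
  base : ∀ z, inner ℝ b (C.n z) = 0 → (z ∈ L ↔ C.s z ≤ ρ)

namespace Cap
variable {C : Chart g d X} {L : Set X} {b : Vec d} {ρ : ℝ} (D : Cap C L b ρ)
include D

theorem exists_out {B T : ℝ} (hB : ∀ z ∈ L, 0 ≤ inner ℝ b (C.n z) → C.s z ≤ B) (hT : 0 < T)
    {z : X} (hz : z ∈ L) (hzb : 0 ≤ inner ℝ b (C.n z))
    (hzT : ρ < C.s z + T * inner ℝ b (C.n z)) (hQ : ∀ w ∈ L, 0 ≤ inner ℝ b (C.n w) →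
      0 ≤ 2 * (C.s w + T * inner ℝ b (C.n w)) - g.k * (C.s w + T * inner ℝ b (C.n w)) ^ 2) :
    ∃ z₀ ∈ L, 0 ≤ inner ℝ b (C.n z₀) ∧ ρ < C.s z₀ + T * inner ℝ b (C.n z₀) ∧
      ∃ H, IsHS g H ∧ H z₀ = 0 ∧ OutC g L z₀ H ((1 - g.k * (C.s z₀ + T * inner ℝ b (C.n z₀))) /
        √(T ^ 2 + (2 * (C.s z₀ + T * inner ℝ b (C.n z₀)) -
          g.k * (C.s z₀ + T * inner ℝ b (C.n z₀)) ^ 2))) := by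
  have hcn := C.continuous_n
  have hcs := C.continuous_s
  have hcomp : IsCompact (L ∩ {z | 0 ≤ inner ℝ b (C.n z)}) := by
    refine (C.isCompact_qd_le C.o B).of_isClosed_subset
      (D.closed.inter (isClosed_le continuous_const (continuous_const.inner hcn))) ?_
    intro w hw
    have := hB w hw.1 hw.2
    rwa [C.s_eq] at this
  obtain ⟨z₀, ⟨h0, h0b⟩, hmax⟩ := hcomp.exists_isMaxOn ⟨z, hz, hzb⟩
    (f := fun w => C.s w + T * inner ℝ b (C.n w)) (by fun_prop)
  have h0b : 0 ≤ inner ℝ b (C.n z₀) := h0b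
  have h1 : ρ < C.s z₀ + T * inner ℝ b (C.n z₀) := hzT.trans_le (hmax ⟨hz, hzb⟩)
  have hpos : 0 < inner ℝ b (C.n z₀) := by
    refine lt_of_le_of_ne h0b fun h => ?_
    rw [← h, mul_zero, add_zero] at h1
    exact absurd ((D.base z₀ h.symm).1 h0) (not_le.2 h1)
  refine ⟨z₀, h0, h0b, h1, ?_⟩
  have h2 := hQ z₀ h0 h0b
  set f₀ := C.s z₀ + T * inner ℝ b (C.n z₀) with hf
  have h3 : 0 < T ^ 2 + (2 * f₀ - g.k * f₀ ^ 2) := by positivity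
  refine C.touch_out (f₀ := f₀) (G := -(T • b)) (Real.sqrt_pos.2 h3) ?_ ?_
    (U := {z | 0 < inner ℝ b (C.n z)})
    ((isOpen_lt continuous_const (continuous_const.inner hcn)).mem_nhds hpos) ?_
  · rw [Real.sq_sqrt h3.le, norm_neg, norm_smul, D.hb, Real.norm_eq_abs, mul_one, sq_abs]; ring
  · rw [inner_neg_left, inner_smul_left, RCLike.conj_to_real, hf]; ring
  · intro w hw hwU
    have hwU : 0 < inner ℝ b (C.n w) := hwU
    have := hmax ⟨hw, show 0 ≤ inner ℝ b (C.n w) from hwU.le⟩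
    rw [inner_neg_left, inner_smul_left, RCLike.conj_to_real]
    have h4 : C.s w + T * inner ℝ b (C.n w) ≤ f₀ := this
    linarith

theorem exists_in (hd : 1 ≤ d) {T : ℝ} (hT : 0 < T) {z : X} (hz : z ∉ interior L)
    (hzb : 0 ≤ inner ℝ b (C.n z)) (hzT : C.s z + T * inner ℝ b (C.n z) < ρ) (hρ : ρ ≤ 1) :
    ∃ z₀ ∈ L, z₀ ∉ interior L ∧ 0 ≤ inner ℝ b (C.n z₀) ∧ C.s z₀ + T * inner ℝ b (C.n z₀) < ρ ∧
      ∃ H, IsHS g H ∧ H z₀ = 0 ∧ InC g L z₀ H ((1 - g.k * (C.s z₀ + T * inner ℝ b (C.n z₀))) /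
        √(T ^ 2 + (2 * (C.s z₀ + T * inner ℝ b (C.n z₀)) -
          g.k * (C.s z₀ + T * inner ℝ b (C.n z₀)) ^ 2))) := by
  have hcn := C.continuous_n
  have hcs := C.continuous_s
  have hcF : Continuous fun w => C.s w + T * inner ℝ b (C.n w) := by fun_prop
  have hcomp : IsCompact (((interior L)ᶜ ∩ {z | 0 ≤ inner ℝ b (C.n z)}) ∩
      {w | C.s w + T * inner ℝ b (C.n w) ≤ ρ}) := by
    refine (C.isCompact_qd_le C.o ρ).of_isClosed_subset
      ((isOpen_interior.isClosed_compl.inter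
        (isClosed_le continuous_const (continuous_const.inner hcn))).inter
        (isClosed_le hcF continuous_const)) ?_
    intro w hw
    have h1 : C.s w + T * inner ℝ b (C.n w) ≤ ρ := hw.2
    have h2 : 0 ≤ inner ℝ b (C.n w) := hw.1.2
    change qd g C.o w ≤ ρ
    rw [← C.s_eq]
    nlinarith
  obtain ⟨z₀, ⟨⟨h0, h0b⟩, h0ρ⟩, hmin⟩ := hcomp.exists_isMinOn ⟨z, ⟨hz, hzb⟩, hzT.le⟩
    (f := fun w => C.s w + T * inner ℝ b (C.n w)) hcF.continuousOn
  have h0b : 0 ≤ inner ℝ b (C.n z₀) := h0b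
  have h1 : C.s z₀ + T * inner ℝ b (C.n z₀) < ρ :=
    lt_of_le_of_lt (hmin ⟨⟨hz, hzb⟩, hzT.le⟩) hzT
  have hpos : 0 < inner ℝ b (C.n z₀) := by
    refine lt_of_le_of_ne h0b fun h => h0 ?_
    rw [← h, mul_zero, add_zero] at h1
    by_cases hn : C.n z₀ = 0
    · have h2 := C.norm_n z₀
      rw [hn, norm_zero] at h2
      have h3 := C.s_nonneg z₀
      have h4 := g.k_le_one
      have h5 : C.s z₀ = 0 := by nlinarith
      rw [← C.eq_o h5]; exact D.o_mem
    · obtain ⟨u, r, hu, hr, -, hrv, -, hSr, hzn, hzs⟩ := C.exists_polar z₀ hn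
      have hk : g.k * ρ ≤ 2 := by nlinarith [g.k_le_one, D.ρ_pos]
      obtain ⟨R, hR, hRρ⟩ := g.exists_ps D.ρ_pos.le hk
      have hrR : r < R := by rw [← g.ps_lt hrv hR, hRρ, ← hzs]; exact h1
      have hSR : 0 < g.Sn R := by
        have h5 := g.Sn_sq R
        rw [hRρ] at h5
        have h6 := g.Sn_nonneg hR
        refine lt_of_le_of_ne h6 fun h => ?_
        rw [← h] at h5
        nlinarith [g.k_le_one, D.ρ_pos]
      have hub : inner ℝ b u = 0 := by
        have h7 := h
        rw [hzn, inner_smul_right] at h7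
        exact (mul_eq_zero.1 h7.symm).resolve_left hSr.ne'
      have hmem : C.polar u hu R ∈ L := by
        rw [D.base _ (by rw [C.n_polar, inner_smul_right, hub, mul_zero]), C.s_polar, hRρ]
      have hcomb := C.comb_polar (r := R) (r' := r) hu hSR.ne' (C.n_polar u hu R) (C.s_polar u hu R)
      have hpol : C.polar u hu r = z₀ := C.ext_pt (by rw [C.n_polar, hzn]) (by rw [C.s_polar, hzs])
      rw [hpol] at hcomb
      have hS' : 0 < g.Sn (R - r) := g.Sn_pos (by linarith) (fun h => by linarith [hR.2 h])
      exact C.comb_mem_interior hd D.closed D.convex D.o_mem hmem (div_pos hS' hSR)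
        (div_pos hSr hSR) hcomb
  have h2 : 0 ≤ 2 * (C.s z₀ + T * inner ℝ b (C.n z₀)) -
      g.k * (C.s z₀ + T * inner ℝ b (C.n z₀)) ^ 2 := by
    have h3 : 0 ≤ C.s z₀ + T * inner ℝ b (C.n z₀) := by
      have := C.s_nonneg z₀; positivity
    nlinarith [g.k_le_one]
  set f₀ := C.s z₀ + T * inner ℝ b (C.n z₀) with hf
  have h3 : 0 < T ^ 2 + (2 * f₀ - g.k * f₀ ^ 2) := by positivity
  obtain ⟨H, hH, hH0, hin⟩ := C.touch_in (L := L) (f₀ := f₀) (G := -(T • b)) (Real.sqrt_pos.2 h3)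
    (by rw [Real.sq_sqrt h3.le, norm_neg, norm_smul, D.hb, Real.norm_eq_abs, mul_one, sq_abs]; ring)
    (z₀ := z₀) (by rw [inner_neg_left, inner_smul_left, RCLike.conj_to_real, hf]; ring)
    (U := {z | 0 < inner ℝ b (C.n z)})
    ((isOpen_lt continuous_const (continuous_const.inner hcn)).mem_nhds hpos) (fun w hwU hw => by
      by_contra hwL
      rw [inner_neg_left, inner_smul_left, RCLike.conj_to_real] at hw
      have h5 : w ∉ interior L := fun h => hwL (interior_subset h)
      have h6 : C.s w + T * inner ℝ b (C.n w) < f₀ := by linarith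
      have h7 : f₀ ≤ C.s w + T * inner ℝ b (C.n w) :=
        hmin ⟨⟨h5, show 0 ≤ inner ℝ b (C.n w) from le_of_lt (show 0 < inner ℝ b (C.n w) from hwU)⟩, (h6.trans h1).le⟩
      linarith)
  exact ⟨z₀, hin.mem C D.closed hH hH0, h0, h0b, h1, H, hH, hH0, hin⟩

end Cap
end

section
variable {g : Geo} {d : ℕ} {X : Type*} [MetricSpace X]

theorem Geo.Q_nonneg (g : Geo) {f : ℝ} (h0 : 0 ≤ f) (h1 : f ≤ 1) : 0 ≤ 2 * f - g.k * f ^ 2 := by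
  nlinarith [g.k_le_one, mul_nonneg h0 (sub_nonneg.2 h1), sq_nonneg f]

theorem Geo.one_sub_k_mul_pos (g : Geo) {f : ℝ} (h0 : 0 ≤ f) (h1 : f < 1) : 0 < 1 - g.k * f := by
  nlinarith [g.k_le_one, mul_nonneg h0 (sub_nonneg.2 g.k_le_one)]

theorem Geo.lt_curvature (g : Geo) {f T c : ℝ} (h0 : 0 ≤ f) (h1 : f < 1)
    (hT : 0 < T) (h : 0 < 1 - (g.k + c ^ 2) * (2 * f - g.k * f ^ 2) - c ^ 2 * T ^ 2) :
    c < (1 - g.k * f) / √(T ^ 2 + (2 * f - g.k * f ^ 2)) := by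
  have hq := g.Q_nonneg h0 h1.le
  have h2 : 0 < T ^ 2 + (2 * f - g.k * f ^ 2) := by positivity
  have hs := Real.sqrt_pos.2 h2
  rw [lt_div_iff₀ hs]
  refine lt_of_pow_lt_pow_left₀ 2 (g.one_sub_k_mul_pos h0 h1).le ?_
  rw [mul_pow, Real.sq_sqrt h2.le]
  nlinarith

theorem Geo.curvature_lt (g : Geo) {f T c : ℝ} (h0 : 0 ≤ f) (h1 : f < 1) (hc : 0 < c)
    (hT : 0 < T) (h : 1 - (g.k + c ^ 2) * (2 * f - g.k * f ^ 2) - c ^ 2 * T ^ 2 < 0) :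
    (1 - g.k * f) / √(T ^ 2 + (2 * f - g.k * f ^ 2)) < c := by
  have hq := g.Q_nonneg h0 h1.le
  have h2 : 0 < T ^ 2 + (2 * f - g.k * f ^ 2) := by positivity
  have hs := Real.sqrt_pos.2 h2
  rw [div_lt_iff₀ hs]
  refine lt_of_pow_lt_pow_left₀ 2 (by positivity) ?_
  rw [mul_pow, Real.sq_sqrt h2.le]
  nlinarith

theorem Geo.curvature_eq (g : Geo) {f T c : ℝ} (h0 : 0 ≤ f) (h1 : f < 1) (hc : 0 < c)
    (hT : 0 < T) (h : 1 - (g.k + c ^ 2) * (2 * f - g.k * f ^ 2) - c ^ 2 * T ^ 2 = 0) :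
    (1 - g.k * f) / √(T ^ 2 + (2 * f - g.k * f ^ 2)) = c := by
  have hq := g.Q_nonneg h0 h1.le
  have h2 : 0 < T ^ 2 + (2 * f - g.k * f ^ 2) := by positivity
  have hs := Real.sqrt_pos.2 h2
  rw [div_eq_iff hs.ne']
  refine (pow_left_inj₀ (g.one_sub_k_mul_pos h0 h1).le (by positivity) two_ne_zero).1 ?_
  rw [mul_pow, Real.sq_sqrt h2.le]
  nlinarith

theorem Geo.exists_tube (g : Geo) (c T ρ : ℝ) : ∀ U ∈ nhds (1 - (g.k + c ^ 2) *
      (2 * ρ - g.k * ρ ^ 2) - c ^ 2 * T ^ 2), ∃ δ > 0, ∀ T' f, |T' - T| < δ → |f - ρ| < δ →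
      1 - (g.k + c ^ 2) * (2 * f - g.k * f ^ 2) - c ^ 2 * T' ^ 2 ∈ U := by
  intro U hU
  have hc : Continuous fun q : ℝ × ℝ =>
    1 - (g.k + c ^ 2) * (2 * q.2 - g.k * q.2 ^ 2) - c ^ 2 * q.1 ^ 2 := by fun_prop
  obtain ⟨δ, hδ, h⟩ := Metric.mem_nhds_iff.1 ((hc.continuousAt (x := (T, ρ))).preimage_mem_nhds hU)
  refine ⟨δ, hδ, fun T' f h1 h2 => h (a := (T', f)) ?_⟩
  rw [Metric.mem_ball, Prod.dist_eq, Real.dist_eq, Real.dist_eq]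
  exact max_lt h1 h2

namespace Cap
variable {C : Chart g d X} {L : Set X} {b : Vec d} {ρ : ℝ} (D : Cap C L b ρ)
include D

theorem outer {B c M : ℝ} (hc : 0 < c) (hM : 0 ≤ M)
    (hB : ∀ z ∈ L, 0 ≤ inner ℝ b (C.n z) → C.s z ≤ B ∧ inner ℝ b (C.n z) ≤ M)
    (hB1 : B + 1 / (2 * c) * M ≤ 1 / 2) (hρB : ρ ≤ B)
    (hB2 : (1 + c ^ 2) * (3 * (B + 1 / (2 * c) * M)) < 3 / 4)
    (hO : ∀ z ∈ L, ∀ H a, IsHS g H → H z = 0 → OutC g L z H a → a ≤ c) {T₁ : ℝ} (hT₁ : 0 < T₁)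
    (hT₁c : c ^ 2 * T₁ ^ 2 = 1 - (g.k + c ^ 2) * (2 * ρ - g.k * ρ ^ 2)) :
    ∀ z ∈ L, 0 ≤ inner ℝ b (C.n z) → C.s z + T₁ * inner ℝ b (C.n z) ≤ ρ := by
  have hρ := D.ρ_pos
  have hT0 : 0 < 1 / (2 * c) := by positivity
  set A : Set ℝ := {T | ∀ z ∈ L, 0 ≤ inner ℝ b (C.n z) → C.s z + T * inner ℝ b (C.n z) ≤ ρ}
  have hcl : IsClosed A := by
    have : A = ⋂ z ∈ L, ⋂ (_ : 0 ≤ inner ℝ b (C.n z)), {T | C.s z + T * inner ℝ b (C.n z) ≤ ρ} := by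
      ext T; simp [A]
    rw [this]
    exact isClosed_biInter fun z _ => isClosed_iInter fun _ =>
      isClosed_le (by fun_prop) continuous_const
  have hk1 := g.k_le_one
  have hk2 := g.neg_one_le_k
  have hq : ∀ f, 0 ≤ f → f ≤ B + 1 / (2 * c) * M →
      (g.k + c ^ 2) * (2 * f - g.k * f ^ 2) < 3 / 4 := by
    intro f h0 h1
    have h2 := g.Q_nonneg h0 (by linarith)
    have h3 : 2 * f - g.k * f ^ 2 ≤ 3 * f := by nlinarith [sq_nonneg f]
    have h4 : (g.k + c ^ 2) * (2 * f - g.k * f ^ 2) ≤ (1 + c ^ 2) * (2 * f - g.k * f ^ 2) := by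
      gcongr
    have h5 : (1 + c ^ 2) * (2 * f - g.k * f ^ 2) ≤ (1 + c ^ 2) * (3 * (B + 1 / (2 * c) * M)) := by
      gcongr; linarith
    linarith
  have hcc : c ^ 2 * (1 / (2 * c)) ^ 2 = 1 / 4 := by field_simp; norm_num
  have hMp : 0 ≤ 1 / (2 * c) * M := by positivity
  have hbase : 1 / (2 * c) ∈ A := by
    by_contra hn
    simp only [A, Set.mem_ofPred_eq, not_forall, not_le] at hn
    obtain ⟨z, hz, hzb, hzT⟩ := hn
    have hf : ∀ w ∈ L, 0 ≤ inner ℝ b (C.n w) → 0 ≤ C.s w + 1 / (2 * c) * inner ℝ b (C.n w) ∧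
        C.s w + 1 / (2 * c) * inner ℝ b (C.n w) ≤ B + 1 / (2 * c) * M := by
      intro w hw hwb
      obtain ⟨h1, h2⟩ := hB w hw hwb
      have := C.s_nonneg w
      exact ⟨by positivity, by gcongr⟩
    obtain ⟨z₀, h0, h0b, h0ρ, H, hH, hH0, hout⟩ := D.exists_out (fun w hw hwb => (hB w hw hwb).1)
      hT0 hz hzb hzT (fun w hw hwb => g.Q_nonneg (hf w hw hwb).1 (by linarith [(hf w hw hwb).2]))
    have h1 := hO z₀ h0 H _ hH hH0 hout
    obtain ⟨h2, h3⟩ := hf z₀ h0 h0b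
    refine absurd h1 (not_le.2 (g.lt_curvature h2 (by linarith) hT0 ?_))
    have := hq _ h2 h3
    linarith
  have hle : 1 / (2 * c) ≤ T₁ := by
    have := hq ρ hρ.le (by linarith)
    have h1 : c ^ 2 * (1 / (2 * c)) ^ 2 ≤ c ^ 2 * T₁ ^ 2 := by linarith
    exact (sq_le_sq₀ hT0.le hT₁.le).1 (le_of_mul_le_mul_left h1 (by positivity))
  refine (hcl.inter isClosed_Icc).Icc_subset_of_forall_mem_nhdsWithin hbase ?_ ⟨hle, le_rfl⟩
  rintro T ⟨hTA, hT0', hT1⟩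
  have hTpos : 0 < T := hT0.trans_le hT0'
  have hpos : 0 < 1 - (g.k + c ^ 2) * (2 * ρ - g.k * ρ ^ 2) - c ^ 2 * T ^ 2 := by
    rw [← hT₁c]
    have : T ^ 2 < T₁ ^ 2 := by gcongr
    nlinarith [pow_pos hc 2]
  obtain ⟨δ, hδ, hδ2⟩ := g.exists_tube c T ρ (Ioi 0) (Ioi_mem_nhds hpos)
  have hη : 0 < min δ (1 / 4) / (M + 1) := by positivity
  refine mem_of_superset (Ioo_mem_nhdsGT (lt_add_of_pos_right T hη)) fun T' hT' => ?_
  by_contra hn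
  simp only [A, Set.mem_ofPred_eq, not_forall, not_le] at hn
  obtain ⟨z, hz, hzb, hzT⟩ := hn
  have hd : 0 < T' - T := sub_pos.2 hT'.1
  have hd2 : (T' - T) * (M + 1) < min δ (1 / 4) := by
    rw [← lt_div_iff₀ (by positivity)]; linarith [hT'.2]
  have hd3 := hd2.trans_le (min_le_left _ _)
  have hd4 := hd2.trans_le (min_le_right _ _)
  have hT'pos : 0 < T' := by linarith
  have hdM : 0 ≤ (T' - T) * M := mul_nonneg hd.le hM
  rw [mul_add, mul_one] at hd3 hd4
  have hf : ∀ w ∈ L, 0 ≤ inner ℝ b (C.n w) → 0 ≤ C.s w + T' * inner ℝ b (C.n w) ∧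
      C.s w + T' * inner ℝ b (C.n w) ≤ ρ + (T' - T) * M := by
    intro w hw hwb
    obtain ⟨h1, h2⟩ := hB w hw hwb
    have h3 := hTA w hw hwb
    have := C.s_nonneg w
    refine ⟨by positivity, ?_⟩
    have h4 := mul_le_mul_of_nonneg_left h2 hd.le
    linarith
  obtain ⟨z₀, h0, h0b, h0ρ, H, hH, hH0, hout⟩ := D.exists_out (fun w hw hwb => (hB w hw hwb).1)
    hT'pos hz hzb hzT (fun w hw hwb => g.Q_nonneg (hf w hw hwb).1 (by linarith [(hf w hw hwb).2]))
  have h1 := hO z₀ h0 H _ hH hH0 hout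
  obtain ⟨h2, h3⟩ := hf z₀ h0 h0b
  refine absurd h1 (not_le.2 (g.lt_curvature h2 (by linarith) hT'pos (hδ2 _ _ ?_ ?_)))
  · rw [abs_of_pos hd]; linarith
  · rw [abs_of_pos (sub_pos.2 h0ρ)]; linarith

theorem inner (hd : 1 ≤ d) {c M : ℝ} (hc : 0 < c) (hM : 0 ≤ M)
    (hB : ∀ z ∈ L, 0 ≤ inner ℝ b (C.n z) → inner ℝ b (C.n z) ≤ M) (hρ1 : ρ ≤ 1 / 2)
    (hI : ∀ z ∈ L, z ∉ interior L → ∀ H a, IsHS g H → H z = 0 → InC g L z H a → c ≤ a)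
    {T₁ : ℝ} (hT₁ : 0 < T₁)
    (hT₁c : c ^ 2 * T₁ ^ 2 = 1 - (g.k + c ^ 2) * (2 * ρ - g.k * ρ ^ 2)) :
    ∀ z ∉ interior L, 0 ≤ inner ℝ b (C.n z) → ρ ≤ C.s z + T₁ * inner ℝ b (C.n z) := by
  have hρ := D.ρ_pos
  have hk1 := g.k_le_one
  have hk2 := g.neg_one_le_k
  have hc2 : 0 < 2 / c := by positivity
  set A : Set ℝ := {t | ∀ z ∉ interior L, 0 ≤ Inner.inner ℝ b (C.n z) →
    ρ ≤ C.s z + -t * Inner.inner ℝ b (C.n z)} with hA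
  have hcl : IsClosed A := by
    have : A = ⋂ z ∈ (interior L)ᶜ, ⋂ (_ : 0 ≤ Inner.inner ℝ b (C.n z)),
        {t | ρ ≤ C.s z + -t * Inner.inner ℝ b (C.n z)} := by
      ext T; simp [A]
    rw [this]
    exact isClosed_biInter fun z _ => isClosed_iInter fun _ =>
      isClosed_le continuous_const (by fun_prop)
  have hq : ∀ f, 0 ≤ f → f ≤ ρ →
      1 - (g.k + c ^ 2) * (2 * f - g.k * f ^ 2) < 4 := by
    intro f h0 h1
    have h2 := g.Q_nonneg h0 (by linarith)
    have h3 : 2 * f - g.k * f ^ 2 ≤ 3 * f := by nlinarith [sq_nonneg f]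
    nlinarith [mul_nonneg (sq_nonneg c) h2]
  have hcc : c ^ 2 * (2 / c) ^ 2 = 4 := by field_simp; norm_num
  have hbase : -(2 / c) ∈ A := by
    by_contra hn
    simp only [A, Set.mem_ofPred_eq, not_forall, not_le, neg_neg] at hn
    obtain ⟨z, hz, hzb, hzT⟩ := hn
    obtain ⟨z₀, h0L, h0, h0b, h0ρ, H, hH, hH0, hin⟩ := D.exists_in hd hc2 hz hzb hzT (by linarith)
    have h1 := hI z₀ h0L h0 H _ hH hH0 hin
    have h2 : 0 ≤ C.s z₀ + 2 / c * Inner.inner ℝ b (C.n z₀) := by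
      have := C.s_nonneg z₀; positivity
    refine absurd h1 (not_le.2 (g.curvature_lt h2 (by linarith) hc hc2 ?_))
    have := hq _ h2 h0ρ.le
    linarith
  have hle : -(2 / c) ≤ -T₁ := by
    have := hq ρ hρ.le le_rfl
    have h1 : c ^ 2 * T₁ ^ 2 ≤ c ^ 2 * (2 / c) ^ 2 := by linarith
    exact neg_le_neg ((sq_le_sq₀ hT₁.le hc2.le).1 (le_of_mul_le_mul_left h1 (by positivity)))
  have key := (hcl.inter isClosed_Icc).Icc_subset_of_forall_mem_nhdsWithin hbase ?_ ⟨hle, le_rfl⟩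
  · intro z hz hzb
    have := key z hz hzb
    rwa [neg_neg] at this
  rintro t ⟨htA, ht0, ht1⟩
  obtain ⟨T, rfl⟩ : ∃ T, t = -T := ⟨-t, by ring⟩
  have hT1 : T₁ < T := by linarith
  have hneg : 1 - (g.k + c ^ 2) * (2 * ρ - g.k * ρ ^ 2) - c ^ 2 * T ^ 2 < 0 := by
    rw [← hT₁c]
    have : T₁ ^ 2 < T ^ 2 := by gcongr
    nlinarith [pow_pos hc 2]
  obtain ⟨δ, hδ, hδ2⟩ := g.exists_tube c T ρ (Iio 0) (Iio_mem_nhds hneg)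
  have hη : 0 < min δ (T - T₁) / (M + 1) := by
    have := sub_pos.2 hT1; positivity
  refine mem_of_superset (Ioo_mem_nhdsGT (lt_add_of_pos_right (-T) hη)) fun t' ht' => ?_
  obtain ⟨T', rfl⟩ : ∃ T, t' = -T := ⟨-t', by ring⟩
  by_contra hn
  simp only [A, Set.mem_ofPred_eq, not_forall, not_le, neg_neg] at hn
  obtain ⟨z, hz, hzb, hzT⟩ := hn
  have hd0 : 0 < T - T' := by linarith [ht'.1]
  have hd2 : (T - T') * (M + 1) < min δ (T - T₁) := by
    rw [← lt_div_iff₀ (by positivity)]; linarith [ht'.2]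
  have hd3 := hd2.trans_le (min_le_left _ _)
  have hd4 := hd2.trans_le (min_le_right _ _)
  have hdM : 0 ≤ (T - T') * M := mul_nonneg hd0.le hM
  rw [mul_add, mul_one] at hd3 hd4
  have hT'pos : 0 < T' := by linarith
  obtain ⟨z₀, h0L, h0, h0b, h0ρ, H, hH, hH0, hin⟩ := D.exists_in hd hT'pos hz hzb hzT (by linarith)
  have h1 := hI z₀ h0L h0 H _ hH hH0 hin
  have h2 : 0 ≤ C.s z₀ + T' * Inner.inner ℝ b (C.n z₀) := by
    have := C.s_nonneg z₀; positivity
  have h3 := htA z₀ h0 h0b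
  rw [neg_neg] at h3
  have h4 := mul_le_mul_of_nonneg_left (hB z₀ h0L h0b) hd0.le
  refine absurd h1 (not_le.2 (g.curvature_lt h2 (by linarith) hc hT'pos (hδ2 _ _ ?_ ?_)))
  · rw [abs_sub_comm, abs_of_pos hd0]; linarith
  · rw [abs_sub_comm, abs_of_pos (sub_pos.2 h0ρ)]; linarith

theorem osculating (hd : 1 ≤ d) {B c c' M : ℝ} (hc : 0 < c) (hcc' : c ≤ c') (hM : 0 ≤ M)
    (hB : ∀ z ∈ L, 0 ≤ Inner.inner ℝ b (C.n z) → C.s z ≤ B ∧ Inner.inner ℝ b (C.n z) ≤ M)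
    (hB1 : B + 1 / (2 * c) * M ≤ 1 / 2) (hρB : ρ ≤ B)
    (hB2 : (1 + c ^ 2) * (3 * (B + 1 / (2 * c) * M)) < 3 / 4) (hB3 : (1 + c' ^ 2) * (3 * B) < 3 / 4)
    (hO : ∀ z ∈ L, ∀ H a, IsHS g H → H z = 0 → OutC g L z H a → a ≤ c)
    (hI : ∀ z ∈ L, z ∉ interior L → ∀ H a, IsHS g H → H z = 0 → InC g L z H a → c' ≤ a)
    {y : X} (hy : y ∈ L) (hyi : y ∉ interior L) (hyb : 0 < Inner.inner ℝ b (C.n y)) :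
    (∃ H, IsHS g H ∧ H y = 0 ∧ OutC g L y H c) ∧ ∃ H, IsHS g H ∧ H y = 0 ∧ InC g L y H c := by
  have hρ := D.ρ_pos
  have hk1 := g.k_le_one
  have hk2 := g.neg_one_le_k
  have hcM : 0 ≤ 1 / (2 * c) * M := by positivity
  have hρ1 : ρ ≤ 1 / 2 := by linarith
  have hQ0 := g.Q_nonneg hρ.le (by linarith)
  have hQ3 : 2 * ρ - g.k * ρ ^ 2 ≤ 3 * B := by nlinarith [sq_nonneg ρ]
  have hT : ∀ e, 0 < e → (1 + e ^ 2) * (3 * B) < 3 / 4 → ∃ T, 0 < T ∧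
      e ^ 2 * T ^ 2 = 1 - (g.k + e ^ 2) * (2 * ρ - g.k * ρ ^ 2) := by
    intro e he h
    have h1 : 0 < 1 - (g.k + e ^ 2) * (2 * ρ - g.k * ρ ^ 2) := by
      have h4 : (g.k + e ^ 2) * (2 * ρ - g.k * ρ ^ 2) ≤ (1 + e ^ 2) * (2 * ρ - g.k * ρ ^ 2) := by
        gcongr
      have h5 : (1 + e ^ 2) * (2 * ρ - g.k * ρ ^ 2) ≤ (1 + e ^ 2) * (3 * B) := by gcongr
      linarith
    refine ⟨√(1 - (g.k + e ^ 2) * (2 * ρ - g.k * ρ ^ 2)) / e, by positivity, ?_⟩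
    rw [div_pow, Real.sq_sqrt h1.le]
    field_simp
  obtain ⟨T, hT0, hTc⟩ := hT c hc (lt_of_le_of_lt (by gcongr; linarith) hB2)
  have hc' := hc.trans_le hcc'
  obtain ⟨T', hT'0, hT'c⟩ := hT c' hc' hB3
  have hout := D.outer hc hM hB hB1 hρB hB2 hO hT0 hTc
  have hin := D.inner hd hc' hM (fun z hz hzb => (hB z hz hzb).2) hρ1 hI hT'0 hT'c
  have hTT : T' ≤ T := by
    have e1 : c ^ 2 * (T ^ 2 + (2 * ρ - g.k * ρ ^ 2)) = c' ^ 2 * (T' ^ 2 + (2 * ρ - g.k * ρ ^ 2)) := by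
      linarith
    have e2 : c ^ 2 ≤ c' ^ 2 := by gcongr
    have e3 : c ^ 2 * (T' ^ 2 + (2 * ρ - g.k * ρ ^ 2)) ≤ c ^ 2 * (T ^ 2 + (2 * ρ - g.k * ρ ^ 2)) := by
      rw [e1]; gcongr
    have e4 := le_of_mul_le_mul_left e3 (by positivity)
    exact (sq_le_sq₀ hT'0.le hT0.le).1 (by linarith)
  have h1 := hout y hy hyb.le
  have h2 := hin y hyi hyb.le
  have hTe : T' = T := le_antisymm hTT (le_of_mul_le_mul_right (by linarith) hyb)
  subst hTe
  have hcv := g.curvature_eq hρ.le (by linarith) hc hT0 (T := T') (by linarith)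
  have h3 : 0 < T' ^ 2 + (2 * ρ - g.k * ρ ^ 2) := by positivity
  have e1 : √(T' ^ 2 + (2 * ρ - g.k * ρ ^ 2)) ^ 2 = ‖-(T' • b)‖ ^ 2 + 2 * ρ - g.k * ρ ^ 2 := by
    rw [Real.sq_sqrt h3.le, norm_neg, norm_smul, D.hb, Real.norm_eq_abs, mul_one, sq_abs]; ring
  have e2 : ∀ z, ρ - C.s z + Inner.inner ℝ (-(T' • b)) (C.n z) =
      ρ - (C.s z + T' * Inner.inner ℝ b (C.n z)) := by
    intro z
    rw [inner_neg_left, inner_smul_left, RCLike.conj_to_real]; ring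
  have hU : {z | 0 < Inner.inner ℝ b (C.n z)} ∈ nhds y :=
    (isOpen_lt continuous_const (continuous_const.inner C.continuous_n)).mem_nhds hyb
  constructor
  · have := C.touch_out (f₀ := ρ) (L := L) (Real.sqrt_pos.2 h3) e1 (z₀ := y)
      (by rw [e2]; linarith) hU (fun z hz hzU => by
        have := hout z hz (le_of_lt hzU)
        rw [e2]; linarith)
    rwa [hcv] at this
  · have := C.touch_in (f₀ := ρ) (L := L) (Real.sqrt_pos.2 h3) e1 (z₀ := y)
      (by rw [e2]; linarith) hU (fun z hzU hz => by
        by_contra hzL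
        have := hin z (fun h => hzL (interior_subset h)) (le_of_lt hzU)
        rw [e2] at hz; linarith)
    rwa [hcv] at this

end Cap
end

section
variable {g : Geo} {d : ℕ} {X : Type*} [MetricSpace X]

namespace Chart
variable (C : Chart g d X)

theorem _root_.BallChar.exists_lt_qd (g : Geo) {X : Type*} [MetricSpace X] {ε : ℝ} (hε : 0 < ε) : ∃ δ > 0, ∀ z w : X, dist z w < δ → qd g z w < ε := by
  have h := g.continuous_ps.continuousAt (x := 0)
  obtain ⟨δ, hδ, h1⟩ := Metric.continuousAt_iff.1 h ε hε
  refine ⟨δ, hδ, fun z w hzw => ?_⟩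
  have := h1 (x := dist z w) (by simpa [Real.dist_eq] using hzw)
  rw [g.ps_zero, Real.dist_eq, sub_zero] at this
  exact (le_abs_self _).trans_lt this

include C in
/-- A small cap of a convex set cut off near a point with an outer bound of positive curvature. -/
theorem exists_cut (hd : 1 ≤ d) {L : Set X} {y : X} {H : X → ℝ} {c cs : ℝ} (hL : GConvex L)
    (hsp : Supp g L y H cs) (hout : OutC g L y H c) (hc : 0 < c) {ε : ℝ} (hε : 0 < ε) :
    ∃ P o, IsHS g P ∧ o ∈ interior L ∧ P o = 0 ∧ 0 < P y ∧ (∀ z ∈ L, 0 ≤ P z → dist y z < ε) ∧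
      ∀ z z', P z = 0 → P z' = 0 → qd g o z = qd g o z' → qd g y z = qd g y z' ∧ H z = H z' := by
  obtain ⟨C, hCy⟩ := C.exists_at y
  obtain rfl := C.eq_o hCy
  obtain ⟨a, ha, hHa⟩ := C.isHS_zero hCy hsp.isHS hsp.zero
  obtain ⟨δ₀, hδ₀, hout⟩ := hout
  obtain ⟨δ₁, hδ₁, hqd⟩ := C.exists_qd_lt hε
  obtain ⟨r₁, hr₁, hv₁, hS₁, hC₁, -, hr₁δ⟩ : ∃ r, 0 < r ∧ g.Val r ∧ 0 < g.Sn r ∧ 0 < g.Co r ∧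
      0 * g.ps r < g.Sn r ∧ g.ps r < min δ₀ δ₁ := by
    have h1 : ∀ᶠ r in nhdsWithin (0:ℝ) (Ioi 0), 0 < min δ₀ δ₁ - g.ps r :=
      Geo.eventually_pos (by have := g.continuous_ps; fun_prop) (by simp [hδ₀, hδ₁])
    obtain ⟨r, ⟨h1, h2, h3, h4, h5⟩, h6⟩ := ((g.eventually_small 0).and h1).exists
    exact ⟨r, h1, h2, h3, h4, h5, by linarith⟩
  have hσ := g.ps_pos hv₁ hr₁
  set σ := g.ps r₁ with hσdef
  have hσ2 : g.k * σ ≤ 2 := g.k_ps_le r₁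
  obtain ⟨η, ⟨hη, hvη, hSη, hCη, hcη⟩, hη2⟩ : ∃ r, (0 < r ∧ g.Val r ∧ 0 < g.Sn r ∧ 0 < g.Co r ∧
      cs * g.ps r < g.Sn r) ∧ 0 < g.Co r * (c * σ) - g.Sn r * (1 - g.k * σ) := by
    have h1 : ∀ᶠ r in nhdsWithin (0:ℝ) (Ioi 0), 0 < g.Co r * (c * σ) - g.Sn r * (1 - g.k * σ) :=
      Geo.eventually_pos (by have := g.continuous_Co; have := g.continuous_Sn; fun_prop)
        (by simp; positivity)
    exact ((g.eventually_small cs).and h1).exists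
  have hP : ‖-(g.Co η • a)‖ ^ 2 + g.k * g.Sn η ^ 2 = 1 := by
    rw [norm_neg, norm_smul, ha, mul_one, Real.norm_eq_abs, sq_abs]; exact g.Co_sq_add η
  have hPe : ∀ z, C.hs (-(g.Co η • a)) (g.Sn η) z = g.Sn η * C.t z - g.Co η * H z := by
    intro z
    rw [hs, inner_neg_left, inner_smul_left, RCLike.conj_to_real, hHa]; ring
  have hPo : C.hs (-(g.Co η • a)) (g.Sn η) C.o = g.Sn η := by
    rw [hPe, hsp.zero, C.t_o]; ring
  have hHo : H (C.polar a ha η) = g.Sn η := by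
    rw [hHa, C.n_polar, inner_smul_right, real_inner_self_eq_norm_sq, ha]; ring
  have hL0 : C.o ∈ L := hsp.mem
  refine ⟨_, C.polar a ha η, C.isHS_hs hP, ?_, ?_, by rw [hPo]; exact hSη, ?_, ?_⟩
  · refine mem_interior.2 ⟨{z | cs * qd g C.o z < H z}, fun z hz => hsp.inner z (le_of_lt hz),
      isOpen_lt (continuous_const.mul (continuous_qd C.o)) (hsp.isHS.continuous C), ?_⟩
    change cs * qd g C.o _ < H _
    rw [← C.s_eq, C.s_polar, hHo]; exact hcη
  · rw [hPe, hHo, C.t_polar]; ring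
  · intro z hz hPz
    apply hqd
    rw [← C.s_eq]
    refine lt_of_lt_of_le ?_ (hr₁δ.le.trans (min_le_right _ _))
    by_contra! h
    have key : ∀ w ∈ L, C.s w = σ → C.hs (-(g.Co η • a)) (g.Sn η) w < 0 := by
      intro w hw hws
      have h1 := hout w hw (by rw [← C.s_eq, hws]; exact hr₁δ.trans_le (min_le_left _ _))
      rw [← C.s_eq, hws] at h1
      have h2 := mul_le_mul_of_nonneg_left h1 hCη.le
      rw [hPe, C.t_def, hws]
      linarith
    rcases h.eq_or_lt with h | h
    · exact absurd hPz (not_le.2 (key z hz h.symm))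
    by_cases hn : C.n z = 0
    · have h1 := C.norm_n z
      rw [hn, norm_zero] at h1
      have h2 : g.k * C.s z = 2 := by
        have : C.s z * (2 - g.k * C.s z) = 0 := by linarith
        rcases mul_eq_zero.1 this with h | h
        · linarith
        · linarith
      rw [hPe, C.t_def, h2, hHa, hn, inner_zero_right] at hPz
      linarith
    obtain ⟨u, R, hu, hR, -, hRv, -, hSR, hzn, hzs⟩ := C.exists_polar z hn
    have hρR : r₁ < R := by
      rw [← g.ps_lt hv₁ hRv, ← hzs]; exact h
    have h1 := key _ (hL.polar_mem C hd hL0 hu hr₁ hρR hRv hSR hz hzn hzs) (C.s_polar _ _ _)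
    have h2 := C.comb_polar (r' := r₁) hu hSR.ne' hzn hzs _ (C.isHS_hs hP)
    rw [hPo] at h2
    have h3 : 0 < g.Sn (R - r₁) := g.Sn_pos (by linarith) (fun h => by linarith [hRv.2 h])
    have h4 : 0 ≤ g.Sn (R - r₁) / g.Sn R * g.Sn η := by positivity
    have h5 := mul_nonneg (div_nonneg hS₁.le hSR.le) hPz
    linarith
  · intro z z' hz hz' hq
    have h1 : ∀ w, C.hs (-(g.Co η • a)) (g.Sn η) w = 0 →
        g.Co η * H w = g.Sn η * (1 - g.k * qd g C.o w) ∧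
        g.Co η * qd g (C.polar a ha η) w = g.Co η * g.ps η + (qd g C.o w - g.Sn η ^ 2) := by
      intro w hw
      rw [hPe, C.t_def, C.s_eq] at hw
      have h2 := C.qd_eq (C.polar a ha η) w
      rw [C.s_polar, C.n_polar, inner_smul_left, RCLike.conj_to_real, ← hHa, C.s_eq w] at h2
      have h3 := g.Co_sq_add η
      have h4 := g.Co_eq η
      have h5 : g.Co η * H w = g.Sn η * (1 - g.k * qd g C.o w) := by linarith
      refine ⟨h5, ?_⟩
      rw [h2]
      linear_combination (-g.Sn η) * h5 + qd g C.o w * h3 - g.Co η * qd g C.o w * h4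
    obtain ⟨h2, h3⟩ := h1 z hz
    obtain ⟨h2', h3'⟩ := h1 z' hz'
    have h4 : qd g C.o z = qd g C.o z' := by rw [hq] at h3; linarith
    refine ⟨h4, mul_left_cancel₀ hCη.ne' ?_⟩
    rw [h2, h2', h4]

end Chart
end

section
variable {g : Geo} {d : ℕ} {X : Type*} [MetricSpace X]

theorem eq_or_eq_neg_of_orth {b u v : Vec 2} (hb : ‖b‖ = 1) (hu : ‖u‖ = 1) (hv : ‖v‖ = 1)
    (hbu : inner ℝ b u = 0) (hbv : inner ℝ b v = 0) : v = u ∨ v = -u := by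
  have nrm : ∀ w : Vec 2, ‖w‖ = 1 → w 0 ^ 2 + w 1 ^ 2 = 1 := by
    intro w hw
    have := EuclideanSpace.real_norm_sq_eq w
    rw [hw, Fin.sum_univ_two] at this
    linarith
  have inn : ∀ w w' : Vec 2, inner ℝ w w' = w 0 * w' 0 + w 1 * w' 1 := by
    intro w w'
    rw [PiLp.inner_apply, Fin.sum_univ_two]
    simp [mul_comm]
  have par : ∀ w : Vec 2, ‖w‖ = 1 → inner ℝ b w = 0 → ∃ l : ℝ, l ^ 2 = 1 ∧ w 0 = -(l * b 1) ∧
      w 1 = l * b 0 := by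
    intro w hw h
    have hb1 := nrm b hb
    have hw1 := nrm w hw
    rw [inn] at h
    refine ⟨b 0 * w 1 - b 1 * w 0, ?_, ?_, ?_⟩
    · linear_combination (w 0 ^ 2 + w 1 ^ 2) * hb1 + hw1 - (b 0 * w 0 + b 1 * w 1) * h
    · linear_combination (-w 0) * hb1 + b 0 * h
    · linear_combination (-w 1) * hb1 + b 1 * h
  obtain ⟨l, hl, h0, h1⟩ := par u hu hbu
  obtain ⟨m, hm, h0', h1'⟩ := par v hv hbv
  have : m = l ∨ m = -l := sq_eq_sq_iff_eq_or_eq_neg.1 (by rw [hl, hm])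
  rcases this with rfl | rfl
  · left
    ext i; fin_cases i <;> simp [h0, h1, h0', h1']
  · right
    ext i; fin_cases i <;> simp [h0, h1, h0', h1']

namespace Chart
variable (C : Chart g d X)

theorem polar_zero {u : Vec d} (hu : ‖u‖ = 1) : C.polar u hu 0 = C.o :=
  C.ext_pt (by simp) (by simp)

theorem exists_eq_polar {z : X} {r : ℝ} (hs : C.s z = g.ps r) (hr : 0 < g.Sn r) :
    ∃ u, ∃ hu : ‖u‖ = 1, z = C.polar u hu r := by
  refine ⟨(g.Sn r)⁻¹ • C.n z, ?_, ?_⟩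
  · have h1 : ‖C.n z‖ = g.Sn r := by
      refine (pow_left_inj₀ (norm_nonneg _) hr.le two_ne_zero).1 ?_
      rw [C.norm_n, g.Sn_sq, hs]
    rw [norm_smul, h1, norm_inv, Real.norm_eq_abs, abs_of_pos hr, inv_mul_cancel₀ hr.ne']
  · refine C.ext_pt ?_ ?_
    · rw [C.n_polar, smul_smul, mul_inv_cancel₀ hr.ne', one_smul]
    · rw [C.s_polar, hs]

theorem qd_polar_neg {u : Vec d} (hu : ‖u‖ = 1) (hu' : ‖-u‖ = 1) (r r' : ℝ) :
    qd g (C.polar u hu r) (C.polar (-u) hu' r') = g.ps (r + r') := by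
  rw [C.qd_eq, C.s_polar, C.s_polar, C.n_polar, C.n_polar, g.ps_add, inner_smul_left,
    inner_smul_right, inner_neg_right, real_inner_self_eq_norm_sq, hu, RCLike.conj_to_real]
  ring

theorem qd_polar_polar {u : Vec d} (hu : ‖u‖ = 1) (r r' : ℝ) :
    qd g (C.polar u hu r) (C.polar u hu r') = g.ps (r - r') := by
  rw [C.qd_eq, C.s_polar, C.s_polar, C.n_polar, C.n_polar, g.ps_sub, inner_smul_left,
    inner_smul_right, real_inner_self_eq_norm_sq, hu, RCLike.conj_to_real]
  ring

theorem comb_polar_neg {u : Vec d} (hu : ‖u‖ = 1) (hu' : ‖-u‖ = 1) {r r' : ℝ}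
    (h : g.Sn (r + r') ≠ 0) : Comb g (g.Sn r' / g.Sn (r + r')) (g.Sn r / g.Sn (r + r'))
      (C.polar u hu r) (C.polar (-u) hu' r') C.o := by
  apply C.comb_of
  · rw [C.n_o, C.n_polar, C.n_polar, smul_neg, smul_neg, smul_smul, smul_smul, ← sub_eq_add_neg,
      ← sub_smul]
    rw [show g.Sn r' / g.Sn (r + r') * g.Sn r - g.Sn r / g.Sn (r + r') * g.Sn r' = 0 by ring,
      zero_smul]
  · rw [C.t_o, C.t_polar, C.t_polar]
    field_simp
    rw [g.Sn_add]; ring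

theorem polar_mem_of_le {K : Set X} (hd : 1 ≤ d) (hK : GConvex K) (ho : C.o ∈ K) {u : Vec d}
    (hu : ‖u‖ = 1) {r R : ℝ} (hr : 0 < r) (hrR : r ≤ R) (hR : g.Val R) (hS : 0 < g.Sn R)
    (h : C.polar u hu R ∈ K) : C.polar u hu r ∈ K := by
  rcases hrR.eq_or_lt with rfl | hlt
  · exact h
  · exact hK.polar_mem C hd ho hu hr hlt hR hS h (C.n_polar _ _ _) (C.s_polar _ _ _)

theorem exists_polar_mem {K : Set X} (ho : C.o ∈ interior K) {u : Vec d} (hu : ‖u‖ = 1) :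
    ∃ r, 0 < r ∧ g.Val r ∧ 0 < g.Sn r ∧ C.polar u hu r ∈ K := by
  obtain ⟨δ, hδ, h⟩ := C.mem_interior_iff.1 ho
  have h1 : ∀ᶠ r in nhdsWithin (0:ℝ) (Ioi 0), 0 < δ - g.ps r :=
    Geo.eventually_pos (by have := g.continuous_ps; fun_prop) (by simp [hδ])
  obtain ⟨r, ⟨h2, h3, h4, -, -⟩, h6⟩ := ((g.eventually_small 0).and h1).exists
  exact ⟨r, h2, h3, h4, h _ (by rw [← C.s_eq, C.s_polar]; linarith)⟩

/-- A cap whose base is invariant under rotations around `C.o`. -/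
theorem exists_cap_of_round (hd : 2 ≤ d) {L : Set X} (hLc : IsClosed L) (hL : GConvex L)
    (ho : C.o ∈ interior L) {b : Vec d} (hb : ‖b‖ = 1) {B : ℝ}
    (hB : ∀ z ∈ L, inner ℝ b (C.n z) = 0 → C.s z ≤ B) (hkB : g.k * B < 2)
    (hround : ∀ z ∈ L, inner ℝ b (C.n z) = 0 → ∀ z', inner ℝ b (C.n z') = 0 →
      C.s z = C.s z' → z' ∈ L) :
    ∃ ρ, Cap C L b ρ ∧ ∃ z ∈ L, inner ℝ b (C.n z) = 0 ∧ C.s z = ρ := by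
  obtain ⟨u, hu, hub⟩ := exists_unit_orth_one hd b
  rw [real_inner_comm] at hub
  have hoL := interior_subset ho
  have hcn := C.continuous_n
  have hcomp : IsCompact (L ∩ {z | inner ℝ b (C.n z) = 0}) := by
    refine (C.isCompact_qd_le C.o B).of_isClosed_subset
      (hLc.inter (isClosed_eq (continuous_const.inner hcn) continuous_const)) ?_
    intro w hw
    have := hB w hw.1 hw.2
    rwa [C.s_eq] at this
  obtain ⟨z₀, ⟨h0, h0b⟩, hmax⟩ := hcomp.exists_isMaxOn
    ⟨C.o, hoL, show inner ℝ b (C.n C.o) = 0 by simp⟩ C.continuous_s.continuousOn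
  have h0b : inner ℝ b (C.n z₀) = 0 := h0b
  obtain ⟨r, hr, hrv, hSr, hrL⟩ := C.exists_polar_mem ho hu
  have hρ : 0 < C.s z₀ := by
    have h1 : C.s (C.polar u hu r) ≤ C.s z₀ := hmax ⟨hrL, show inner ℝ b (C.n _) = 0 by
      rw [C.n_polar, inner_smul_right, hub, mul_zero]⟩
    rw [C.s_polar] at h1
    linarith [g.ps_pos hrv hr]
  have hsB := hB z₀ h0 h0b
  have nz : ∀ z, 0 < C.s z → C.s z ≤ C.s z₀ → C.n z ≠ 0 := by
    intro z h1 h2 hn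
    have h3 := C.norm_n z
    rw [hn, norm_zero] at h3
    have h4 : g.k * C.s z < 2 := by
      rcases le_total 0 g.k with h | h
      · nlinarith
      · nlinarith
    nlinarith
  refine ⟨C.s z₀, ⟨hb, hLc, hL, ho, hρ, fun z hz => ⟨fun hzL => hmax ⟨hzL, hz⟩, fun hzs => ?_⟩⟩,
    z₀, h0, h0b, rfl⟩
  rcases (C.s_nonneg z).eq_or_lt with h | h
  · rwa [← C.eq_o h.symm]
  obtain ⟨u', r', hu', hr', -, hrv', -, hSr', hzn, hzs'⟩ := C.exists_polar z (nz z h hzs)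
  obtain ⟨v, R, hv, hR, -, hRv, -, hSR, hn0, hs0⟩ := C.exists_polar z₀ (nz z₀ hρ le_rfl)
  have hvb : inner ℝ b v = 0 := by
    rw [hn0, inner_smul_right] at h0b
    exact (mul_eq_zero.1 h0b).resolve_left hSR.ne'
  have hz0 : C.polar v hv R = z₀ := C.ext_pt (by simp [hn0]) (by simp [hs0])
  refine hround _ (C.polar_mem_of_le (by omega) hL hoL hv hr' ?_ hRv hSR (by rwa [hz0])) ?_ z hz ?_
  · rwa [← g.ps_le hrv' hRv, ← hs0, ← hzs']
  · rw [C.n_polar, inner_smul_right, hvb, mul_zero]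
  · rw [C.s_polar, hzs']

end Chart

theorem Chart.exists_cap_two (C : Chart g 2 X) {L : Set X} (hLc : IsClosed L) (hL : GConvex L)
    {P : X → ℝ} (hP : IsHS g P) {y o : X} (ho : o ∈ interior L) (hPo : P o = 0)
    (hsmall : ∀ z ∈ L, P z = 0 → dist y z < 1 / 2) :
    ∃ (C' : Chart g 2 X) (b : Vec 2) (ρ : ℝ), (∀ z, P z = inner ℝ b (C'.n z)) ∧ Cap C' L b ρ ∧
      ∃ z ∈ L, P z = 0 ∧ C'.s z = ρ := by
  have hd2 : ∀ z ∈ L, P z = 0 → ∀ w ∈ L, P w = 0 → dist z w < 1 := by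
    intro z hz hPz w hw hPw
    have h1 := dist_triangle_left z w y
    have h2 := hsmall z hz hPz
    have h3 := hsmall w hw hPw
    linarith
  have hoL := interior_subset ho
  have hcomp : IsCompact (L ∩ {z | P z = 0}) := by
    refine (C.isCompact_qd_le y (g.ps (1 / 2))).of_isClosed_subset
      (hLc.inter (isClosed_eq (hP.continuous C) continuous_const)) ?_
    intro w hw
    have hv : g.Val (1 / 2) := ⟨by norm_num, fun _ => by linarith [Real.pi_gt_three]⟩
    exact (C.qd_le_of hv).2 (hsmall w hw.1 hw.2).le
  obtain ⟨⟨z₁, z₂⟩, ⟨⟨hz₁, hPz₁⟩, hz₂, hPz₂⟩, hmax⟩ := (hcomp.prod hcomp).exists_isMaxOn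
    ⟨(o, o), ⟨hoL, hPo⟩, hoL, hPo⟩ (f := fun q => dist q.1 q.2) continuous_dist.continuousOn
  replace hPz₁ : P z₁ = 0 := hPz₁
  replace hPz₂ : P z₂ = 0 := hPz₂
  replace hz₁ : z₁ ∈ L := hz₁
  replace hz₂ : z₂ ∈ L := hz₂
  replace hmax : ∀ z ∈ L, P z = 0 → ∀ w ∈ L, P w = 0 → dist z w ≤ dist z₁ z₂ :=
    fun z hz hPz w hw hPw => hmax (a := (z, w)) ⟨⟨hz, hPz⟩, hw, hPw⟩
  have hlt := hd2 z₁ hz₁ hPz₁ z₂ hz₂ hPz₂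
  have Sp : ∀ r, 0 < r → r < 3 → 0 < g.Sn r := fun r h h' =>
    g.Sn_pos h (fun _ => by linarith [Real.pi_gt_three])
  have Vp : ∀ r, 0 ≤ r → r < 3 → g.Val r := fun r h h' => ⟨h, fun _ => by linarith [Real.pi_gt_three]⟩
  have hpos : 0 < dist z₁ z₂ := by
    obtain ⟨C₀, hC₀⟩ := C.exists_at o
    obtain rfl := C₀.eq_o hC₀
    obtain ⟨b, hb, hPb⟩ := C₀.isHS_zero hC₀ hP hPo
    obtain ⟨u, hu, hub⟩ := exists_unit_orth_one le_rfl b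
    rw [real_inner_comm] at hub
    obtain ⟨r, hr, hrv, hSr, hrL⟩ := C₀.exists_polar_mem ho hu
    refine lt_of_lt_of_le ?_ (hmax C₀.o hoL hPo _ hrL
      (by rw [hPb, C₀.n_polar, inner_smul_right, hub, mul_zero]))
    rw [dist_pos]
    intro h
    have h1 := C₀.s_polar u hu r
    rw [← h, C₀.s_o] at h1
    linarith [g.ps_pos hrv hr]
  obtain ⟨R, hR⟩ : ∃ R, dist z₁ z₂ = R + R := ⟨dist z₁ z₂ / 2, by ring⟩
  have hR0 : 0 < R := by linarith
  have hR1 : R < 1 / 2 := by linarith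
  obtain ⟨m, hm1, hm2, hPm⟩ : ∃ m, qd g m z₁ = g.ps R ∧ qd g m z₂ = g.ps R ∧ P m = 0 := by
    obtain ⟨C₁, hC₁⟩ := C.exists_at z₁
    obtain rfl := C₁.eq_o hC₁
    obtain ⟨b, hb, hPb⟩ := C₁.isHS_zero hC₁ hP hPz₁
    have hS := Sp (R + R) (by linarith) (by linarith)
    obtain ⟨u, hu, rfl⟩ := C₁.exists_eq_polar (z := z₂) (r := R + R)
      (by rw [C₁.s_eq, qd, hR]) hS
    refine ⟨C₁.polar u hu R, ?_, ?_, ?_⟩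
    · rw [qd_comm, ← C₁.s_eq, C₁.s_polar]
    · rw [qd_comm, C₁.qd_polar_polar, add_sub_cancel_right]
    · rw [hPb, C₁.n_polar, inner_smul_right, mul_eq_zero] at hPz₂ ⊢
      exact Or.inr (hPz₂.resolve_left hS.ne')
  obtain ⟨C', hC'⟩ := C.exists_at m
  obtain rfl := C'.eq_o hC'
  obtain ⟨b, hb, hPb⟩ := C'.isHS_zero hC' hP hPm
  rw [← C'.s_eq] at hm1 hm2
  have hSR := Sp R hR0 (by linarith)
  have hVR := Vp R hR0.le (by linarith)
  obtain ⟨v, hv, rfl⟩ := C'.exists_eq_polar hm1 hSR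
  obtain ⟨v', hv', rfl⟩ := C'.exists_eq_polar hm2 hSR
  have orth : ∀ u (hu : ‖u‖ = 1) r, 0 < g.Sn r → (P (C'.polar u hu r) = 0 ↔ inner ℝ b u = 0) := by
    intro u hu r hr
    rw [hPb, C'.n_polar, inner_smul_right, mul_eq_zero, or_iff_right hr.ne']
  have hbv := (orth v hv R hSR).1 hPz₁
  have hbv' := (orth v' hv' R hSR).1 hPz₂
  obtain rfl : v' = -v := by
    rcases eq_or_eq_neg_of_orth hb hv hv' hbv hbv' with rfl | h
    · simp at hpos
    · exact h
  have hmem : ∀ u (hu : ‖u‖ = 1), inner ℝ b u = 0 → C'.polar u hu R ∈ L := by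
    intro u hu hbu
    rcases eq_or_eq_neg_of_orth hb hv hu hbv hbu with rfl | rfl
    · exact hz₁
    · exact hz₂
  have neg : ∀ u : Vec 2, ‖u‖ = 1 → inner ℝ b u = 0 → ∃ _ : ‖-u‖ = 1, inner ℝ b (-u) = 0 :=
    fun u hu hbu => ⟨by rwa [norm_neg], by rw [inner_neg_right, hbu, neg_zero]⟩
  have hmL : C'.o ∈ L := by
    have h2 := Sp (R + R) (by linarith) (by linarith)
    exact hL.comb_mem C' (by norm_num) (div_pos hSR h2) (div_pos hSR h2)
      (C'.comb_polar_neg hv hv' h2.ne') hz₁ hz₂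
  have hin : ∀ z ∈ L, P z = 0 → z ≠ C'.o → ∃ u, ∃ hu : ‖u‖ = 1, ∃ r, 0 < r ∧ r ≤ R ∧
      inner ℝ b u = 0 ∧ z = C'.polar u hu r := by
    intro z hz hPz hne
    have h1 := hd2 _ hmL hPm z hz hPz
    have h2 : 0 < dist C'.o z := dist_pos.2 hne.symm
    have hS := Sp _ h2 (by linarith)
    obtain ⟨u, hu, hzu⟩ := C'.exists_eq_polar (C'.s_eq z) hS
    have hbu : inner ℝ b u = 0 := (orth u hu _ hS).1 (by rwa [← hzu])
    refine ⟨u, hu, _, h2, ?_, hbu, hzu⟩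
    obtain ⟨hu', hbu'⟩ := neg u hu hbu
    have h3 := hmax z hz hPz _ (hmem _ hu' hbu') ((orth _ hu' R hSR).2 hbu')
    have h4 := C'.qd_polar_neg hu hu' (dist C'.o z) R
    rw [← hzu] at h4
    have h5 := g.ps_inj (C'.val _ _) (Vp (dist C'.o z + R) (by linarith) (by linarith)) h4
    linarith
  have hmi : C'.o ∈ interior L := by
    by_cases hne : o = C'.o
    · rwa [hne] at ho
    obtain ⟨u, hu, r, hr, hrR, hbu, rfl⟩ := hin o hoL hPo hne
    obtain ⟨hu', hbu'⟩ := neg u hu hbu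
    have h2 := Sp (r + R) (by linarith) (by linarith)
    exact C'.comb_mem_interior (by norm_num) hLc hL ho (hmem _ hu' hbu') (div_pos hSR h2)
      (div_pos (Sp r hr (by linarith)) h2) (C'.comb_polar_neg hu hu' h2.ne')
  refine ⟨C', b, g.ps R, hPb, ⟨hb, hLc, hL, hmi, g.ps_pos hVR hR0, fun z hz => ⟨fun hzL => ?_,
    fun hzs => ?_⟩⟩, _, hz₁, hPz₁, C'.s_polar _ _ _⟩
  · by_cases hne : z = C'.o
    · rw [hne, C'.s_o]; exact g.ps_nonneg _
    obtain ⟨u, hu, r, hr, hrR, hbu, rfl⟩ := hin z hzL (by rw [hPb, hz]) hne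
    rw [C'.s_polar]
    exact (g.ps_le (Vp r hr.le (by linarith)) hVR).2 hrR
  · by_cases hne : z = C'.o
    · rwa [hne]
    have h2 : 0 < dist C'.o z := dist_pos.2 (Ne.symm hne)
    have h3 : dist C'.o z ≤ R := by
      rw [C'.s_eq] at hzs
      exact (C'.qd_le_of hVR).1 hzs
    have hS := Sp _ h2 (by linarith)
    obtain ⟨u, hu, hzu⟩ := C'.exists_eq_polar (C'.s_eq z) hS
    have hbu : inner ℝ b u = 0 := (orth u hu _ hS).1 (by rw [← hzu, hPb, hz])
    rw [hzu]
    exact C'.polar_mem_of_le (by norm_num) hL hmL hu h2 h3 hVR hSR (hmem u hu hbu)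

/-- Small caps with round bases near a point with an outer bound of positive curvature. -/
theorem Chart.exists_cap (C : Chart g d X) (hd : 2 ≤ d) {L : Set X} (hLc : IsClosed L)
    (hL : GConvex L) {y : X} {H : X → ℝ} {c cs : ℝ} (hsp : Supp g L y H cs) (hout : OutC g L y H c)
    (hc : 0 < c) (hrot : ∃ δ > 0, ∀ f : X ≃ᵢ X, OrientationPreserving f → f y = y →
      (∀ z, H (f z) = H z) → ∀ z, qd g y z < δ → (z ∈ L ↔ f z ∈ L)) {ε : ℝ} (hε : 0 < ε) :
    ∃ (C' : Chart g d X) (b : Vec d) (ρ : ℝ), Cap C' L b ρ ∧ ρ ≤ ε ∧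
      (∀ z ∈ L, 0 ≤ inner ℝ b (C'.n z) → C'.s z ≤ ε) ∧ 0 < inner ℝ b (C'.n y) := by
  obtain ⟨δ, hδ, hrot⟩ := hrot
  obtain ⟨δ₁, hδ₁, hq1⟩ := exists_lt_qd g (X := X) (lt_min hε one_pos)
  obtain ⟨δ₂, hδ₂, hq2⟩ := exists_lt_qd g (X := X) hδ
  obtain ⟨P, o, hP, ho, hPo, hPy, hsm, hround⟩ := C.exists_cut (by omega) hL hsp hout hc
    (lt_min (lt_min (half_pos hδ₁) hδ₂) (one_half_pos (α := ℝ)))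
  have hq : ∀ z ∈ L, 0 ≤ P z → ∀ w ∈ L, 0 ≤ P w → qd g z w < min ε 1 := by
    intro z hz hPz w hw hPw
    apply hq1
    have h1 := dist_triangle_left z w y
    have h2 := (hsm z hz hPz).trans_le ((min_le_left _ _).trans (min_le_left _ _))
    have h3 := (hsm w hw hPw).trans_le ((min_le_left _ _).trans (min_le_left _ _))
    linarith
  have fin : ∀ (C' : Chart g d X) (b : Vec d) (ρ : ℝ), (∀ z, P z = inner ℝ b (C'.n z)) →
      Cap C' L b ρ → (∃ z ∈ L, P z = 0 ∧ C'.s z = ρ) →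
      Cap C' L b ρ ∧ ρ ≤ ε ∧
      (∀ z ∈ L, 0 ≤ inner ℝ b (C'.n z) → C'.s z ≤ ε) ∧ 0 < inner ℝ b (C'.n y) := by
    intro C' b ρ hPb hcap ⟨z, hz, hPz, hzs⟩
    have h1 : ∀ w ∈ L, 0 ≤ inner ℝ b (C'.n w) → C'.s w ≤ ε := by
      intro w hw hwb
      rw [C'.s_eq]
      exact ((hq C'.o (interior_subset hcap.o_mem) (by rw [hPb, C'.n_o, inner_zero_right]) w hw
        (by rw [hPb]; exact hwb)).trans_le (min_le_left _ _)).le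
    refine ⟨hcap, ?_, h1, by rw [← hPb]; exact hPy⟩
    rw [← hzs]
    exact h1 z hz (by rw [← hPb, hPz])
  rcases hd.eq_or_lt with rfl | hd3
  · obtain ⟨C', b, ρ, h1, h2, h3⟩ := C.exists_cap_two hLc hL hP (y := y) ho hPo
      (fun z hz hPz => (hsm z hz hPz.ge).trans_le (min_le_right _ _))
    exact ⟨C', b, ρ, fin C' b ρ h1 h2 h3⟩
  obtain ⟨C', hC'⟩ := C.exists_at o
  obtain rfl := C'.eq_o hC'
  obtain ⟨b, hb, hPb⟩ := C'.isHS_zero hC' hP hPo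
  obtain ⟨ρ, h2, z, hz, hzb, hzs⟩ := C'.exists_cap_of_round hd hLc hL ho hb (B := 1)
    (fun z hz hzb => by
      rw [C'.s_eq]
      exact ((hq _ (interior_subset ho) hPo.ge z hz (by rw [hPb, hzb])).trans_le
        (min_le_right _ _)).le)
    (by linarith [g.k_le_one])
    (fun z hz hzb z' hzb' hss => by
      obtain ⟨h3, h4⟩ := hround z z' (by rw [hPb, hzb]) (by rw [hPb, hzb'])
        (by rw [← C'.s_eq, ← C'.s_eq, hss])
      obtain ⟨C₀, hC₀⟩ := C.exists_at y
      obtain rfl := C₀.eq_o hC₀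
      obtain ⟨a, ha, hHa⟩ := C₀.isHS_zero hC₀ hsp.isHS hsp.zero
      obtain ⟨f, hf, hfy, hfa, hfz⟩ := C₀.exists_flag_rotation hd3 hC₀ (a := a) (z := z) (z' := z')
        (by rw [C₀.s_eq, C₀.s_eq, h3]) (by rw [← hHa, ← hHa, h4])
      rw [← hfz]
      refine (hrot f hf hfy (fun w => by rw [hHa, hHa, hfa]) z (hq2 _ _ ?_)).1 hz
      exact (hsm z hz (by rw [hPb, hzb])).trans_le ((min_le_left _ _).trans (min_le_right _ _)))
  exact ⟨C', b, ρ, fin C' b ρ hPb h2 ⟨z, hz, by rw [hPb, hzb], hzs⟩⟩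

end

section
variable {g : Geo} {d : ℕ} {X : Type*} [MetricSpace X]

theorem IsMidpoint.symm {p x y : X} (h : IsMidpoint p x y) : IsMidpoint p y x := by
  obtain ⟨h1, h2⟩ := h
  unfold Btw at h1
  refine ⟨?_, by rw [dist_comm y, dist_comm p x, h2]⟩
  unfold Btw
  rw [dist_comm y p, dist_comm p x, dist_comm y x, ← h1, add_comm]

theorem T6Cond2.symm {K L : Set X} (h : T6Cond2 K L) : T6Cond2 L K := by
  intro y hy x hx
  obtain ⟨ε, hε, h⟩ := h x hx y hy
  refine ⟨ε, hε, fun φ ψ hφ hψ h1 h2 p r h3 h4 h5 h6 h7 => ?_⟩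
  rw [inter_comm (⇑φ '' L)] at h1 h2 h3 h4 ⊢
  exact h ψ φ hψ hφ h1 h2 p r h3 (by rw [h4, pair_comm]) h6 h5 h7.symm

theorem OutC.transfer {K L : Set X} {x y : X} {H₁ H₂ : X → ℝ} {c : ℝ} (θ : X ≃ᵢ X) (hθ : θ y = x)
    (hH : ∀ z, H₁ (θ z) = H₂ z) (hKL : ∃ δ > 0, ∀ z, qd g y z < δ → (z ∈ L ↔ θ z ∈ K)) :
    OutC g L y H₂ c ↔ OutC g K x H₁ c := by
  obtain ⟨δ, hδ, hKL⟩ := hKL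
  constructor
  · rintro ⟨δ', hδ', h⟩
    refine ⟨min δ δ', lt_min hδ hδ', fun z hz hzq => ?_⟩
    rw [← θ.apply_symm_apply z] at hz hzq ⊢
    rw [← hθ, qd_isom] at hzq ⊢
    rw [hH]
    exact h _ ((hKL _ (hzq.trans_le (min_le_left _ _))).2 hz) (hzq.trans_le (min_le_right _ _))
  · rintro ⟨δ', hδ', h⟩
    refine ⟨min δ δ', lt_min hδ hδ', fun z hz hzq => ?_⟩
    have := h (θ z) ((hKL _ (hzq.trans_le (min_le_left _ _))).1 hz)
      (by rw [← hθ, qd_isom]; exact hzq.trans_le (min_le_right _ _))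
    rwa [← hθ, qd_isom, hH] at this

theorem InC.transfer {K L : Set X} {x y : X} {H₁ H₂ : X → ℝ} {c : ℝ} (θ : X ≃ᵢ X) (hθ : θ y = x)
    (hH : ∀ z, H₁ (θ z) = H₂ z) (hKL : ∃ δ > 0, ∀ z, qd g y z < δ → (z ∈ L ↔ θ z ∈ K)) :
    InC g L y H₂ c ↔ InC g K x H₁ c := by
  obtain ⟨δ, hδ, hKL⟩ := hKL
  constructor
  · rintro ⟨δ', hδ', h⟩
    refine ⟨min δ δ', lt_min hδ hδ', fun z hzq hz => ?_⟩
    rw [← θ.apply_symm_apply z] at hz hzq ⊢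
    rw [← hθ, qd_isom] at hzq hz
    rw [hH] at hz
    exact (hKL _ (hzq.trans_le (min_le_left _ _))).1 (h _ (hzq.trans_le (min_le_right _ _)) hz)
  · rintro ⟨δ', hδ', h⟩
    refine ⟨min δ δ', lt_min hδ hδ', fun z hzq hz => ?_⟩
    refine (hKL _ (hzq.trans_le (min_le_left _ _))).2 (h (θ z) ?_ ?_)
    · rw [← hθ, qd_isom]; exact hzq.trans_le (min_le_right _ _)
    · rwa [← hθ, qd_isom, hH]

theorem Supp.inC {K : Set X} {x : X} {H : X → ℝ} {c : ℝ} (h : Supp g K x H c) : InC g K x H c :=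
  ⟨1, one_pos, fun z _ hz => h.inner z hz.le⟩

theorem Supp.eq_of_outC (C : Chart g d X) {K : Set X} {x : X} {H H' : X → ℝ} {c c' : ℝ}
    (h : Supp g K x H c) (hH' : IsHS g H') (h0 : H' x = 0) (ho : OutC g K x H' c') : H = H' := by
  obtain ⟨δ, hδ, ho⟩ := ho
  exact C.tangent_unique h.isHS hH' h.zero h0 hδ fun z hz h1 => ho z (h.inner z h1) hz

theorem Supp.eq_of_inC (C : Chart g d X) {K : Set X} {x : X} {H H' : X → ℝ} {c c' : ℝ}
    (h : Supp g K x H c) (hH' : IsHS g H') (h0 : H' x = 0) (hi : InC g K x H' c') : H = H' := by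
  obtain ⟨δ, hδ, hi⟩ := hi
  refine (C.tangent_unique hH' h.isHS h0 h.zero (c := c' + 1) (c' := 0) hδ fun z hz h1 => ?_).symm
  rw [zero_mul]
  by_cases hxz : x = z
  · rw [← hxz, h.zero]
  have := C.qd_pos hxz
  exact h.nonneg z (hi z hz (by linarith))

theorem OutC.le_of_inC (C : Chart g d X) (hd : 2 ≤ d) {K : Set X} {x : X} {H : X → ℝ} {c c' : ℝ}
    (hH : IsHS g H) (h0 : H x = 0) (ho : OutC g K x H c) (hi : InC g K x H c') : c ≤ c' := by
  by_contra! hlt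
  obtain ⟨C, hC⟩ := C.exists_at x
  obtain ⟨a, ha, hHa⟩ := C.isHS_zero hC hH h0
  obtain ⟨v, hv, hva⟩ := exists_unit_orth_one hd a
  obtain ⟨δ, hδ, ho⟩ := ho
  obtain ⟨δ', hδ', hi⟩ := hi
  have h1 : ∀ᶠ r in nhdsWithin (0 : ℝ) (Ioi 0), g.ps r < min δ δ' :=
    nhdsWithin_le_nhds ((g.continuous_ps.tendsto 0).eventually_lt_const
      (by simpa using And.intro hδ hδ'))
  obtain ⟨r, ⟨hr, hvr, hS, -, h3⟩, h5⟩ := ((g.eventually_small |(c + c') / 2|).and h1).exists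
  set e := (c + c') / 2 with he
  have hps : 0 < g.ps r := g.ps_pos hvr hr
  set κ := e * g.ps r / g.Sn r with hκ
  have hκ1 : κ ^ 2 ≤ 1 := by
    rw [sq_le_one_iff_abs_le_one, hκ, abs_div, abs_mul, abs_of_pos hps, abs_of_pos hS,
      div_le_one hS]
    exact h3.le
  have hκS : g.Sn r * κ = e * g.ps r := by rw [hκ]; field_simp
  set u := κ • a + √(1 - κ ^ 2) • v with hu
  have hua : inner ℝ a u = κ := by
    rw [hu, inner_add_right, inner_smul_right, inner_smul_right, real_inner_self_eq_norm_sq, ha,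
      real_inner_comm, hva]
    ring
  have hu1 : ‖u‖ = 1 := by
    have : ‖u‖ ^ 2 = 1 := by
      rw [hu, norm_add_sq_real, norm_smul, norm_smul, ha, hv, inner_smul_left, inner_smul_right,
        real_inner_comm, hva, Real.norm_eq_abs, Real.norm_eq_abs, mul_one, mul_one, sq_abs, sq_abs,
        Real.sq_sqrt (by linarith)]
      simp
    exact (pow_eq_one_iff_of_nonneg (norm_nonneg u) two_ne_zero).1 this
  have hq : qd g x (C.polar u hu1 r) = g.ps r := by rw [← C.s_eq_zero_iff hC, C.s_polar]
  have hHu : H (C.polar u hu1 r) = e * g.ps r := by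
    rw [hHa, C.n_polar, inner_smul_right, hua, hκS]
  have h6 := hi (C.polar u hu1 r) (by rw [hq]; exact h5.trans_le (min_le_right _ _))
    (by rw [hq, hHu, he]; nlinarith)
  have h7 := ho _ h6 (by rw [hq]; exact h5.trans_le (min_le_left _ _))
  rw [hq, hHu, he] at h7
  nlinarith

/-- The germ of `L` at `y` has the osculating data of the germ of `K` at `x`. -/
def SameGerm (g : Geo) (K : Set X) (x : X) (H : X → ℝ) (L : Set X) : Prop :=
  ∀ y ∈ frontier L, ∃ H' cs, Supp g L y H' cs ∧ (∀ c, OutC g L y H' c ↔ OutC g K x H c) ∧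
    (∀ c, InC g L y H' c ↔ InC g K x H c) ∧
    ∃ δ > 0, ∀ f : X ≃ᵢ X, OrientationPreserving f → f y = y → (∀ z, H' (f z) = H' z) →
      ∀ z, qd g y z < δ → (z ∈ L ↔ f z ∈ L)

theorem Chart.sameGerm (C : Chart g d X) (hd : 2 ≤ d) {K L : Set X} (hK : GConvex K)
    (hLc : IsClosed L) (hL : GConvex L) (hLb : CondBallInside L) {x : X} {H : X → ℝ} {cs c : ℝ}
    (hx : Supp g K x H cs) (hc : 0 < c) (hout : OutC g K x H c) (h2 : T6Cond2 K L) :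
    SameGerm g K x H L := by
  intro y hy
  obtain ⟨H', cs', hs⟩ := C.exists_supp (by omega) hLc hL hLb hy
  obtain ⟨⟨θ, hθ, hH, h⟩, hrot⟩ := C.germ hd hK hL hx hs hc hout h2
  exact ⟨H', cs', hs, fun c => OutC.transfer θ hθ hH h, fun c => InC.transfer θ hθ hH h, hrot⟩

theorem exists_cap_size (c c' : ℝ) : ∃ B > 0,
    B + 1 / (2 * c) * √(3 * B) ≤ 1 / 2 ∧
    (1 + c ^ 2) * (3 * (B + 1 / (2 * c) * √(3 * B))) < 3 / 4 ∧ (1 + c' ^ 2) * (3 * B) < 3 / 4 := by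
  have e1 := Geo.eventually_pos (F := fun B => 1 / 2 - (B + 1 / (2 * c) * √(3 * B)))
    (by fun_prop) (by simp)
  have e2 := Geo.eventually_pos
    (F := fun B => 3 / 4 - (1 + c ^ 2) * (3 * (B + 1 / (2 * c) * √(3 * B)))) (by fun_prop) (by simp)
  have e3 := Geo.eventually_pos
    (F := fun B => 3 / 4 - (1 + c' ^ 2) * (3 * B)) (by fun_prop) (by simp)
  obtain ⟨B, ⟨⟨h1, h2⟩, h3⟩, h4⟩ := (((e1.and e2).and e3).and self_mem_nhdsWithin).exists
  exact ⟨B, h4, by linarith, by linarith, by linarith⟩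

/-- All boundary points of `L` are osculated with curvature `c`. -/
def Osculated (g : Geo) (L : Set X) (c : ℝ) : Prop :=
  ∀ y ∈ frontier L, ∃ H cs, Supp g L y H cs ∧ OutC g L y H c ∧ InC g L y H c

theorem Chart.osculated_of_sameGerm (C : Chart g d X) (hd : 2 ≤ d) {K L : Set X} (hLc : IsClosed L)
    (hL : GConvex L) {x : X} {H : X → ℝ} {cs c₀ : ℝ} (hx : Supp g K x H cs) (hc₀ : 0 < c₀)
    (hout : OutC g K x H c₀) (hs : SameGerm g K x H L) :
    Osculated g L (sSup {c | OutC g K x H c}) := by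
  intro y hy
  have hbdd : BddAbove {c | OutC g K x H c} :=
    ⟨cs, fun c hc => OutC.le_of_inC C hd hx.isHS hx.zero hc hx.inC⟩
  set c := sSup {c | OutC g K x H c} with hc
  set c' := sInf {c | InC g K x H c} with hc'
  have hcpos : 0 < c := hc₀.trans_le (le_csSup hbdd hout)
  have hci : ∀ a, InC g K x H a → c ≤ a := fun a ha =>
    csSup_le ⟨c₀, hout⟩ fun b hb => OutC.le_of_inC C hd hx.isHS hx.zero hb ha
  have hbi : BddBelow {c | InC g K x H c} := ⟨c, hci⟩
  have hcc' : c ≤ c' := le_csInf ⟨cs, hx.inC⟩ hci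
  obtain ⟨B, hB, hB1, hB2, hB3⟩ := exists_cap_size c c'
  obtain ⟨H', cs', hsp, hO, hI, hrot⟩ := hs y hy
  obtain ⟨C', b, ρ, D, hρB, hsB, hyb⟩ := C.exists_cap hd hLc hL hsp ((hO c₀).2 hout) hc₀ hrot hB
  have hM : 0 ≤ 1 / (2 * c) * √(3 * B) := by positivity
  obtain ⟨⟨H₁, hH₁, h01, h1⟩, ⟨H₂, hH₂, h02, h2⟩⟩ := D.osculating (by omega) hcpos hcc'
    (Real.sqrt_nonneg (3 * B))
    (fun z hz hzb => ⟨hsB z hz hzb, by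
      have h1 := hsB z hz hzb
      have h0 := C'.s_nonneg z
      have h2 : ‖C'.n z‖ ^ 2 ≤ 3 * B := by
        rw [C'.norm_n]
        nlinarith [g.neg_one_le_k, sq_nonneg (C'.s z)]
      refine (real_inner_le_norm _ _).trans ?_
      rw [D.hb, one_mul]
      exact Real.le_sqrt_of_sq_le h2⟩) hB1 hρB hB2 hB3
    (fun z hz G a hG h0 ho => by
      obtain ⟨G', cs', hsp, hO, -⟩ := hs z (ho.mem_frontier C hG h0 hz)
      rw [← hsp.eq_of_outC C hG h0 ho] at ho
      exact le_csSup hbdd ((hO a).1 ho))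
    (fun z hz hzi G a hG h0 hi => by
      obtain ⟨G', cs', hsp, -, hI, -⟩ := hs z ⟨subset_closure hz, hzi⟩
      rw [← hsp.eq_of_inC C hG h0 hi] at hi
      exact csInf_le hbi ((hI a).1 hi)) hsp.mem hy.2 hyb
  refine ⟨H', cs', hsp, ?_, ?_⟩
  · rwa [hsp.eq_of_outC C hH₁ h01 h1]
  · rwa [hsp.eq_of_inC C hH₂ h02 h2]

theorem Chart.exists_osculated (C : Chart g d X) (hd : 2 ≤ d) {K L : Set X} (hKc : IsClosed K)
    (hLc : IsClosed L) (hK : GConvex K) (hL : GConvex L) (hKb : CondBallInside K)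
    (hLb : CondBallInside L) (hLn : (frontier L).Nonempty) (h2 : T6Cond2 K L) {x : X} {H : X → ℝ}
    {cs c₀ : ℝ} (hx : Supp g K x H cs) (hc₀ : 0 < c₀) (hout : OutC g K x H c₀) :
    ∃ c > 0, Osculated g K c ∧ Osculated g L c := by
  have hKL := C.sameGerm hd hK hLc hL hLb hx hc₀ hout h2
  have hcs : BddAbove {c | OutC g K x H c} :=
    ⟨cs, fun c hc => OutC.le_of_inC C hd hx.isHS hx.zero hc hx.inC⟩
  obtain ⟨y, hy⟩ := hLn
  obtain ⟨H', cs', hsp, hO, hI, -⟩ := hKL y hy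
  have hLK := C.sameGerm hd hL hKc hK hKb hsp hc₀ ((hO _).2 hout) h2.symm
  refine ⟨_, hc₀.trans_le (le_csSup hcs hout), ?_,
    C.osculated_of_sameGerm hd hLc hL hx hc₀ hout hKL⟩
  have := C.osculated_of_sameGerm hd hKc hK hsp hc₀ ((hO _).2 hout) hLK
  simpa only [hO] using this

end

section
variable {g : Geo} {d : ℕ} {X : Type*} [MetricSpace X]

namespace Chart
variable (C : Chart g d X)

theorem continuous_of {T : Type*} [TopologicalSpace T] {f : T → X}
    (hn : Continuous fun x => C.n (f x)) (hs : Continuous fun x => C.s (f x)) : Continuous f := by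
  rw [continuous_iff_continuousAt]
  intro x
  rw [ContinuousAt, Metric.tendsto_nhds]
  intro ε hε
  obtain ⟨δ, hδ, h⟩ := C.exists_qd_lt hε
  have hq : Continuous fun y => qd g (f y) (f x) := by
    simp_rw [C.qd_eq]
    exact ((hs.add continuous_const).sub ((continuous_const.mul hs).mul continuous_const)).sub
      (hn.inner continuous_const)
  have h0 : qd g (f x) (f x) < δ := by rwa [qd_self]
  filter_upwards [hq.continuousAt.eventually_lt_const h0] with y hy
  exact h _ _ hy

theorem continuous_polar {u : Vec d} (hu : ‖u‖ = 1) : Continuous (C.polar u hu) := by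
  have h1 := g.continuous_Sn
  have h2 := g.continuous_ps
  refine C.continuous_of ?_ ?_
  · simp_rw [n_polar]; fun_prop
  · simp_rw [s_polar]; fun_prop

theorem exists_polar_eq (hd : 1 ≤ d) (z : X) : ∃ u, ∃ hu : ‖u‖ = 1, ∃ r, z = C.polar u hu r := by
  by_cases hz : C.n z = 0
  · obtain ⟨u, hu, -⟩ := exists_unit_orth (d := d) ∅ (by simp; omega)
    refine ⟨u, hu, dist C.o z, C.ext_pt ?_ ?_⟩
    · have h1 : g.Sn (dist C.o z) = 0 := by
        have h2 := C.norm_n z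
        rw [hz, norm_zero, C.s_eq, qd, ← g.Sn_sq] at h2
        exact pow_eq_zero_iff two_ne_zero |>.1 (by rw [← h2]; simp)
      rw [n_polar, h1, zero_smul, hz]
    · rw [s_polar, C.s_eq, qd]
  · obtain ⟨u, r, hu, -, -, -, -, -, hn, hs⟩ := C.exists_polar z hz
    exact ⟨u, hu, r, C.ext_pt (by rw [n_polar, hn]) (by rw [s_polar, hs])⟩

include C in
theorem preconnectedSpace (hd : 1 ≤ d) : PreconnectedSpace X := by
  refine ⟨isPreconnected_of_forall C.o fun z _ => ?_⟩
  obtain ⟨u, hu, r, rfl⟩ := C.exists_polar_eq hd z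
  refine ⟨range (C.polar u hu), subset_univ _, ⟨0, C.polar_zero hu⟩, ⟨r, rfl⟩, ?_⟩
  rw [← image_univ]
  exact isPreconnected_univ.image _ (C.continuous_polar hu).continuousOn

include C in
theorem frontier_nonempty (hd : 1 ≤ d) {K : Set X} (h1 : K.Nonempty) (h2 : K ≠ univ) :
    (frontier K).Nonempty := by
  have := C.preconnectedSpace hd
  by_contra h
  rcases isClopen_iff.1 (isClopen_iff_frontier_eq_empty.2 (not_nonempty_iff_eq_empty.1 h)) with h | h
  · exact h1.ne_empty h
  · exact h2 h

/-- The chart vector determines the point, outside of spherical geometry. -/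
theorem exists_n_eq (hg : g ≠ .sph) : ∃ σ : Vec d → X, Continuous σ ∧ (∀ v, C.n (σ v) = v) ∧
    ∀ z, σ (C.n z) = z := by
  have hk : g.k ≤ 0 := by cases g <;> simp_all [Geo.k]
  have ht : ∀ v : Vec d, 0 < 1 + √(1 - g.k * ‖v‖ ^ 2) := fun v => by positivity
  have hq : ∀ v : Vec d, 0 ≤ 1 - g.k * ‖v‖ ^ 2 := fun v => by nlinarith [sq_nonneg ‖v‖]
  set S : Vec d → ℝ := fun v => ‖v‖ ^ 2 / (1 + √(1 - g.k * ‖v‖ ^ 2)) with hS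
  have hS0 : ∀ v, 0 ≤ S v := fun v => div_nonneg (sq_nonneg _) (ht v).le
  have hS1 : ∀ v : Vec d, ‖v‖ ^ 2 = 2 * S v - g.k * S v ^ 2 := fun v => by
    have h1 := Real.sq_sqrt (hq v)
    have h2 := ht v
    simp only [hS]
    generalize √(1 - g.k * ‖v‖ ^ 2) = w at h1 h2
    field_simp
    linear_combination ‖v‖ ^ 2 * h1
  have huniq : ∀ a b : ℝ, 0 ≤ a → 0 ≤ b → 2 * a - g.k * a ^ 2 = 2 * b - g.k * b ^ 2 → a = b := by
    intro a b ha hb h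
    have h3 : (a - b) * (2 - g.k * (a + b)) = 0 := by linarith
    rcases mul_eq_zero.1 h3 with h | h
    · linarith
    · nlinarith
  refine ⟨fun v => C.pt v (S v) (hS0 v) (hS1 v), C.continuous_of ?_ ?_, fun v => C.n_pt _ _ _ _,
    fun z => C.ext_pt (C.n_pt _ _ _ _) ?_⟩
  · simp_rw [n_pt]; exact continuous_id
  · simp_rw [s_pt]
    refine Continuous.div (by fun_prop) (by fun_prop) fun v => (ht v).ne'
  · rw [s_pt]
    exact huniq _ _ (hS0 _) (C.s_nonneg z) (by rw [← hS1, C.norm_n])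

theorem isPreconnected_of_convex (hg : g ≠ .sph) {S : Set (Vec d)} (hS : Convex ℝ S) :
    IsPreconnected {z | C.n z ∈ S} := by
  obtain ⟨σ, h1, h2, h3⟩ := C.exists_n_eq hg
  have : {z | C.n z ∈ S} = σ '' S := by
    ext z
    constructor
    · intro hz; exact ⟨C.n z, hz, h3 z⟩
    · rintro ⟨v, hv, rfl⟩
      change C.n (σ v) ∈ S
      rwa [h2]
  rw [this]
  exact hS.isPreconnected.image _ h1.continuousOn

end Chart

end

section
variable {g : Geo} {d : ℕ} {X : Type*} [MetricSpace X]

theorem exists_fixed_of_crossing {σ : X ≃ᵢ X} {P S : Set X} (hP : IsClosed P)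
    (hu : P ∪ σ '' P = univ) (hi : P ∩ σ '' P = {x | σ x = x}) (hS : IsPreconnected S) {x y : X}
    (hx : x ∈ S) (hxP : x ∉ P) (hy : y ∈ S) (hyP : y ∈ P) : ∃ v ∈ S, σ v = v := by
  have hc : IsClosed (σ '' P) := σ.toHomeomorph.isClosedMap P hP
  have hx' : x ∈ σ '' P := by
    have : x ∈ P ∪ σ '' P := by rw [hu]; trivial
    exact this.resolve_left hxP
  obtain ⟨v, hv, hv'⟩ := isPreconnected_closed_iff.1 hS P (σ '' P) hP hc (by rw [hu]; exact subset_univ _)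
    ⟨y, hy, hyP⟩ ⟨x, hx, hx'⟩
  rw [hi] at hv'
  exact ⟨v, hv, hv'⟩

theorem Chart.hs_le_sinh (C : Chart .hyp d X) {H : X → ℝ} (hH : IsHS .hyp H) {w : X}
    (hw : H w ≤ 0) (z : X) : H z ≤ Real.sinh (dist z w) := by
  obtain ⟨C, hC⟩ := C.exists_at w
  obtain ⟨a, e, hae, rfl⟩ := (C.isHS_iff H).1 hH
  rw [Chart.hs, C.n_zero hC, C.t_zero hC, inner_zero_right, zero_add, mul_one] at hw
  have hk : Geo.hyp.k = -1 := rfl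
  rw [hk] at hae
  have hs : C.s z = Geo.hyp.ps (dist z w) := by rw [C.s_eq_zero_iff hC, qd, dist_comm]
  have hn := C.norm_n z
  rw [hs, ← Geo.Sn_sq] at hn
  have hS0 : 0 ≤ Real.sinh (dist z w) := Real.sinh_nonneg_iff.2 dist_nonneg
  have hn' : ‖C.n z‖ = Real.sinh (dist z w) := (pow_left_inj₀ (norm_nonneg _) hS0 two_ne_zero).1 hn
  have ht : C.t z = Real.cosh (dist z w) := by
    rw [Chart.t, hs, ← Geo.Co_eq]; rfl
  have hCS := Real.sinh_lt_cosh (dist z w)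
  have ha : ‖a‖ ≤ 1 - e := by
    refine abs_le_of_sq_le_sq' ?_ (by linarith) |>.2
    nlinarith
  rw [Chart.hs, ht]
  have h1 := real_inner_le_norm a (C.n z)
  rw [hn'] at h1
  nlinarith

theorem Chart.exists_out_hyp (C : Chart .hyp d X) (hX : IsHyperbolicSpace X d)
    {K : Set X} (hcurv : CondCurvBound d K) {x : X} (hx : x ∈ frontier K) :
    ∃ c > 0, ∃ H, IsHS .hyp H ∧ H x = 0 ∧ OutC .hyp K x H c := by
  obtain ⟨ε, hε, B, hKB, hxB, -, -, h3⟩ := hcurv x hx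
  obtain ⟨P, lam, ⟨σ, -, hPc, hPu, hPi⟩, hlam, -, rfl⟩ := h3 hX
  have hxl : infDist x P = lam := frontier_le_subset_eq (continuous_infDist_pt P) continuous_const hxB
  have hPne : P.Nonempty := by
    by_contra h
    rw [not_nonempty_iff_eq_empty.1 h, infDist_empty] at hxl
    exact hlam.ne hxl
  have hxP : x ∉ P := fun h => hlam.ne' (by rw [← hxl, infDist_zero_of_mem h])
  have hσx : σ x ∈ P := by
    have h1 : σ x ∈ P ∪ σ '' P := by rw [hPu]; trivial
    refine h1.resolve_right ?_
    rintro ⟨w, hw, hwx⟩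
    exact hxP (σ.injective hwx ▸ hw)
  have hne : x ≠ σ x := fun h => hxP (h ▸ hσx)
  obtain ⟨a, e, hae, hsw⟩ := C.exists_sigma_swap hne
  have hswap : ∀ v, σ v = v → C.hs a e v = 0 := by
    intro v hv
    have h1 : qd .hyp v (C.sigma a e hae x) = qd .hyp v x := by
      rw [hsw]; conv_lhs => rw [← hv, qd_isom]
    have h0 : C.hs a e x ≠ 0 := fun h => hne (((C.sigma_eq_iff a e hae x).2 h).symm.trans hsw)
    rw [C.qd_eq, C.qd_eq, C.n_sigma, C.s_sigma, inner_sub_right, inner_smul_right,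
      real_inner_comm a (C.n v)] at h1
    have h2 : C.hs a e x * C.hs a e v = 0 := by
      have h3 : C.hs a e v = inner ℝ a (C.n v) + e * (1 - Geo.hyp.k * C.s v) := rfl
      rw [h3]
      linear_combination h1 / 2
    exact (mul_eq_zero.1 h2).resolve_left h0
  obtain ⟨H, hH, hH0, hHσ, hHx⟩ : ∃ H, IsHS .hyp H ∧ (∀ v, σ v = v → H v = 0) ∧
      qd .hyp x (σ x) = 2 * H x ^ 2 ∧ 0 ≤ H x := by
    have hq := C.qd_sigma a e hae x
    rw [hsw] at hq
    rcases le_total 0 (C.hs a e x) with h | h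
    · exact ⟨_, C.isHS_hs hae, hswap, hq, h⟩
    · refine ⟨fun z => - C.hs a e z, (C.isHS_hs hae).neg, fun v hv => ?_, ?_, ?_⟩
      · simp only [hswap v hv, neg_zero]
      · rw [hq]; ring
      · linarith
  have hxpos : 0 < H x := by
    refine hHx.lt_of_ne fun h => ?_
    rw [← h] at hHσ
    exact hne (C.qd_eq_zero.1 (by rw [hHσ]; ring))
  obtain ⟨v, hv, hvd⟩ : ∃ v, σ v = v ∧ Real.sinh (dist x v) ≤ H x := by
    obtain ⟨C, hC⟩ := C.exists_at x
    have ho := C.eq_o hC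
    obtain ⟨u, r, hu, hr, hrd, -, -, -, hn, hs⟩ := C.exists_polar (σ x) (fun h => hne (by
      have h1 := C.norm_n (σ x)
      rw [h, norm_zero] at h1
      have h2 := C.s_nonneg (σ x)
      have hk : Geo.hyp.k = -1 := rfl
      rw [hk] at h1
      exact C.ext_pt (by rw [h, C.n_zero hC]) (by rw [hC]; nlinarith)))
    have hz : σ x = C.polar u hu r := C.ext_pt (by rw [C.n_polar, hn]) (by rw [C.s_polar, hs])
    obtain ⟨v, ⟨r', -, rfl⟩, hv⟩ := exists_fixed_of_crossing hPc hPu hPi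
      (isPreconnected_univ.image (C.polar u hu) (C.continuous_polar hu).continuousOn)
      (x := x) (y := σ x) ⟨0, trivial, by rw [C.polar_zero, ho]⟩ hxP ⟨r, trivial, hz.symm⟩ hσx
    refine ⟨_, hv, le_of_eq ?_⟩
    have h1 : qd .hyp (C.polar u hu r') (σ x) = qd .hyp (C.polar u hu r') x := by
      conv_lhs => rw [← hv, qd_isom]
    have hx0 : x = C.polar u hu 0 := by rw [C.polar_zero, ho]
    rw [hz, hx0, C.qd_polar_polar, C.qd_polar_polar, sub_zero] at h1
    have h2 : Real.cosh (r' - r) = Real.cosh r' := by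
      have : Real.cosh (r' - r) - 1 = Real.cosh r' - 1 := h1
      linarith
    have h3 : r' = r / 2 := by
      have h4 := abs_eq_abs.1 (le_antisymm (Real.cosh_le_cosh.1 h2.le) (Real.cosh_le_cosh.1 h2.ge))
      rcases h4 with h4 | h4 <;> linarith
    have hvr : Geo.hyp.Val (r / 2) := ⟨by linarith, fun h => by cases h⟩
    have h5 : dist x (C.polar u hu r') = r / 2 := by
      refine Geo.ps_inj .hyp (C.val _ _) hvr ?_
      change qd .hyp _ _ = _
      rw [qd_comm]
      nth_rewrite 1 [hx0]
      rw [C.qd_polar_polar, h3, sub_zero]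
    rw [h5]
    refine (pow_left_inj₀ (Real.sinh_nonneg_iff.2 hvr.1) hHx two_ne_zero).1 ?_
    rw [hz] at hHσ
    nth_rewrite 1 [hx0] at hHσ
    rw [C.qd_polar_polar, zero_sub, Geo.ps_neg] at hHσ
    have h6 : Real.cosh r - 1 = 2 * H x ^ 2 := hHσ
    have h7 := Real.cosh_two_mul (r / 2)
    rw [mul_div_cancel₀ _ two_ne_zero, Real.cosh_sq] at h7
    linarith
  have hPH : ∀ w ∈ P, H w ≤ 0 := by
    intro w hw
    by_contra! hHw
    obtain ⟨C, hC⟩ := C.exists_at v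
    obtain ⟨b, hb, hHb⟩ := C.isHS_zero hC hH (hH0 v hv)
    have hpre : IsPreconnected {z | 0 < H z} := by
      have := C.isPreconnected_of_convex (fun h => by cases h) (convex_halfSpace_gt (𝕜 := ℝ)
        (f := fun n : Vec d => inner ℝ b n) (innerSL ℝ b).isBoundedLinearMap.toIsLinearMap 0)
      simpa [hHb] using this
    obtain ⟨v', hv', hv''⟩ := exists_fixed_of_crossing hPc hPu hPi hpre (x := x) hxpos hxP hHw hw
    have hv' : 0 < H v' := hv'
    rw [hH0 v' hv''] at hv'
    exact lt_irrefl _ hv'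
  have hle : ∀ z, H z ≤ Real.sinh (infDist z P) := by
    intro z
    rw [← Real.sinh_arsinh (H z), Real.sinh_le_sinh]
    refine (le_infDist hPne).2 fun w hw => ?_
    rw [← Real.sinh_le_sinh, Real.sinh_arsinh]
    exact C.hs_le_sinh hH (hPH w hw) z
  have hvP : v ∈ P := by
    have : v ∈ P ∩ σ '' P := by rw [hPi]; exact hv
    exact this.1
  have hHlam : H x = Real.sinh lam := by
    refine le_antisymm (hxl ▸ hle x) (le_trans ?_ hvd)
    rw [Real.sinh_le_sinh, ← hxl]
    exact infDist_le_dist_of_mem hvP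
  obtain ⟨a, e, hae, rfl⟩ := (C.isHS_iff H).1 hH
  have hk : Geo.hyp.k = -1 := rfl
  rw [hk] at hae
  have hF : ∀ z, (Real.sinh lam - e) - e * C.s z + inner ℝ (-a) (C.n z) =
      Real.sinh lam - C.hs a e z := by
    intro z
    rw [Chart.hs, Chart.t, hk, inner_neg_left]; ring
  obtain ⟨G, hG, hG0, hGF⟩ := C.rebase (f₀ := Real.sinh lam - e) (β := e) (G := -a)
    (Λ := Real.cosh lam) (z₀ := x) (Real.cosh_pos _) (by
      rw [Real.cosh_sq, norm_neg, hk]; linear_combination -hae) (by rw [hF, hHlam, sub_self])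
  refine ⟨(e - Geo.hyp.k * (Real.sinh lam - e)) / Real.cosh lam, ?_, G, hG, hG0, ?_⟩
  rotate_left
  · obtain ⟨δ, hδ, hδε⟩ := C.exists_qd_lt hε
    refine ⟨δ, hδ, fun z hz hzx => ?_⟩
    have h1 : infDist z P ≤ lam := hKB ⟨hz, by rw [dist_comm]; exact (hδε _ _ hzx).le⟩
    have h2 := hGF z
    rw [hF] at h2
    have h3 := (hle z).trans (Real.sinh_le_sinh.2 h1)
    by_contra! h4
    nlinarith [Real.cosh_pos lam]
  · rw [hk]
    have := Real.sinh_pos_iff.2 hlam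
    have h2 := Real.cosh_pos lam
    refine div_pos ?_ h2
    linarith

end

section
variable {g : Geo} {d : ℕ} {X : Type*} [MetricSpace X]

namespace Chart

theorem polar_mem_of_antipode (C : Chart .sph d X) (hd : 2 ≤ d) {K : Set X} (hK : GConvex K)
    {z' : X} (hz' : z' ∈ K) (hn : C.n z' = 0) (hs : C.s z' = 2) {u : Vec d} (hu : ‖u‖ = 1)
    {r' r : ℝ} (h0 : 0 < r') (hr : r' ≤ r) (hrπ : r < Real.pi) (h : C.polar u hu r' ∈ K) :
    C.polar u hu r ∈ K := by
  rcases hr.eq_or_lt with rfl | hr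
  · exact h
  have hS' : 0 < Real.sin (Real.pi - r') := Real.sin_pos_of_pos_of_lt_pi (by linarith) (by linarith)
  have hS : 0 < Real.sin (Real.pi - r) := Real.sin_pos_of_pos_of_lt_pi (by linarith) (by linarith)
  have hS2 : 0 < Real.sin (r - r') := Real.sin_pos_of_pos_of_lt_pi (by linarith) (by linarith)
  refine hK.comb_mem C (by omega) (div_pos hS hS') (div_pos hS2 hS') (C.comb_of ?_ ?_) h hz'
  · rw [hn, smul_zero, add_zero, C.n_polar, C.n_polar, smul_smul]
    congr 1
    change Real.sin r = _ * Real.sin r'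
    rw [Real.sin_pi_sub] at hS' ⊢
    rw [Real.sin_pi_sub]; field_simp
  · rw [C.t_polar, C.t_polar, Chart.t, hs]
    change Real.cos r = _ * Real.cos r' + _ * (1 - 1 * 2)
    rw [Real.sin_pi_sub] at hS' ⊢
    rw [Real.sin_pi_sub, Real.sin_sub]; field_simp; ring

theorem hemisphere_of_antipodal (C : Chart .sph d X) (hd : 2 ≤ d) {K : Set X} (hKc : IsClosed K)
    (hK : GConvex K) (hKb : CondBallInside K) (hKp : K ≠ univ) {z z' : X} (hz : z ∈ K)
    (hz' : z' ∈ K) (hzz : qd .sph z z' = 2) : ∃ p, K = {w | qd .sph p w ≤ 1} := by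
  obtain ⟨C, hC⟩ := C.exists_at z
  have ho := C.eq_o hC
  have hs' : C.s z' = 2 := by rw [C.s_eq_zero_iff hC, hzz]
  have hn' : C.n z' = 0 := by
    have := C.norm_n z'
    rw [hs', show Geo.sph.k = 1 from rfl] at this
    exact norm_eq_zero.1 (pow_eq_zero_iff two_ne_zero |>.1 (by linarith))
  have hcase : ∀ w, w = z ∨ w = z' ∨ ∃ u, ∃ hu : ‖u‖ = 1, ∃ r, 0 < r ∧ r < Real.pi ∧
      w = C.polar u hu r := by
    intro w
    by_cases hw : C.n w = 0
    · have := C.norm_n w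
      rw [hw, norm_zero, show Geo.sph.k = 1 from rfl] at this
      have h2 : C.s w * (2 - C.s w) = 0 := by linarith
      rcases mul_eq_zero.1 h2 with h | h
      · exact Or.inl (C.ext_pt (by rw [hw, C.n_zero hC]) (by rw [h, hC]))
      · exact Or.inr (Or.inl (C.ext_pt (by rw [hw, hn']) (by rw [hs']; linarith)))
    · obtain ⟨u, r, hu, hr, -, -, hrπ, -, hn, hs⟩ := C.exists_polar w hw
      exact Or.inr (Or.inr ⟨u, hu, r, hr, hrπ rfl,
        C.ext_pt (by rw [C.n_polar, hn]) (by rw [C.s_polar, hs])⟩)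
  have hzf : z ∈ frontier K := by
    refine ⟨subset_closure hz, fun hi => hKp (eq_univ_of_forall fun w => ?_)⟩
    obtain ⟨δ, hδ, h⟩ := C.mem_interior_iff.1 hi
    rcases hcase w with rfl | rfl | ⟨u, hu, r, hr, hrπ, rfl⟩
    · exact hz
    · exact hz'
    · have h1 : ∀ᶠ r in nhdsWithin (0 : ℝ) (Ioi 0), Geo.sph.ps r < δ :=
        nhdsWithin_le_nhds ((Geo.sph.continuous_ps.tendsto 0).eventually_lt_const (by simpa using hδ))
      have h2 : ∀ᶠ r' in nhdsWithin (0 : ℝ) (Ioi 0), r' < r :=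
        nhdsWithin_le_nhds (eventually_lt_nhds hr)
      obtain ⟨r', ⟨h1, h2⟩, h3⟩ := ((h1.and h2).and self_mem_nhdsWithin).exists
      refine C.polar_mem_of_antipode hd hK hz' hn' hs' hu h3 h2.le hrπ (h _ ?_)
      rwa [← C.s_eq_zero_iff hC, C.s_polar]
  obtain ⟨H, c, hsp⟩ := C.exists_supp (by omega) hKc hK hKb hzf
  obtain ⟨a, ha, hHa⟩ := C.isHS_zero hC hsp.isHS hsp.zero
  have hpos : ∀ w, 0 < H w → w ∈ K := by
    intro w hw
    rcases hcase w with rfl | rfl | ⟨u, hu, r, hr, hrπ, rfl⟩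
    · exact hz
    · exact hz'
    rw [hHa, C.n_polar, inner_smul_right] at hw
    have hS : 0 < Geo.sph.Sn r := Geo.Sn_pos _ hr fun _ => hrπ
    have hau : 0 < inner ℝ a u := pos_of_mul_pos_right hw hS.le
    obtain ⟨r', h3, h2, -, -, -, h4⟩ := Geo.sph.exists_small (c / inner ℝ a u) hr
    refine C.polar_mem_of_antipode hd hK hz' hn' hs' hu h3 h2.le hrπ (hsp.inner _ ?_)
    rw [← C.s_eq_zero_iff hC, C.s_polar, hHa, C.n_polar, inner_smul_right]
    rw [div_mul_eq_mul_div, div_lt_iff₀ hau] at h4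
    exact h4.le
  refine ⟨C.pt a 1 zero_le_one (by rw [ha, show Geo.sph.k = 1 from rfl]; norm_num), ?_⟩
  ext w
  have hq : qd .sph (C.pt a 1 zero_le_one (by rw [ha, show Geo.sph.k = 1 from rfl]; norm_num)) w =
      1 - H w := by
    rw [C.qd_eq, C.n_pt, C.s_pt, hHa, show Geo.sph.k = 1 from rfl]; ring
  change _ ↔ _ ≤ (1 : ℝ)
  rw [hq]
  refine ⟨fun h => by linarith [hsp.nonneg w h], fun h => ?_⟩
  rcases (show 0 ≤ H w by linarith).eq_or_lt with h | h
  · rw [← hKc.closure_eq, mem_closure_iff_nhds]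
    intro U hU
    obtain ⟨δ, hδ, hb⟩ := C.mem_nhds_iff.1 hU
    obtain ⟨⟨v, hv, hv'⟩, -⟩ := C.both_signs hsp.isHS h.symm 0 hδ
    exact ⟨v, hb v hv, hpos v (by linarith)⟩
  · exact hpos w h

theorem exists_hemisphere (C : Chart .sph d X) (hd : 2 ≤ d) {K : Set X} (hKc : IsClosed K)
    (hK : GConvex K) (hne : K.Nonempty) (hKa : ∀ z ∈ K, ∀ z' ∈ K, qd .sph z z' < 2) :
    ∃ p, ∀ z ∈ K, qd .sph p z < 1 := by
  have hk : Geo.sph.k = 1 := rfl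
  have hcpt : IsCompact K := by
    refine (C.isCompact_qd_le C.o 2).of_isClosed_subset hKc fun z _ => ?_
    have := C.k_s_le z
    rw [hk, C.s_eq] at this
    change _ ≤ (2 : ℝ)
    linarith
  set h : X → Vec d × ℝ := fun z => (C.n z, C.t z) with hh
  have hcont : Continuous h := C.continuous_n.prodMk C.continuous_t
  have hsq : ∀ (α β : ℝ) (z₁ z₂ : X), ‖α • C.n z₁ + β • C.n z₂‖ ^ 2 +
      (α * C.t z₁ + β * C.t z₂) ^ 2 = α ^ 2 + β ^ 2 + 2 * α * β * (1 - qd .sph z₁ z₂) := by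
    intro α β z₁ z₂
    rw [norm_add_sq_real, norm_smul, norm_smul, mul_pow, mul_pow, C.norm_n, C.norm_n,
      inner_smul_left, inner_smul_right, RCLike.conj_to_real, Real.norm_eq_abs, sq_abs,
      Real.norm_eq_abs, sq_abs, C.qd_eq, Chart.t, Chart.t, hk]
    ring
  set Q : Set (Vec d × ℝ) := {v | ∃ l : ℝ, 0 ≤ l ∧ ∃ z ∈ K, v = l • h z} with hQ
  have hQc : Convex ℝ Q := by
    refine convex_iff_pairwise_pos.2 ?_
    rintro _ ⟨l₁, hl₁, z₁, hz₁, rfl⟩ _ ⟨l₂, hl₂, z₂, hz₂, rfl⟩ - a b ha hb -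
    rcases hl₁.eq_or_lt with rfl | hl₁
    · exact ⟨b * l₂, by positivity, z₂, hz₂, by rw [zero_smul, smul_zero, zero_add, smul_smul]⟩
    rcases hl₂.eq_or_lt with rfl | hl₂
    · exact ⟨a * l₁, by positivity, z₁, hz₁, by rw [zero_smul, smul_zero, add_zero, smul_smul]⟩
    set α := a * l₁ with hα
    set β := b * l₂ with hβ
    have hαp : 0 < α := mul_pos ha hl₁
    have hβp : 0 < β := mul_pos hb hl₂
    set v := α • C.n z₁ + β • C.n z₂ with hv
    set τ := α * C.t z₁ + β * C.t z₂ with hτ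
    have hnorm : 0 < ‖v‖ ^ 2 + τ ^ 2 := by
      have h1 : ‖v‖ ^ 2 + τ ^ 2 = α ^ 2 + β ^ 2 + 2 * α * β * (1 - qd .sph z₁ z₂) := hsq α β z₁ z₂
      have h2 := hKa z₁ hz₁ z₂ hz₂
      have h3 : 0 < α * β := mul_pos hαp hβp
      nlinarith [sq_nonneg (α - β)]
    set μ := √(‖v‖ ^ 2 + τ ^ 2) with hμ
    have hμp : 0 < μ := Real.sqrt_pos.2 hnorm
    have hμ2 : μ ^ 2 = ‖v‖ ^ 2 + τ ^ 2 := Real.sq_sqrt hnorm.le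
    have hs0 : 0 ≤ 1 - τ / μ := by
      rw [sub_nonneg, div_le_one hμp]
      exact Real.le_sqrt_of_sq_le (by nlinarith [sq_nonneg ‖v‖])
    have hs1 : ‖μ⁻¹ • v‖ ^ 2 = 2 * (1 - τ / μ) - Geo.sph.k * (1 - τ / μ) ^ 2 := by
      rw [norm_smul, mul_pow, Real.norm_eq_abs, sq_abs, hk]
      field_simp
      linear_combination -hμ2
    have hw : C.pt _ _ hs0 hs1 ∈ K := by
      refine hK.comb_mem C (by omega) (div_pos hαp hμp) (div_pos hβp hμp) (C.comb_of ?_ ?_) hz₁ hz₂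
      · rw [C.n_pt, hv, smul_add, smul_smul, smul_smul, div_eq_inv_mul, div_eq_inv_mul]
      · rw [Chart.t, C.s_pt, hk, hτ]; field_simp; ring
    refine ⟨μ, hμp.le, _, hw, ?_⟩
    rw [hh]
    simp only [Prod.smul_mk, C.n_pt, Chart.t, C.s_pt, Prod.mk_add_mk, smul_eq_mul]
    rw [smul_inv_smul₀ hμp.ne']
    refine Prod.ext ?_ ?_
    · simp only [hv, hα, hβ, mul_smul]
    · have : μ * (1 - Geo.sph.k * (1 - τ / μ)) = τ := by rw [hk]; field_simp; ring
      rw [this, hτ, hα, hβ, Chart.t, Chart.t]; ring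
  have hQcl : IsClosed Q := by
    refine IsSeqClosed.isClosed fun v w hv hvw => ?_
    choose l hl z hz hvz using hv
    set N : Vec d × ℝ → ℝ := fun v => √(‖v.1‖ ^ 2 + v.2 ^ 2) with hN
    have hNv : ∀ i, N (v i) = l i := by
      intro i
      have h1 := hsq (l i) 0 (z i) (z i)
      rw [zero_smul, add_zero, zero_mul, add_zero] at h1
      rw [hvz, hN]
      simp only [hh, Prod.smul_mk, smul_eq_mul]
      rw [h1]
      simpa using Real.sqrt_sq (hl i)
    have hNc : Continuous N := by fun_prop
    obtain ⟨z', hz', φ, hφ, hlim⟩ := hcpt.isSeqCompact hz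
    refine ⟨N w, Real.sqrt_nonneg _, z', hz', tendsto_nhds_unique (hvw.comp hφ.tendsto_atTop) ?_⟩
    have h1 : Tendsto (fun i => N (v (φ i)) • h (z (φ i))) atTop (nhds (N w • h z')) :=
      ((hNc.tendsto w).comp (hvw.comp hφ.tendsto_atTop)).smul ((hcont.tendsto z').comp hlim)
    refine h1.congr fun i => ?_
    rw [hNv, ← hvz]; rfl
  have hsep : ∀ z ∈ K, ∃ f : StrongDual ℝ (Vec d × ℝ), (∀ w ∈ K, 0 ≤ f (h w)) ∧ 0 < f (h z) := by
    intro z hz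
    have h0 : - h z ∉ Q := by
      rintro ⟨l, hl, z', hz', hzz⟩
      have h1 := hsq 1 l z z'
      have h2 : h z + l • h z' = 0 := by rw [← hzz, add_neg_cancel]
      have h3 : (1 : ℝ) • C.n z + l • C.n z' = 0 := by rw [one_smul]; exact congrArg Prod.fst h2
      have h4 : 1 * C.t z + l * C.t z' = 0 := by rw [one_mul]; exact congrArg Prod.snd h2
      rw [h3, h4, norm_zero] at h1
      have h5 := hKa z hz z' hz'
      rcases hl.eq_or_lt with rfl | hl
      · norm_num at h1
      · nlinarith [sq_nonneg (1 - l)]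
    obtain ⟨f, u, hfz, hf⟩ := geometric_hahn_banach_point_closed hQc hQcl h0
    have hu : u < 0 := by
      have := hf 0 ⟨0, le_rfl, z, hz, (zero_smul _ _).symm⟩
      rwa [map_zero] at this
    refine ⟨f, fun w hw => ?_, ?_⟩
    · by_contra! hneg
      have := hf ((u / f (h w)) • h w) ⟨_, (div_pos_of_neg_of_neg hu hneg).le, w, hw, rfl⟩
      rw [map_smul, smul_eq_mul, div_mul_cancel₀ _ hneg.ne] at this
      exact lt_irrefl _ this
    · rw [map_neg] at hfz
      linarith
  choose! F hF0 hF1 using hsep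
  obtain ⟨T, hTK, hT⟩ := hcpt.elim_nhds_subcover (fun z => {w | 0 < F z (h w)}) fun z hz =>
    (isOpen_lt continuous_const ((F z).continuous.comp hcont)).mem_nhds (hF1 z hz)
  set f : StrongDual ℝ (Vec d × ℝ) := ∑ z ∈ T, F z with hf
  have hfpos : ∀ w ∈ K, 0 < f (h w) := by
    intro w hw
    obtain ⟨z, hzT, hz⟩ := mem_iUnion₂.1 (hT hw)
    rw [hf, _root_.sum_apply]
    exact Finset.sum_pos' (fun z hz => hF0 z (hTK z hz) w hw) ⟨z, hzT, hz⟩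
  set a := (InnerProductSpace.toDual ℝ (Vec d)).symm (f.comp (ContinuousLinearMap.inl ℝ _ _)) with ha
  set e := f (0, 1) with he
  have hfa : ∀ z ∈ K, 0 < C.hs a e z := by
    intro z hz
    have h1 := hfpos z hz
    have h2 : h z = (C.n z, 0) + C.t z • (0, 1) := by simp [hh]
    rw [h2, map_add, map_smul, smul_eq_mul] at h1
    rw [Chart.hs, ha, InnerProductSpace.toDual_symm_apply, mul_comm]
    simpa using h1
  have hN : 0 < ‖a‖ ^ 2 + e ^ 2 := by
    by_contra! hN
    have h1 : ‖a‖ = 0 := by nlinarith [sq_nonneg ‖a‖, sq_nonneg e]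
    have h2 : e = 0 := by nlinarith [sq_nonneg ‖a‖, sq_nonneg e]
    obtain ⟨z, hz⟩ := hne
    have := hfa z hz
    rw [Chart.hs, norm_eq_zero.1 h1, h2, inner_zero_left] at this
    simp at this
  set μ := √(‖a‖ ^ 2 + e ^ 2) with hμ
  have hμp : 0 < μ := Real.sqrt_pos.2 hN
  have hμ2 : μ ^ 2 = ‖a‖ ^ 2 + e ^ 2 := Real.sq_sqrt hN.le
  have hs0 : 0 ≤ 1 - e / μ := by
    rw [sub_nonneg, div_le_one hμp]
    exact Real.le_sqrt_of_sq_le (by nlinarith [sq_nonneg ‖a‖])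
  have hs1 : ‖μ⁻¹ • a‖ ^ 2 = 2 * (1 - e / μ) - Geo.sph.k * (1 - e / μ) ^ 2 := by
    rw [norm_smul, mul_pow, Real.norm_eq_abs, sq_abs, hk]
    field_simp
    linear_combination -hμ2
  refine ⟨C.pt _ _ hs0 hs1, fun z hz => ?_⟩
  have h1 : qd .sph (C.pt _ _ hs0 hs1) z = 1 - C.hs a e z / μ := by
    rw [C.qd_eq, C.n_pt, C.s_pt, Chart.hs, Chart.t, inner_smul_left, hk, RCLike.conj_to_real]
    field_simp; ring
  rw [h1]
  linarith [div_pos (hfa z hz) hμp]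

theorem exists_out_sph (C : Chart .sph d X) (hd : 2 ≤ d) {K : Set X} (hKc : IsClosed K)
    (hK : GConvex K) {y : X} {H₀ : X → ℝ} {c₀ : ℝ} (hy : Supp .sph K y H₀ c₀)
    (hKa : ∀ z ∈ K, ∀ z' ∈ K, qd .sph z z' < 2) :
    ∃ x ∈ frontier K, ∃ c > 0, ∃ H, IsHS .sph H ∧ H x = 0 ∧ OutC .sph K x H c := by
  have hk : Geo.sph.k = 1 := rfl
  obtain ⟨p, hp⟩ := C.exists_hemisphere hd hKc hK ⟨y, hy.mem⟩ hKa
  obtain ⟨C, hC⟩ := C.exists_at p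
  have hcpt : IsCompact K := (C.isCompact_qd_le p 1).of_isClosed_subset hKc fun z hz => (hp z hz).le
  obtain ⟨x, hx, hmax⟩ := hcpt.exists_isMaxOn ⟨y, hy.mem⟩ C.continuous_s.continuousOn
  have hx1 : C.s x < 1 := by rw [C.s_eq_zero_iff hC]; exact hp x hx
  have hx0 : 0 < C.s x := by
    by_contra! h
    have hall : ∀ z ∈ K, z = p := fun z hz => by
      have h1 : C.s z ≤ C.s x := hmax hz
      have h2 := (C.s_eq_zero_iff hC z).symm.trans (le_antisymm (h1.trans h) (C.s_nonneg z))
      exact (C.qd_eq_zero.1 h2).symm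
    obtain ⟨⟨v, -, hv⟩, -⟩ := C.both_signs hy.isHS hy.zero c₀ one_pos
    have hvK := hy.inner v (by linarith)
    rw [hall v hvK, ← hall y hy.mem, hy.zero, qd_self] at hv
    simp at hv
  have hL : 0 < 2 * C.s x - C.s x ^ 2 := by nlinarith
  obtain ⟨H, hH, h0, ho⟩ := C.touch_out (f₀ := C.s x) (Λ := √(2 * C.s x - C.s x ^ 2)) (G := 0)
    (L := K) (z₀ := x) (Real.sqrt_pos.2 hL) (by rw [Real.sq_sqrt hL.le, hk]; simp) (by simp)
    (U := univ) univ_mem (fun z hz _ => by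
      have h1 : C.s z ≤ C.s x := hmax hz
      rw [inner_zero_left]; linarith)
  exact ⟨x, ho.mem_frontier C hH h0 hx, _,
    div_pos (by rw [hk]; linarith) (Real.sqrt_pos.2 hL), H, hH, h0, ho⟩

end Chart

end

section
variable {g : Geo} {d : ℕ} {X : Type*} [MetricSpace X]

theorem _root_.IsCompact.convexJoin {E : Type*} [AddCommGroup E] [Module ℝ E] [TopologicalSpace E]
    [ContinuousAdd E] [ContinuousSMul ℝ E] {s t : Set E} (hs : IsCompact s) (ht : IsCompact t) :
    IsCompact (convexJoin ℝ s t) := by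
  have h := ((hs.prod ht).prod (isCompact_Icc (a := (0 : ℝ)) (b := 1))).image
    (f := fun q : (E × E) × ℝ => (1 - q.2) • q.1.1 + q.2 • q.1.2) (by fun_prop)
  convert h
  ext x
  rw [mem_convexJoin]
  constructor
  · rintro ⟨a, ha, b, hb, hx⟩
    rw [segment_eq_image] at hx
    obtain ⟨θ, hθ, rfl⟩ := hx
    exact ⟨((a, b), θ), ⟨⟨ha, hb⟩, hθ⟩, rfl⟩
  · rintro ⟨⟨⟨a, b⟩, θ⟩, ⟨⟨ha, hb⟩, hθ⟩, rfl⟩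
    refine ⟨a, ha, b, hb, ?_⟩
    rw [segment_eq_image]
    exact ⟨θ, hθ, rfl⟩

theorem exists_pos_on_shell {K : Set (Vec d)} (hKc : IsClosed K) (hK : Convex ℝ K)
    (h0 : (0 : Vec d) ∈ K.extremePoints ℝ) :
    ∃ a : Vec d, ∀ z ∈ K, 1 / 2 ≤ ‖z‖ → ‖z‖ ≤ 1 → 0 < inner ℝ a z := by
  set S : Set (Vec d) := {z | z ∈ K ∧ 1 / 2 ≤ ‖z‖ ∧ ‖z‖ ≤ 1} with hS
  rcases S.eq_empty_or_nonempty with hSe | ⟨z₀, hz₀⟩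
  · exact ⟨0, fun z hz h1 h2 => absurd (show z ∈ S from ⟨hz, h1, h2⟩) (by rw [hSe]; exact id)⟩
  have hScpt : IsCompact S := by
    refine (isCompact_closedBall (0 : Vec d) 1).of_isClosed_subset ?_ fun z hz => ?_
    · exact hKc.inter ((isClosed_le continuous_const continuous_norm).inter
        (isClosed_le continuous_norm continuous_const))
    · simpa using hz.2.2
  obtain ⟨T, hTS, hT⟩ := hScpt.elim_nhds_subcover (fun z => closedBall z (1 / 4))
    fun z _ => closedBall_mem_nhds z (by norm_num)
  have key : ∀ T : Finset (Vec d), (∀ z ∈ T, z ∈ S) → ∃ J : Set (Vec d), IsCompact J ∧ Convex ℝ J ∧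
      J.Nonempty ∧ J ⊆ K ∧ (0 : Vec d) ∉ J ∧ ∀ z ∈ T, K ∩ closedBall z (1 / 4) ⊆ J := by
    intro T
    induction T using Finset.induction_on with
    | empty =>
      intro _
      refine ⟨{z₀}, isCompact_singleton, convex_singleton _, singleton_nonempty _,
        singleton_subset_iff.2 hz₀.1, fun h => ?_, by simp⟩
      have h1 := hz₀.2.1
      rw [← mem_singleton_iff.1 h, norm_zero] at h1
      norm_num at h1
    | insert z T _ ih =>
      intro hzT
      obtain ⟨J, hJ, hJc, hJn, hJK, hJ0, hJT⟩ := ih fun w hw => hzT w (Finset.mem_insert_of_mem hw)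
      have hz := hzT z (Finset.mem_insert_self z T)
      have hAn : (K ∩ closedBall z (1 / 4)).Nonempty := ⟨z, hz.1, by simp⟩
      have hA0 : (0 : Vec d) ∉ K ∩ closedBall z (1 / 4) := by
        rintro ⟨-, h⟩
        rw [mem_closedBall, dist_zero_left] at h
        linarith [hz.2.1]
      refine ⟨convexJoin ℝ (K ∩ closedBall z (1 / 4)) J,
        ((isCompact_closedBall z _).inter_left hKc).convexJoin hJ,
        (hK.inter (convex_closedBall z _)).convexJoin hJc, ?_,
        convexJoin_subset inter_subset_left hJK hK, ?_, ?_⟩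
      · exact hAn.mono (subset_convexJoin_left hJn)
      · intro h
        obtain ⟨a, ha, b, hb, hab⟩ := mem_convexJoin.1 h
        rw [← insert_endpoints_openSegment] at hab
        rcases hab with hab | hab | hab
        · exact hA0 (hab ▸ ha)
        · exact hJ0 (hab ▸ hb)
        · have := (mem_extremePoints.1 h0).2 a ha.1 b (hJK hb) hab
          exact hA0 (this.1 ▸ ha)
      · intro w hw
        rcases Finset.mem_insert.1 hw with rfl | hw
        · exact subset_convexJoin_left hJn
        · exact (hJT w hw).trans (subset_convexJoin_right hAn)
  obtain ⟨J, hJ, hJc, -, -, hJ0, hJT⟩ := key T hTS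
  obtain ⟨f, u, hu, hf⟩ := geometric_hahn_banach_point_closed hJc hJ.isClosed hJ0
  rw [map_zero] at hu
  refine ⟨(InnerProductSpace.toDual ℝ (Vec d)).symm f, fun z hz h1 h2 => ?_⟩
  rw [InnerProductSpace.toDual_symm_apply]
  obtain ⟨w, hw, hzw⟩ := mem_iUnion₂.1 (hT (show z ∈ S from ⟨hz, h1, h2⟩))
  exact hu.trans (hf z (hJT w hw ⟨hz, hzw⟩))

theorem Chart.exists_out_euc (hX : IsEuclideanSpaceForm X d) (hd : 1 ≤ d) {K : Set X}
    (hKc : IsClosed K) (hK : GConvex K) {y : X} {H₀ : X → ℝ} {c₀ : ℝ} (hy : Supp .euc K y H₀ c₀)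
    (he : HasExtremePoint K) :
    ∃ x ∈ frontier K, ∃ c > 0, ∃ H, IsHS .euc H ∧ H x = 0 ∧ OutC .euc K x H c := by
  have hk : Geo.euc.k = 0 := rfl
  obtain ⟨C, -⟩ := exists_chart_euc hX
  obtain ⟨e, heK, he⟩ := he
  obtain ⟨C, hC⟩ := C.exists_at e
  have hne := C.n_zero hC
  obtain ⟨σ, hσ, hnσ, hσn⟩ := C.exists_n_eq (by rintro ⟨⟩)
  have hmem : ∀ {z₁ z₂ : X}, z₁ ∈ K → z₂ ∈ K → ∀ {α β : ℝ}, 0 < α → 0 < β → α + β = 1 →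
      Comb .euc α β z₁ z₂ (σ (α • C.n z₁ + β • C.n z₂)) := fun {z₁ z₂} _ _ {α β} hα hβ h =>
    C.comb_of (hnσ _) (by simp only [Chart.t, hk]; linarith)
  have hconv : Convex ℝ (σ ⁻¹' K) := by
    refine convex_iff_pairwise_pos.2 ?_
    rintro v hv w hw - α β hα hβ h
    have h1 := hmem (z₁ := σ v) (z₂ := σ w) hv hw hα hβ h
    rw [hnσ, hnσ] at h1
    exact hK.comb_mem C hd hα hβ h1 hv hw
  have hσ0 : σ 0 = e := by rw [← hne, hσn]
  have hext : (0 : Vec d) ∈ (σ ⁻¹' K).extremePoints ℝ := by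
    refine mem_extremePoints_iff_left.2 ⟨show σ 0 ∈ K by rwa [hσ0], ?_⟩
    rintro v hv w hw ⟨α, β, hα, hβ, h, h0⟩
    have h1 := hmem (z₁ := σ v) (z₂ := σ w) hv hw hα hβ h
    rw [hnσ, hnσ, h0, hσ0] at h1
    have hb := (C.uniqueBtwPt_of_comb hd hα hβ h1).1
    rcases he _ hv _ hw hb with h2 | h2
    · rw [← hnσ v, ← h2, hne]
    · have hw0 : w = 0 := by rw [← hnσ w, ← h2, hne]
      rw [hw0, smul_zero, add_zero] at h0
      exact (smul_eq_zero.1 h0).resolve_left hα.ne'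
  obtain ⟨a, ha⟩ := exists_pos_on_shell (hKc.preimage hσ) hconv hext
  have ha' : ∀ z ∈ K, 1 / 2 ≤ ‖C.n z‖ → ‖C.n z‖ ≤ 1 → 0 < inner ℝ a (C.n z) := fun z hz =>
    ha (C.n z) (show σ (C.n z) ∈ K by rwa [hσn])
  have hsn : ∀ z, C.s z = ‖C.n z‖ ^ 2 / 2 := fun z => by
    have := C.norm_n z
    rw [hk] at this; linarith
  have hcpt1 : IsCompact (K ∩ {z | ‖C.n z‖ ≤ 1}) := by
    refine (C.isCompact_qd_le e (1 / 2)).of_isClosed_subset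
      (hKc.inter (isClosed_le C.continuous_n.norm continuous_const)) fun z hz => ?_
    have h1 : ‖C.n z‖ ≤ 1 := hz.2
    change _ ≤ (1 / 2 : ℝ)
    rw [← C.s_eq_zero_iff hC, hsn]
    nlinarith [norm_nonneg (C.n z)]
  have hcpt2 : IsCompact (K ∩ {z | ‖C.n z‖ ≤ 1} ∩ {z | 1 / 2 ≤ ‖C.n z‖}) :=
    hcpt1.inter_right (isClosed_le continuous_const C.continuous_n.norm)
  obtain ⟨N, hN, hG⟩ : ∃ N : ℝ, 0 < N ∧ ∀ z ∈ K, 1 / 2 ≤ ‖C.n z‖ → ‖C.n z‖ ≤ 1 →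
      1 < N * inner ℝ a (C.n z) := by
    rcases (K ∩ {z | ‖C.n z‖ ≤ 1} ∩ {z | 1 / 2 ≤ ‖C.n z‖}).eq_empty_or_nonempty with h | h
    · exact ⟨1, one_pos, fun z hz h1 h2 => absurd (show z ∈ K ∩ {z | ‖C.n z‖ ≤ 1} ∩
        {z | 1 / 2 ≤ ‖C.n z‖} from ⟨⟨hz, h2⟩, h1⟩) (by rw [h]; exact id)⟩
    obtain ⟨m, ⟨⟨hmK, hm1⟩, hm2⟩, hmin⟩ := hcpt2.exists_isMinOn h
      ((continuous_const.inner C.continuous_n (𝕜 := ℝ) (f := fun _ => a)).continuousOn)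
    have hpos := ha' m hmK hm2 hm1
    refine ⟨2 / inner ℝ a (C.n m), by positivity, fun z hz h1 h2 => ?_⟩
    have h3 : inner ℝ a (C.n m) ≤ inner ℝ a (C.n z) := hmin ⟨⟨hz, h2⟩, h1⟩
    calc (1 : ℝ) < 2 / inner ℝ a (C.n m) * inner ℝ a (C.n m) := by
          rw [div_mul_cancel₀ _ hpos.ne']; norm_num
      _ ≤ _ := by gcongr
  have hcontF : Continuous fun z => inner ℝ (N • a) (C.n z) - C.s z :=
    (continuous_const.inner C.continuous_n).sub C.continuous_s
  obtain ⟨x, ⟨hxK, hx1⟩, hmin⟩ := hcpt1.exists_isMinOn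
    ⟨e, heK, show ‖C.n e‖ ≤ 1 by rw [hne, norm_zero]; exact zero_le_one⟩ hcontF.continuousOn
  replace hmin : ∀ z ∈ K, ‖C.n z‖ ≤ 1 →
      inner ℝ (N • a) (C.n x) - C.s x ≤ inner ℝ (N • a) (C.n z) - C.s z := fun z h1 h2 =>
    hmin ⟨h1, h2⟩
  set f₀ := C.s x - inner ℝ (N • a) (C.n x) with hf₀
  have hf0 : 0 ≤ f₀ := by
    have h1 := hmin e heK (by rw [hne, norm_zero]; exact zero_le_one)
    rw [hne, inner_zero_right, hC] at h1
    linarith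
  have hxs : ‖C.n x‖ < 1 / 2 := by
    by_contra! h
    have h1 := hG x hxK h hx1
    have h2 : C.s x ≤ 1 / 2 := by
      rw [hsn]
      have h3 : ‖C.n x‖ ≤ 1 := hx1
      nlinarith [norm_nonneg (C.n x)]
    rw [hf₀, real_inner_smul_left] at hf0
    linarith
  have hL : 0 < ‖N • a‖ ^ 2 + 2 * f₀ := by
    have hpos : 0 ≤ ‖N • a‖ ^ 2 := sq_nonneg _
    by_contra! h
    have h1 : f₀ = 0 := by linarith
    have h2 : ‖N • a‖ = 0 := by
      refine pow_eq_zero_iff two_ne_zero |>.1 (le_antisymm ?_ hpos); linarith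
    rw [norm_eq_zero] at h2
    have hsmall : ∀ z ∈ K, ‖C.n z‖ ≤ 1 → z = e := fun z hz hz1 => by
      have h3 := hmin z hz hz1
      rw [h2, inner_zero_left, inner_zero_left] at h3
      rw [h2, inner_zero_left] at hf₀
      have h4 := le_antisymm (show C.s z ≤ 0 by linarith) (C.s_nonneg z)
      rw [C.s_eq_zero_iff hC] at h4
      exact (C.qd_eq_zero.1 h4).symm
    have hye : y = e := by
      by_contra hye
      have hny : 0 < ‖C.n y‖ := norm_pos_iff.2 fun h => hye (by rw [← hσn y, h, hσ0])
      obtain ⟨α, hα0, hα⟩ : ∃ α : ℝ, 0 < α ∧ α < 1 ∧ α * ‖C.n y‖ ≤ 1 := by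
        refine ⟨min (1 / 2) (1 / ‖C.n y‖), by positivity, (min_le_left _ _).trans_lt (by norm_num), ?_⟩
        calc _ ≤ 1 / ‖C.n y‖ * ‖C.n y‖ := by gcongr; exact min_le_right _ _
          _ = 1 := by field_simp
      have h3 := hmem hy.mem heK hα0 (sub_pos.2 hα.1) (by ring)
      have h4 := hsmall _ (hK.comb_mem C hd hα0 (sub_pos.2 hα.1) h3 hy.mem heK) (by
        rw [hnσ, hne, smul_zero, add_zero, norm_smul, Real.norm_of_nonneg hα0.le]; exact hα.2)
      have h5 := congrArg C.n h4
      rw [hnσ, hne, smul_zero, add_zero, smul_eq_zero] at h5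
      rcases h5 with h5 | h5
      · exact hα0.ne' h5
      · rw [h5, norm_zero] at hny; exact lt_irrefl _ hny
    obtain ⟨⟨v, hv1, hv⟩, -⟩ := C.both_signs hy.isHS hy.zero c₀ (δ := 1 / 2) (by norm_num)
    have hvK := hy.inner v (by linarith)
    have hve : v = e := by
      refine hsmall v hvK ?_
      rw [hye, ← C.s_eq_zero_iff hC, hsn] at hv1
      nlinarith [norm_nonneg (C.n v)]
    rw [hve, ← hye, hy.zero, qd_self] at hv
    simp at hv
  obtain ⟨H, hH, h0, ho⟩ := C.touch_out (f₀ := f₀) (Λ := √(‖N • a‖ ^ 2 + 2 * f₀)) (G := N • a)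
    (L := K) (z₀ := x) (Real.sqrt_pos.2 hL) (by rw [Real.sq_sqrt hL.le, hk]; ring) (by rw [hf₀]; ring)
    (U := {z | ‖C.n z‖ < 1 / 2})
    ((isOpen_lt C.continuous_n.norm continuous_const).mem_nhds hxs) (fun z hz hzU => by
      have h1 := hmin z hz (le_of_lt (lt_trans hzU (by norm_num)))
      linarith)
  exact ⟨x, ho.mem_frontier C hH h0 hxK, _,
    div_pos (by rw [hk]; norm_num) (Real.sqrt_pos.2 hL), H, hH, h0, ho⟩

end

section
variable {g : Geo} {d : ℕ} {X : Type*} [MetricSpace X]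

theorem Chart.exists_rebase (C : Chart g d X) {H : X → ℝ} (hH : IsHS g H) {y w : X} (hy : H y = 0)
    {c : ℝ} (hw : H w - c * qd g y w = 0) :
    ∃ H', IsHS g H' ∧ H' w = 0 ∧ ∀ z, H z - c * qd g y z = H' z - c * qd g w z := by
  obtain ⟨G, hF, hG⟩ := C.expand hH hy c
  set f := H C.o - c * qd g y C.o
  obtain ⟨H', hH', h0, h⟩ := C.rebase (f₀ := f) (β := c + g.k * f) (G := G) (z₀ := w) one_pos
    (by linarith) (by rw [← hF]; exact hw)
  refine ⟨H', hH', h0, fun z => ?_⟩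
  rw [hF, h, one_mul, div_one, add_sub_cancel_right]

/-- `F` describes, near its boundary point `y`, the body `L` as a superlevel set. -/
def Model (g : Geo) (L : Set X) (c : ℝ) (y : X) (F : X → ℝ) : Prop :=
  ∃ H cs, Supp g L y H cs ∧ OutC g L y H c ∧ InC g L y H c ∧ F = fun z => H z - c * qd g y z

theorem Osculated.exists_model {L : Set X} {c : ℝ} (hO : Osculated g L c) {y : X}
    (hy : y ∈ frontier L) : ∃ F, Model g L c y F := by
  obtain ⟨H, cs, h1, h2, h3⟩ := hO y hy
  exact ⟨_, H, cs, h1, h2, h3, rfl⟩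

theorem Model.unique (C : Chart g d X) {L : Set X} {c : ℝ} {y : X} {F F' : X → ℝ}
    (h : Model g L c y F) (h' : Model g L c y F') : F = F' := by
  obtain ⟨H, cs, h1, -, -, rfl⟩ := h
  obtain ⟨H', cs', h1', -, -, rfl⟩ := h'
  rw [Supp.unique C h1 h1']

theorem Model.continuous (C : Chart g d X) {L : Set X} {c : ℝ} {y : X} {F : X → ℝ}
    (h : Model g L c y F) : Continuous F := by
  obtain ⟨H, cs, h1, -, -, rfl⟩ := h
  exact (h1.isHS.continuous C).sub (continuous_const.mul (continuous_qd y))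

theorem Model.zero {L : Set X} {c : ℝ} {y : X} {F : X → ℝ} (h : Model g L c y F) : F y = 0 := by
  obtain ⟨H, cs, h1, -, -, rfl⟩ := h
  simp [h1.zero, qd_self]

theorem Model.both_signs (C : Chart g d X) {L : Set X} {c : ℝ} {y : X} {F : X → ℝ}
    (h : Model g L c y F) {z : X} (hz : F z = 0) {U : Set X} (hU : U ∈ nhds z) :
    (∃ w ∈ U, 0 < F w) ∧ ∃ w ∈ U, F w < 0 := by
  obtain ⟨H, cs, h1, -, -, rfl⟩ := h
  obtain ⟨H', hH', h0, hF⟩ := C.exists_rebase h1.isHS h1.zero hz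
  obtain ⟨δ, hδ, hb⟩ := C.mem_nhds_iff.1 hU
  obtain ⟨⟨w, hw, hw'⟩, w', hv, hv'⟩ := C.both_signs hH' h0 c hδ
  exact ⟨⟨w, hb w hw, by simpa only [hF] using hw'⟩, w', hb w' hv, by simpa only [hF] using hv'⟩

theorem Model.eventually (C : Chart g d X) {L : Set X} (hLc : IsClosed L) {c : ℝ}
    (hO : Osculated g L c) {y : X} {F : X → ℝ} (h : Model g L c y F) :
    ∃ U ∈ nhds y, IsOpen U ∧ ∀ z ∈ U, (z ∈ L ↔ 0 ≤ F z) ∧ (z ∈ frontier L ↔ F z = 0) ∧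
      (z ∈ frontier L → Model g L c z F) := by
  have hcont := h.continuous C
  have hbs := fun z hz (U : Set X) (hU : U ∈ nhds z) => h.both_signs C (z := z) hz hU
  obtain ⟨H, cs, h1, ⟨δ, hδ, hout⟩, ⟨δ', hδ', hin⟩, hF⟩ := h
  have hUo : IsOpen {z | qd g y z < min δ δ'} := isOpen_lt (continuous_qd y) continuous_const
  have hpos : ∀ z, qd g y z < min δ δ' → 0 < F z → z ∈ L := fun z hz hz' =>
    hin z (hz.trans_le (min_le_right _ _)) (by rw [hF] at hz'; linarith)
  have hL : ∀ z, qd g y z < min δ δ' → (z ∈ L ↔ 0 ≤ F z) := by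
    refine fun z hz => ⟨fun hzL => ?_, fun h0 => ?_⟩
    · rw [hF]; exact sub_nonneg.2 (hout z hzL (hz.trans_le (min_le_left _ _)))
    · rcases h0.eq_or_lt with h0 | h0
      · rw [← hLc.closure_eq, mem_closure_iff_nhds]
        intro V hV
        obtain ⟨⟨w, ⟨hw, hw'⟩, hw''⟩, -⟩ := hbs z h0.symm _ (inter_mem hV (hUo.mem_nhds hz))
        exact ⟨w, hw, hpos w hw' hw''⟩
      · exact hpos z hz h0
  have hfr : ∀ z, qd g y z < min δ δ' → (z ∈ frontier L ↔ F z = 0) := by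
    refine fun z hz => ⟨fun hzf => ?_, fun h0 => ⟨subset_closure ((hL z hz).2 h0.ge), fun hi => ?_⟩⟩
    · refine le_antisymm ?_ ((hL z hz).1 (hLc.frontier_subset hzf))
      by_contra! h0
      refine hzf.2 (mem_interior_iff_mem_nhds.2 ?_)
      filter_upwards [hUo.mem_nhds hz, hcont.continuousAt.eventually_const_lt h0] with w hw hw'
      exact hpos w hw hw'
    · obtain ⟨-, w, ⟨hw, hw'⟩, hw''⟩ := hbs z h0 _ (inter_mem (isOpen_interior.mem_nhds hi)
        (hUo.mem_nhds hz))
      exact absurd ((hL w hw').1 (interior_subset hw)) (by linarith)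
  refine ⟨_, hUo.mem_nhds (by rw [Set.mem_ofPred_eq, qd_self]; exact lt_min hδ hδ'), hUo,
    fun z hz => ⟨hL z hz, hfr z hz, fun hzf => ?_⟩⟩
  have h0 := (hfr z hz).1 hzf
  rw [hF] at h0
  obtain ⟨H', hH', h0', hFH⟩ := C.exists_rebase h1.isHS h1.zero h0
  obtain ⟨H₂, cs₂, h2, h3, h4⟩ := hO z hzf
  have : H₂ = H' := by
    refine Supp.eq_of_outC C h2 hH' h0' (c' := c) ?_
    obtain ⟨η, hη, hb⟩ := C.mem_nhds_iff.1 (hUo.mem_nhds hz)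
    refine ⟨η, hη, fun w hwL hw => ?_⟩
    have h5 := (hL w (hb w hw)).1 hwL
    rw [hF] at h5
    have h6 := hFH w
    linarith
  exact ⟨H₂, cs₂, h2, h3, h4, by rw [hF, this]; exact funext hFH⟩

theorem Model.component (C : Chart g d X) {L : Set X} (hLc : IsClosed L) {c : ℝ}
    (hO : Osculated g L c) {y : X} {F : X → ℝ} (hy : y ∈ frontier L) (h : Model g L c y F)
    (hS : IsPreconnected {z | F z = 0}) :
    connectedComponentIn (frontier L) y = {z | F z = 0} ∧
      ∀ z, F z = 0 → z ∈ frontier L ∧ Model g L c z F := by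
  have hsub : ∀ z, F z = 0 → z ∈ frontier L ∧ Model g L c z F := by
    have := isPreconnected_iff_preconnectedSpace.1 hS
    set A : Set {z | F z = 0} := {z | z.1 ∈ frontier L ∧ Model g L c z.1 F} with hA
    have hAo : IsOpen A := by
      refine isOpen_iff_mem_nhds.2 fun z ⟨hz, hzm⟩ => ?_
      obtain ⟨U, hU, -, hUL⟩ := hzm.eventually C hLc hO
      filter_upwards [continuous_subtype_val.continuousAt.preimage_mem_nhds hU] with w hw
      have hw' := (hUL w.1 hw).2.1.2 w.2
      exact ⟨hw', (hUL w.1 hw).2.2 hw'⟩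
    have hAc : IsClosed A := by
      refine isClosed_iff_clusterPt.2 fun z hz => ?_
      have hzf : z.1 ∈ frontier L := by
        refine isClosed_frontier.closure_subset (mem_closure_iff_nhds.2 fun V hV => ?_)
        obtain ⟨w, hw, hw'⟩ := mem_closure_iff_nhds.1 (mem_closure_iff_clusterPt.2 hz) _
          (continuous_subtype_val.continuousAt.preimage_mem_nhds hV)
        exact ⟨w.1, hw, hw'.1⟩
      obtain ⟨F', hF'⟩ := hO.exists_model hzf
      obtain ⟨U, hU, -, hUL⟩ := hF'.eventually C hLc hO
      obtain ⟨w, hw, hw'⟩ := mem_closure_iff_nhds.1 (mem_closure_iff_clusterPt.2 hz) _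
        (continuous_subtype_val.continuousAt.preimage_mem_nhds hU)
      exact ⟨hzf, Eq.mp (congrArg (Model g L c z.1)
        (((hUL w.1 hw).2.2 hw'.1).unique C hw'.2)) hF'⟩
    have huniv := IsClopen.eq_univ ⟨hAc, hAo⟩ ⟨⟨y, h.zero⟩, hy, h⟩
    exact fun z hz => (huniv ▸ mem_univ (⟨z, hz⟩ : {z | F z = 0}) : (⟨z, hz⟩ : {z | F z = 0}) ∈ A)
  refine ⟨Subset.antisymm ?_ ?_, hsub⟩
  · have hT := isPreconnected_iff_preconnectedSpace.1
      (isPreconnected_connectedComponentIn (F := frontier L) (x := y))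
    have hTf := connectedComponentIn_subset (frontier L) y
    set T := connectedComponentIn (frontier L) y with hTdef
    choose F' hF' using fun z : T => hO.exists_model (hTf z.2)
    have hlc : IsLocallyConstant F' := by
      refine (IsLocallyConstant.iff_eventually_eq F').2 fun z => ?_
      obtain ⟨U, hU, -, hUL⟩ := (hF' z).eventually C hLc hO
      filter_upwards [continuous_subtype_val.continuousAt.preimage_mem_nhds hU] with w hw
      exact (hF' w).unique C ((hUL w.1 hw).2.2 (hTf w.2))
    intro z hz
    have h1 := hlc.apply_eq_of_preconnectedSpace ⟨z, hz⟩ ⟨y, mem_connectedComponentIn hy⟩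
    have h2 := (hF' ⟨z, hz⟩).zero
    rw [h1, (hF' ⟨y, mem_connectedComponentIn hy⟩).unique C h] at h2
    exact h2
  · exact hS.subset_connectedComponentIn h.zero fun z hz => (hsub z hz).1

end

section
variable {g : Geo} {d : ℕ} {X : Type*} [MetricSpace X]

theorem _root_.IsPreconnected.inter_frontier {Y : Type*} [TopologicalSpace Y] {I S : Set Y}
    (hI : IsPreconnected I) {x y : Y} (hx : x ∈ I) (hxS : x ∈ S) (hy : y ∈ I) (hyS : y ∉ S) :
    (I ∩ frontier S).Nonempty := by
  rw [frontier_eq_closure_inter_closure]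
  refine isPreconnected_closed_iff.1 hI _ _ isClosed_closure isClosed_closure (fun z _ => ?_)
    ⟨x, hx, subset_closure hxS⟩ ⟨y, hy, subset_closure hyS⟩
  by_cases hz : z ∈ S
  · exact Or.inl (subset_closure hz)
  · exact Or.inr (subset_closure hz)

namespace Chart
variable (C : Chart g d X)

theorem exists_crossing {S : Set X} (ho : C.o ∉ S) {u : X} (hn : C.n u ≠ 0) (hu : u ∈ S) :
    ∃ v ∈ frontier S, v = u ∨ v = C.o ∨ ∃ α > 0, ∃ β > 0, Comb g α β C.o u v := by
  obtain ⟨e, r, he, hr, -, -, hrπ, hS, hn, hs⟩ := C.exists_polar u hn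
  have hI := (isPreconnected_Icc (a := (0 : ℝ)) (b := r)).image _ (C.continuous_polar he).continuousOn
  have hur : C.polar e he r = u := C.ext_pt (by rw [hn, n_polar]) (by rw [hs, s_polar])
  obtain ⟨v, ⟨r', hr', rfl⟩, hv⟩ := hI.inter_frontier (x := u) (y := C.o) (S := S)
    ⟨r, right_mem_Icc.2 hr.le, hur⟩ hu
    ⟨0, left_mem_Icc.2 hr.le, C.polar_zero he⟩ ho
  refine ⟨_, hv, ?_⟩
  rcases hr'.1.eq_or_lt with rfl | h0
  · exact Or.inr (Or.inl (C.polar_zero he))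
  rcases hr'.2.eq_or_lt with rfl | h1
  · exact Or.inl hur
  refine Or.inr (Or.inr ⟨_, div_pos (g.Sn_pos (sub_pos.2 h1) fun h => ?_) hS, _,
    div_pos (g.Sn_pos h0 fun h => h1.trans (hrπ h)) hS, C.comb_polar he hS.ne' hn hs⟩)
  linarith [hrπ h]

theorem eq_of_n_eq_zero {y u : X} (hy : C.n y = 0) (hu : C.n u = 0) (hyo : y ≠ C.o)
    (huo : u ≠ C.o) : u = y := by
  have key : ∀ w, C.n w = 0 → w ≠ C.o → C.s w ≠ 0 ∧ g.k * C.s w = 2 := fun w hw hwo => by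
    have h1 : C.s w ≠ 0 := fun h => hwo (C.eq_o h).symm
    have h2 := C.norm_n w
    rw [hw, norm_zero] at h2
    exact ⟨h1, mul_left_cancel₀ h1 (by linarith)⟩
  refine C.ext_pt (by rw [hu, hy]) ?_
  have h1 := (key y hy hyo).2
  have h2 := (key u hu huo).2
  have hk : g.k ≠ 0 := fun h => by rw [h, zero_mul] at h1; norm_num at h1
  exact mul_left_cancel₀ hk (h2.trans h1.symm)

end Chart

theorem Model.exists_pos_near (C : Chart g d X) {L : Set X} {c : ℝ} {y : X} {F : X → ℝ}
    (h : Model g L c y F) (ho : F C.o ≠ 0) {V : Set X} (hV : V ∈ nhds y) :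
    ∃ u ∈ V, 0 < F u ∧ (C.n u ≠ 0 ∨ u = C.o) := by
  by_cases hy : C.n y = 0
  · obtain ⟨⟨u, huV, hu⟩, -⟩ := h.both_signs C h.zero hV
    refine ⟨u, huV, hu, ?_⟩
    by_contra! hcon
    have := C.eq_of_n_eq_zero hy hcon.1 (fun h' => ho (h' ▸ h.zero)) hcon.2
    rw [this, h.zero] at hu
    exact lt_irrefl _ hu
  · obtain ⟨⟨u, ⟨huV, hun⟩, hu⟩, -⟩ := h.both_signs C h.zero
      (inter_mem hV ((isOpen_ne_fun C.continuous_n continuous_const).mem_nhds hy))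
    exact ⟨u, huV, hu, Or.inl hun⟩

theorem Model.not_comb {L : Set X} {c : ℝ} {v : X} {F : X → ℝ} (hc : 0 < c)
    (h : Model g L c v F) {α β : ℝ} (hα : 0 < α) (hβ : 0 < β) {a u : X} (hu : 0 < F u)
    (ha : a ∈ L ∨ 0 < F a) (hcomb : Comb g α β a u v) : False := by
  obtain ⟨H, cs, h1, -, -, rfl⟩ := h
  have h2 := hcomb H h1.isHS
  have hHu : 0 < H u := by
    have := mul_nonneg hc.le (qd_nonneg v u (g := g))
    simp only at hu; linarith
  have hHa : 0 ≤ H a := by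
    rcases ha with ha | ha
    · exact h1.nonneg a ha
    · have := mul_nonneg hc.le (qd_nonneg v a (g := g))
      simp only at ha; linarith
  rw [h1.zero] at h2
  have := mul_pos hβ hHu
  have := mul_nonneg hα.le hHa
  linarith

/-- A sphere of sufficiently large curvature meets every open half-space bounded by a hyperplane
through a point inside it. -/
theorem Chart.exists_zero_neg (C : Chart g d X) (hd : 2 ≤ d) {c f₀ : ℝ} (hc : 0 < c)
    (hf : 0 < f₀) (hhyp : g = .hyp → 1 ≤ c ∧ f₀ < c) {G : Vec d}
    (hG : ‖G‖ ^ 2 + 2 * c * f₀ + g.k * f₀ ^ 2 = 1) {a : Vec d} (ha : ‖a‖ = 1) :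
    ∃ z, f₀ - (c + g.k * f₀) * C.s z + inner ℝ G (C.n z) = 0 ∧ inner ℝ a (C.n z) < 0 := by
  suffices h : ∃ u, ∃ hu : ‖u‖ = 1, inner ℝ a u < 0 ∧ ∃ r > 0, (g = .sph → r ≤ Real.pi) ∧
      f₀ - (c + g.k * f₀) * g.ps r + g.Sn r * inner ℝ G u < 0 by
    obtain ⟨u, hu, hau, r, hr, hrπ, hneg⟩ := h
    have hcont : ContinuousOn (fun r => f₀ - (c + g.k * f₀) * g.ps r + g.Sn r * inner ℝ G u)
        (Icc 0 r) := by
      have := g.continuous_ps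
      have := g.continuous_Sn
      fun_prop
    obtain ⟨r', ⟨h0, h1⟩, h2⟩ := intermediate_value_Ioo' hr.le hcont ⟨hneg, by simpa using hf⟩
    refine ⟨C.polar u hu r', by rw [C.s_polar, C.n_polar, inner_smul_right]; exact h2, ?_⟩
    rw [C.n_polar, inner_smul_right]
    exact mul_neg_of_pos_of_neg (g.Sn_pos h0 fun h => h1.trans_le (hrπ h)) hau
  have hna : inner ℝ a (-a) < 0 := by
    rw [inner_neg_right, real_inner_self_eq_norm_sq, ha]; norm_num
  have hna1 : ‖-a‖ = 1 := by rw [norm_neg, ha]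
  cases g with
  | sph =>
    refine ⟨-a, hna1, hna, Real.pi, Real.pi_pos, fun _ => le_rfl, ?_⟩
    change f₀ - (c + 1 * f₀) * (1 - Real.cos Real.pi) + Real.sin Real.pi * _ < 0
    rw [Real.cos_pi, Real.sin_pi]
    linarith
  | euc =>
    set m := |inner ℝ G (-a)| with hm
    have hm0 : 0 ≤ m := abs_nonneg _
    have hx : 0 < 2 * (f₀ + m) / c := by positivity
    refine ⟨-a, hna1, hna, 1 + 2 * (f₀ + m) / c, by positivity, fun h => (by cases h), ?_⟩
    set r := 1 + 2 * (f₀ + m) / c with hr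
    change f₀ - (c + 0 * f₀) * (r ^ 2 / 2) + r * inner ℝ G (-a) < 0
    have h1 : inner ℝ G (-a) ≤ m := le_abs_self _
    have h2 : c * (r - 1) = 2 * (f₀ + m) := by rw [hr]; field_simp; ring
    have h3 : 1 < r := by linarith
    nlinarith [mul_le_mul_of_nonneg_left h1 (show 0 ≤ r by linarith)]
  | hyp =>
    obtain ⟨hc1, hfc⟩ := hhyp rfl
    rw [show Geo.hyp.k = -1 from rfl] at hG ⊢
    set β := c + -1 * f₀ with hβ
    have hβ0 : 0 < β := by linarith
    have hGβ : ‖G‖ ^ 2 ≤ β ^ 2 := by rw [hβ]; nlinarith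
    suffices h : ∃ u : Vec d, ‖u‖ = 1 ∧ inner ℝ a u < 0 ∧ inner ℝ G u < β by
      obtain ⟨u, hu, hau, hGu⟩ := h
      have hD : 0 < β - inner ℝ G u := sub_pos.2 hGu
      set r := (f₀ + β) / (β - inner ℝ G u) + 1 with hr
      have hr0 : 0 < r := by positivity
      refine ⟨u, hu, hau, r, hr0, fun h => (by cases h), ?_⟩
      change f₀ - β * (Real.cosh r - 1) + Real.sinh r * inner ℝ G u < 0
      have h1 : r ≤ Real.sinh r := Real.self_le_sinh_iff.2 hr0.le
      have h2 : Real.sinh r < Real.cosh r := Real.sinh_lt_cosh r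
      have h3 : (β - inner ℝ G u) * r = f₀ + β + (β - inner ℝ G u) := by rw [hr]; field_simp
      nlinarith [mul_le_mul_of_nonneg_left h1 hD.le, mul_lt_mul_of_pos_left h2 hβ0]
    by_cases h1 : inner ℝ G (-a) < β
    · exact ⟨-a, hna1, hna, h1⟩
    push Not at h1
    rw [inner_neg_right] at h1
    have h2 : ‖G + β • a‖ ^ 2 ≤ 0 := by
      rw [norm_add_sq_real, inner_smul_right, norm_smul, ha, mul_one, Real.norm_of_nonneg hβ0.le]
      nlinarith
    have h3 : G = -(β • a) := eq_neg_of_add_eq_zero_left (norm_eq_zero.1 (by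
      nlinarith [norm_nonneg (G + β • a)]))
    obtain ⟨w, hw, hwa⟩ := exists_unit_orth_one hd a
    have haw : inner ℝ a w = 0 := by rw [real_inner_comm]; exact hwa
    have h4 : inner ℝ a (-((3 / 5 : ℝ) • a) + (4 / 5 : ℝ) • w) = -(3 / 5) := by
      rw [inner_add_right, inner_neg_right, inner_smul_right, inner_smul_right, haw,
        real_inner_self_eq_norm_sq, ha]; norm_num
    refine ⟨-((3 / 5 : ℝ) • a) + (4 / 5 : ℝ) • w, ?_, by rw [h4]; norm_num, ?_⟩
    · rw [← sq_eq_sq₀ (norm_nonneg _) zero_le_one, norm_add_sq_real, norm_neg, norm_smul, norm_smul,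
        ha, hw, inner_neg_left, inner_smul_left, inner_smul_right, haw]
      norm_num
    · rw [h3, inner_neg_left, inner_smul_left, h4, RCLike.conj_to_real]; linarith

theorem Model.eq_superlevel (C : Chart g d X) (hd : 2 ≤ d) {L : Set X} (hLc : IsClosed L) {c : ℝ}
    (hc : 0 < c) (hhyp : g = .hyp → 1 ≤ c) (hO : Osculated g L c) {y : X} {F : X → ℝ}
    (hy : y ∈ frontier L) (h : Model g L c y F) (hS : IsPreconnected {z | F z = 0}) :
    L = {z | 0 ≤ F z} := by
  have hcomp := (h.component C hLc hO hy hS).2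
  have hcont := h.continuous C
  obtain ⟨U, hU, -, hUL⟩ := h.eventually C hLc hO
  have hLF : ∀ a ∈ L, 0 ≤ F a := by
    intro a haL
    by_contra! ha
    obtain ⟨C, hC⟩ := C.exists_at a
    have hoa := C.eq_o hC
    obtain ⟨u, huU, hu, hn | hn⟩ := h.exists_pos_near C (by rw [hoa]; exact ha.ne) hU
    · obtain ⟨v, hv, hvu | hvo | ⟨α, hα, β, hβ, hcomb⟩⟩ := C.exists_crossing (S := {z | 0 ≤ F z})
        (by rw [hoa]; exact not_le.2 ha) hn (show 0 ≤ F u from hu.le)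
      · have : 0 = F v := frontier_le_subset_eq continuous_const hcont hv
        rw [hvu] at this; linarith
      · have : 0 = F v := frontier_le_subset_eq continuous_const hcont hv
        rw [hvo, hoa] at this; linarith
      · have h0 : 0 = F v := frontier_le_subset_eq continuous_const hcont hv
        rw [hoa] at hcomb
        exact (hcomp v h0.symm).2.not_comb hc hα hβ hu (Or.inl haL) hcomb
    · rw [hn, hoa] at hu; linarith
  refine Subset.antisymm hLF fun b hb => ?_
  replace hb : 0 ≤ F b := hb
  by_contra hbL
  rcases hb.eq_or_lt with hb | hb
  · exact hbL (hLc.frontier_subset (hcomp b hb.symm).1)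
  obtain ⟨v, hv, hFv⟩ : ∃ v ∈ frontier L, 0 < F v := by
    obtain ⟨C, hC⟩ := C.exists_at b
    have hoa := C.eq_o hC
    obtain ⟨u, huU, hu, hn | hn⟩ := h.exists_pos_near C (by rw [hoa]; exact hb.ne') hU
    · have huL := (hUL u huU).1.2 hu.le
      obtain ⟨v, hv, hvu | hvo | ⟨α, hα, β, hβ, hcomb⟩⟩ := C.exists_crossing (S := L)
        (by rwa [hoa]) hn huL
      · exact ⟨u, hvu ▸ hv, hu⟩
      · refine absurd (hLc.frontier_subset hv) ?_
        rwa [hvo, hoa]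
      · refine ⟨v, hv, (hLF v (hLc.frontier_subset hv)).lt_of_ne fun h0 => ?_⟩
        rw [hoa] at hcomb
        exact (hcomp v h0.symm).2.not_comb hc hα hβ hu (Or.inr hb) hcomb
    · refine absurd ((hUL u huU).1.2 hu.le) ?_
      rwa [hn, hoa]
  obtain ⟨Hv, cs, hHv, -⟩ := hO v hv
  obtain ⟨C, hC⟩ := C.exists_at v
  have hoa := C.eq_o hC
  obtain ⟨a, ha, hHa⟩ := C.isHS_zero hC hHv.isHS hHv.zero
  obtain ⟨H, cs', h1, -, -, hF⟩ := id h
  obtain ⟨G, hG, hG1⟩ := C.expand h1.isHS h1.zero c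
  have hF0 : H C.o - c * qd g y C.o = F v := by rw [hF, hoa]
  rw [hF0] at hG hG1
  have hFc : g = .hyp → F v < c := by
    intro hg
    have h2 := h1.isHS.sq_le C h1.zero v
    have hk : g.k = -1 := by rw [hg]; rfl
    have h3 := hhyp hg
    have hq := qd_nonneg y v (g := g)
    rw [hk] at h2
    rw [hF]
    by_contra! h4
    have h5 : 1 + qd g y v ≤ H v := by nlinarith
    nlinarith
  obtain ⟨z, hz, hz'⟩ := C.exists_zero_neg hd hc hFv (fun hg => ⟨hhyp hg, hFc hg⟩) hG1 ha
  have hzF : F z = 0 := by rw [← hz, ← hG, hF]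
  have := hHv.nonneg z (hLc.frontier_subset (hcomp z hzF).1)
  rw [hHa] at this
  linarith

end

section
variable {g : Geo} {d : ℕ} {X : Type*} [MetricSpace X]

theorem Model.frontier_superlevel (C : Chart g d X) {L : Set X} {c : ℝ} {y : X} {F : X → ℝ}
    (h : Model g L c y F) : frontier {z | 0 ≤ F z} = {z | F z = 0} := by
  refine Subset.antisymm (fun z hz => ?_) fun z hz => ⟨subset_closure (le_of_eq (Eq.symm hz)), ?_⟩
  · exact (frontier_le_subset_eq continuous_const (h.continuous C) hz : 0 = F z).symm
  · intro hi
    obtain ⟨-, w, hw, hw'⟩ := h.both_signs C hz (isOpen_interior.mem_nhds hi)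
    have h1 : w ∈ {z | 0 ≤ F z} := interior_subset hw
    exact absurd (show 0 ≤ F w from h1) (by linarith)

theorem Model.exists_chart (C : Chart g d X) {L : Set X} {c : ℝ} {y : X} {F : X → ℝ}
    (h : Model g L c y F) : ∃ C' : Chart g d X, ∃ a, ‖a‖ = 1 ∧
      ∀ z, F z = inner ℝ a (C'.n z) - c * C'.s z := by
  obtain ⟨C, hC⟩ := C.exists_at y
  obtain ⟨H, cs, h1, -, -, rfl⟩ := h
  obtain ⟨a, ha, hHa⟩ := C.isHS_zero hC h1.isHS h1.zero
  exact ⟨C, a, ha, fun z => by simp only; rw [hHa, C.s_eq_zero_iff hC]⟩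

theorem Geo.exists_radius {c : ℝ} (hc : 0 < c) (hg : g = .hyp → 1 < c) :
    ∃ R, 0 < R ∧ (g = .sph → R ≤ Real.pi / 2) ∧ g.Co R = c * g.Sn R := by
  cases g with
  | sph =>
    have hc' : 0 < c⁻¹ := inv_pos.2 hc
    refine ⟨Real.arctan c⁻¹, Real.arctan_pos.2 hc', fun _ => (Real.arctan_lt_pi_div_two _).le, ?_⟩
    change Real.cos _ = c * Real.sin _
    rw [← Real.tan_mul_cos (Real.cos_arctan_pos _).ne', Real.tan_arctan]
    field_simp
  | euc =>
    refine ⟨c⁻¹, inv_pos.2 hc, fun h => (by cases h), ?_⟩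
    change (1 : ℝ) = c * c⁻¹
    field_simp
  | hyp =>
    have h1 := hg rfl
    have h2 : 0 < c ^ 2 - 1 := by nlinarith
    have h3 : 0 < √(c ^ 2 - 1) := Real.sqrt_pos.2 h2
    refine ⟨Real.arsinh (√(c ^ 2 - 1))⁻¹, Real.arsinh_pos_iff.2 (inv_pos.2 h3),
      fun h => (by cases h), ?_⟩
    change Real.cosh _ = c * Real.sinh _
    rw [Real.cosh_arsinh, Real.sinh_arsinh, inv_pow, Real.sq_sqrt h2.le,
      show 1 + (c ^ 2 - 1)⁻¹ = (c / √(c ^ 2 - 1)) ^ 2 by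
        rw [div_pow, Real.sq_sqrt h2.le]; field_simp; ring,
      Real.sqrt_sq (by positivity), div_eq_mul_inv]

theorem Model.eq_ball (C : Chart g d X) {L : Set X} {c : ℝ} {y : X} {F : X → ℝ}
    (h : Model g L c y F) {R : ℝ} (hR : 0 < R) (hRπ : g = .sph → R ≤ Real.pi / 2)
    (hRc : g.Co R = c * g.Sn R) :
    ∃ p, {z | 0 ≤ F z} = closedBall p R ∧ {z | F z = 0} = sphere p R := by
  obtain ⟨C, a, ha, hF⟩ := h.exists_chart C
  have hv : g.Val R := ⟨hR.le, fun h => (hRπ h).trans (by linarith [Real.pi_pos])⟩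
  have hS : 0 < g.Sn R := g.Sn_pos hR fun h => (hRπ h).trans_lt (by linarith [Real.pi_pos])
  have hq : ∀ z, qd g (C.polar a ha R) z = g.ps R - g.Sn R * F z := fun z => by
    rw [C.qd_eq, C.s_polar, C.n_polar, inner_smul_left, hF, RCLike.conj_to_real]
    linear_combination (-(C.s z)) * g.Co_eq R + C.s z * hRc
  refine ⟨C.polar a ha R, ?_, ?_⟩
  · rw [C.closedBall_eq _ hv]
    ext z
    change 0 ≤ F z ↔ qd g _ z ≤ _
    rw [hq, sub_le_self_iff, mul_nonneg_iff_of_pos_left hS]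
  · rw [C.sphere_eq _ hv]
    ext z
    change F z = 0 ↔ qd g _ z = _
    rw [hq, sub_eq_self, mul_eq_zero, or_iff_right hS.ne']

theorem Chart.isPreconnected_sphere (C : Chart g d X) (hd : 2 ≤ d) (p : X) {R : ℝ} (hR : 0 < R)
    (hRπ : g = .sph → R < Real.pi) : IsPreconnected (sphere p R) := by
  obtain ⟨C, hC⟩ := C.exists_at p
  have hv : g.Val R := ⟨hR.le, fun h => (hRπ h).le⟩
  have hconn := isPreconnected_iff_preconnectedSpace.1 (_root_.isPreconnected_sphere
    (E := Vec d) (by rw [← Module.finrank_eq_rank, finrank_euclideanSpace, Fintype.card_fin]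
                     exact_mod_cast (show 1 < d by omega)) 0 1)
  have hcont : Continuous fun u : sphere (0 : Vec d) 1 =>
      C.polar u.1 (mem_sphere_zero_iff_norm.1 u.2) R := by
    refine C.continuous_of ?_ ?_
    · simp_rw [n_polar]; fun_prop
    · simp_rw [s_polar]; fun_prop
  convert isPreconnected_range hcont
  rw [C.sphere_eq p hv]
  ext z
  change qd g p z = _ ↔ _
  rw [← C.s_eq_zero_iff hC]
  constructor
  · intro h
    obtain ⟨u, hu, rfl⟩ := C.exists_eq_polar h (g.Sn_pos hR hRπ)
    exact ⟨⟨u, mem_sphere_zero_iff_norm.2 hu⟩, rfl⟩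
  · rintro ⟨u, rfl⟩
    rw [s_polar]

end

section
variable {g : Geo} {d : ℕ} {X : Type*} [MetricSpace X]

theorem Chart.dist_polar_polar (C : Chart .hyp d X) {a : Vec d} (ha : ‖a‖ = 1) (t r : ℝ) :
    dist (C.polar a ha t) (C.polar a ha r) = |t - r| := by
  have h := C.qd_polar_polar ha t r
  refine Geo.ps_inj .hyp (C.val _ _) ⟨abs_nonneg _, fun h => (by cases h)⟩ ?_
  rw [← qd, h]
  change Real.cosh _ - 1 = Real.cosh _ - 1
  rw [Real.cosh_abs]

theorem Chart.horo_pos (C : Chart .hyp d X) {a : Vec d} (ha : ‖a‖ = 1) (z : X) :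
    0 < 1 + C.s z - inner ℝ a (C.n z) := by
  have h1 := C.norm_n z
  have h2 := real_inner_le_norm a (C.n z)
  have h3 := C.s_nonneg z
  rw [ha, one_mul] at h2
  change _ = 2 * C.s z - (-1) * C.s z ^ 2 at h1
  nlinarith [norm_nonneg (C.n z)]

theorem Chart.tendsto_dist_polar (C : Chart .hyp d X) {a : Vec d} (ha : ‖a‖ = 1) (z : X) :
    Tendsto (fun t => dist z (C.polar a ha t) - t) atTop
      (nhds (Real.log (1 + C.s z - inner ℝ a (C.n z)))) := by
  set m := inner ℝ a (C.n z) with hm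
  have hw := C.horo_pos ha z
  rw [← hm] at hw
  have hq : ∀ t, Real.cosh (dist z (C.polar a ha t)) =
      (1 + C.s z) * Real.cosh t - m * Real.sinh t := fun t => by
    have h := C.qd_eq z (C.polar a ha t)
    rw [C.s_polar, C.n_polar, inner_smul_right, real_inner_comm, ← hm] at h
    change Real.cosh _ - 1 = C.s z + (Real.cosh t - 1) - (-1) * C.s z * (Real.cosh t - 1)
      - Real.sinh t * m at h
    linarith
  have he : ∀ t, Real.exp (dist z (C.polar a ha t) - t) =
      (1 + C.s z) * (1 + Real.exp (-t) * Real.exp (-t)) - m * (1 - Real.exp (-t) * Real.exp (-t))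
        - Real.exp (-dist z (C.polar a ha t)) * Real.exp (-t) := fun t => by
    have h := hq t
    have h1 : Real.exp t * Real.exp (-t) = 1 := by rw [← Real.exp_add]; simp
    rw [Real.cosh_eq, Real.cosh_eq, Real.sinh_eq] at h
    rw [sub_eq_add_neg, Real.exp_add]
    linear_combination (2 * Real.exp (-t)) * h + (1 + C.s z - m) * h1
  have h0 : Tendsto (fun t : ℝ => Real.exp (-t)) atTop (nhds 0) := Real.tendsto_exp_neg_atTop_nhds_zero
  have h1 : Tendsto (fun t : ℝ => Real.exp (-dist z (C.polar a ha t)) * Real.exp (-t)) atTop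
      (nhds 0) := by
    refine squeeze_zero (fun t => by positivity) (fun t => ?_) h0
    exact mul_le_of_le_one_left (Real.exp_pos _).le
      (Real.exp_le_one_iff.2 (neg_nonpos.2 dist_nonneg))
  have h2 : Tendsto (fun t => Real.exp (dist z (C.polar a ha t) - t)) atTop
      (nhds (1 + C.s z - m)) := by
    simp_rw [he]
    have := (((h0.mul h0).const_add 1).const_mul (1 + C.s z)).sub
      (((h0.mul h0).const_sub 1).const_mul m) |>.sub h1
    simpa using this
  have h3 := h2.log hw.ne'
  simpa only [Real.log_exp] using h3

theorem Chart.isParaball (C : Chart .hyp d X) {a : Vec d} (ha : ‖a‖ = 1) :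
    IsParaball {z | 0 ≤ inner ℝ a (C.n z) - C.s z} := by
  refine ⟨C.polar a ha, Isometry.of_dist_eq fun t r => C.dist_polar_polar ha t r, ?_⟩
  ext z
  change 0 ≤ inner ℝ a (C.n z) - C.s z ↔ ∃ b ≤ 0, Tendsto _ _ _
  have hw := C.horo_pos ha z
  have h1 := C.tendsto_dist_polar ha z
  constructor
  · intro h
    exact ⟨_, Real.log_nonpos hw.le (by linarith), h1⟩
  · rintro ⟨b, hb, h2⟩
    rw [tendsto_nhds_unique h2 h1] at hb
    have := (Real.log_nonpos_iff hw.le).1 hb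
    linarith

theorem Chart.isPreconnected_parasphere (C : Chart .hyp d X) {a : Vec d} (ha : ‖a‖ = 1) :
    IsPreconnected {z | inner ℝ a (C.n z) - C.s z = 0} := by
  obtain ⟨σ, h1, h2, h3⟩ := C.exists_n_eq (by rintro ⟨⟩)
  have hS : Convex ℝ {v : Vec d | inner ℝ a v = 0} := by
    have h4 := convex_hyperplane (𝕜 := ℝ) (innerSL ℝ a).toLinearMap.isLinear (0 : ℝ)
    exact h4
  have haa : inner ℝ a a = 1 := by rw [real_inner_self_eq_norm_sq, ha]; norm_num
  have hns : ∀ z, ‖C.n z‖ ^ 2 = 2 * C.s z + C.s z ^ 2 := fun z => by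
    rw [C.norm_n]
    change 2 * C.s z - (-1) * C.s z ^ 2 = _
    ring
  have hc : Continuous fun v : Vec d => σ (v + (‖v‖ ^ 2 / 2) • a) := by fun_prop
  convert hS.isPreconnected.image _ hc.continuousOn
  ext z
  constructor
  · intro hz
    replace hz : inner ℝ a (C.n z) = C.s z := sub_eq_zero.1 hz
    refine ⟨C.n z - C.s z • a, ?_, ?_⟩
    · change inner ℝ a _ = 0
      rw [inner_sub_right, inner_smul_right, haa, hz]; ring
    · have h4 : ‖C.n z - C.s z • a‖ ^ 2 / 2 = C.s z := by
        rw [norm_sub_sq_real, hns, inner_smul_right, real_inner_comm, hz, norm_smul, ha, mul_one,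
          Real.norm_eq_abs, sq_abs]
        ring
      simp only
      rw [h4, sub_add_cancel, h3]
  · rintro ⟨v, hv, rfl⟩
    replace hv : inner ℝ a v = 0 := hv
    change inner ℝ a (C.n (σ _)) - C.s (σ _) = 0
    set z := σ (v + (‖v‖ ^ 2 / 2) • a) with hz
    have h4 : C.n z = v + (‖v‖ ^ 2 / 2) • a := h2 _
    have h5 := hns z
    have h6 := C.s_nonneg z
    rw [h4, norm_add_sq_real, inner_smul_right, real_inner_comm, hv, norm_smul, ha, mul_one,
      Real.norm_eq_abs, sq_abs] at h5
    rw [h4, inner_add_right, hv, inner_smul_right, haa]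
    have h7 : 0 ≤ ‖v‖ ^ 2 / 2 := by positivity
    have h8 : (‖v‖ ^ 2 / 2 - C.s z) * (2 + ‖v‖ ^ 2 / 2 + C.s z) = 0 := by linear_combination h5
    rcases mul_eq_zero.1 h8 with h | h
    · linarith
    · linarith

end

section
variable {g : Geo} {d : ℕ} {X : Type*} [MetricSpace X]

theorem UniqueBtwPt.fixed {τ : X ≃ᵢ X} {u v m : X} (hu : τ u = u) (hv : τ v = v)
    (h : UniqueBtwPt u m v) : τ m = m := by
  have h1 : dist u (τ m) = dist u m := by
    conv_lhs => rw [← hu]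
    exact τ.dist_eq u m
  have h2 : dist (τ m) v = dist m v := by
    conv_lhs => rw [← hv]
    exact τ.dist_eq m v
  refine h.2 _ ?_ h1
  have h3 := h.1
  unfold Btw at h3 ⊢
  rw [h1, h2, h3]

theorem Chart.exists_zero_chart (C : Chart g d X) (hd : 1 ≤ d) {W : X → ℝ} (hW : IsHS g W) :
    ∃ C' : Chart g d X, ∃ b, ‖b‖ = 1 ∧ ∀ z, W z = inner ℝ b (C'.n z) := by
  have := C.preconnectedSpace hd
  have hc := hW.continuous C
  obtain ⟨p, hp⟩ : ∃ p, W p = 0 := by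
    obtain ⟨a, e, h, rfl⟩ := (C.isHS_iff W).1 hW
    obtain ⟨z, hz⟩ := C.exists_hs_pos a e h
    obtain ⟨w, hw⟩ := C.exists_hs_neg a e h
    exact mem_range_of_exists_le_of_exists_ge hc ⟨w, hw.le⟩ ⟨z, hz.le⟩
  obtain ⟨C, hC⟩ := C.exists_at p
  obtain ⟨b, hb, h⟩ := C.isHS_zero hC hW hp
  exact ⟨C, b, hb, h⟩

theorem Chart.isHalfspace (C : Chart g d X) {W : X → ℝ} (hW : IsHS g W) :
    IsHalfspace {z | W z ≤ 0} := by
  have hc := hW.continuous C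
  obtain ⟨a, e, h, rfl⟩ := (C.isHS_iff W).1 hW
  have him : ⇑(C.sigma a e h) '' {z | C.hs a e z ≤ 0} = {z | 0 ≤ C.hs a e z} := by
    ext z
    constructor
    · rintro ⟨w, hw, rfl⟩
      change 0 ≤ C.hs a e _
      rw [C.hs_sigma]
      exact neg_nonneg.2 hw
    · intro hz
      refine ⟨C.sigma a e h z, ?_, C.sigma_sigma a e h z⟩
      change C.hs a e _ ≤ 0
      rw [C.hs_sigma]
      exact neg_nonpos.2 hz
  refine ⟨C.sigma a e h, C.isReflection_sigma a e h, isClosed_le hc continuous_const, ?_, ?_⟩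
  · rw [him]
    exact eq_univ_of_forall fun z => le_total (C.hs a e z) 0
  · rw [him]
    ext z
    change C.hs a e z ≤ 0 ∧ 0 ≤ C.hs a e z ↔ C.sigma a e h z = z
    rw [C.sigma_eq_iff, le_antisymm_iff]

theorem Chart.infDist_halfspace_le (C : Chart .hyp d X) {W : X → ℝ} (hW : IsHS .hyp W) {lam : ℝ}
    (hlam : 0 < lam) : {z | infDist z {w | W w ≤ 0} ≤ lam} = {z | W z ≤ Real.sinh lam} := by
  have hne : ({w | W w ≤ 0} : Set X).Nonempty := by
    obtain ⟨a, e, h, rfl⟩ := (C.isHS_iff W).1 hW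
    obtain ⟨w, hw⟩ := C.exists_hs_neg a e h
    exact ⟨w, hw.le⟩
  ext z
  change infDist z _ ≤ lam ↔ W z ≤ _
  constructor
  · intro h
    have h1 : Real.arsinh (W z) ≤ infDist z {w | W w ≤ 0} := by
      refine (le_infDist hne).2 fun w hw => ?_
      rw [← Real.sinh_le_sinh, Real.sinh_arsinh]
      exact C.hs_le_sinh hW hw z
    rw [← Real.sinh_arsinh (W z), Real.sinh_le_sinh]
    exact h1.trans h
  · intro h
    by_cases hz : W z ≤ 0
    · rw [infDist_zero_of_mem (show z ∈ {w | W w ≤ 0} from hz)]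
      exact hlam.le
    · obtain ⟨C, hC⟩ := C.exists_at z
      obtain ⟨b, e, hbe, rfl⟩ := (C.isHS_iff W).1 hW
      have he : C.hs b e z = e := by
        rw [Chart.hs, C.n_zero hC, C.t_zero hC, inner_zero_right, zero_add, mul_one]
      rw [he] at h hz
      push Not at hz
      replace hbe : ‖b‖ ^ 2 + (-1) * e ^ 2 = 1 := hbe
      have hb : 0 < ‖b‖ := by
        by_contra hb
        have : ‖b‖ = 0 := le_antisymm (not_lt.1 hb) (norm_nonneg _)
        rw [this] at hbe
        nlinarith
      have hu : ‖(-‖b‖⁻¹) • b‖ = 1 := by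
        rw [norm_smul, norm_neg, norm_inv, norm_norm, inv_mul_cancel₀ hb.ne']
      have hr : 0 < Real.arsinh e := Real.arsinh_pos_iff.2 hz
      have hch : Real.cosh (Real.arsinh e) = ‖b‖ := by
        rw [Real.cosh_arsinh, Real.sqrt_eq_iff_mul_self_eq (by positivity) hb.le]
        linarith
      have hf : C.polar _ hu (Real.arsinh e) ∈ {w | C.hs b e w ≤ 0} := by
        change C.hs b e _ ≤ 0
        rw [Chart.hs, C.n_polar, C.t_polar, inner_smul_right, inner_smul_right,
          real_inner_self_eq_norm_sq]
        change Real.sinh (Real.arsinh e) * _ + e * Real.cosh (Real.arsinh e) ≤ 0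
        rw [Real.sinh_arsinh, hch]
        apply le_of_eq
        field_simp
        ring
      have hdist : dist z (C.polar _ hu (Real.arsinh e)) = Real.arsinh e := by
        refine Geo.ps_inj .hyp (C.val _ _) ⟨hr.le, fun h => (by cases h)⟩ ?_
        rw [← qd, ← C.s_eq_zero_iff hC, C.s_polar]
      refine (infDist_le_dist_of_mem hf).trans ?_
      rw [hdist, ← Real.sinh_le_sinh, Real.sinh_arsinh]
      exact h

theorem Chart.not_isHyperplane (C : Chart .hyp d X) (hd : 2 ≤ d) {W : X → ℝ} (hW : IsHS .hyp W)
    {S : ℝ} (hS : 0 < S) : ¬ IsHyperplane {z | W z = S} := by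
  rintro ⟨τ, -, hτ⟩
  obtain ⟨C, b, hb, hWb⟩ := C.exists_zero_chart (by omega) hW
  obtain ⟨w, hw, hwb⟩ := exists_unit_orth_one hd b
  obtain ⟨σ, -, h2, -⟩ := C.exists_n_eq (by rintro ⟨⟩)
  have ht : ∀ z, 0 < C.t z := fun z => by
    have := C.s_nonneg z
    rw [C.t_def]
    change 0 < 1 - (-1) * C.s z
    linarith
  have htsq : ∀ z, C.t z ^ 2 = 1 + ‖C.n z‖ ^ 2 := fun z => by
    have h := C.t_sq z
    change C.t z ^ 2 + (-1) * _ = 1 at h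
    linarith
  have hbw : inner ℝ b w = 0 := by rw [real_inner_comm]; exact hwb
  have hbb : inner ℝ b b = 1 := by rw [real_inner_self_eq_norm_sq, hb]; norm_num
  set α : ℝ := 1 / (2 * √2) with hα
  have hα0 : 0 < α := by positivity
  have hα2 : 8 * α ^ 2 = 1 := by
    rw [hα, div_pow, mul_pow, Real.sq_sqrt (by norm_num)]; norm_num
  have hn : ∀ e : ℝ, e ^ 2 = 1 → ‖S • b + e • w‖ ^ 2 = S ^ 2 + 1 := fun e he => by
    rw [norm_add_sq_real, inner_smul_left, inner_smul_right, hbw, norm_smul, norm_smul, hb, hw,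
      mul_one, mul_one, Real.norm_eq_abs, Real.norm_eq_abs, sq_abs, sq_abs, he]
    simp
  have hfix : ∀ e : ℝ, τ (σ (S • b + e • w)) = σ (S • b + e • w) := fun e => by
    have : σ (S • b + e • w) ∈ {z | W z = S} := by
      change W _ = S
      rw [hWb, h2, inner_add_right, inner_smul_right, inner_smul_right, hbb, hbw]; ring
    rw [hτ] at this
    exact this
  set m := σ ((2 * α * S) • b) with hm
  have hcomb : Comb .hyp α α (σ (S • b + (1 : ℝ) • w)) (σ (S • b + (-1 : ℝ) • w)) m := by
    refine C.comb_of ?_ ?_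
    · rw [hm, h2, h2, h2]; module
    · have e1 : C.t (σ (S • b + (1 : ℝ) • w)) ^ 2 = S ^ 2 + 2 := by
        rw [htsq, h2, hn _ (by norm_num)]; ring
      have e2 : C.t (σ (S • b + (-1 : ℝ) • w)) ^ 2 = S ^ 2 + 2 := by
        rw [htsq, h2, hn _ (by norm_num)]; ring
      have e3 : C.t m ^ 2 = 1 + (2 * α * S) ^ 2 := by
        rw [htsq, hm, h2, norm_smul, hb, mul_one, Real.norm_eq_abs, sq_abs]
      have p1 := ht (σ (S • b + (1 : ℝ) • w))
      have p2 := ht (σ (S • b + (-1 : ℝ) • w))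
      have p3 := ht m
      have e4 := (pow_left_inj₀ p1.le p2.le two_ne_zero).1 (e1.trans e2.symm)
      rw [← e4]
      refine (pow_left_inj₀ p3.le (by positivity) two_ne_zero).1 ?_
      rw [e3]
      linear_combination (-4 * α ^ 2) * e1 - hα2
  have h3 := (C.uniqueBtwPt_of_comb (by omega) hα0 hα0 hcomb).fixed (hfix 1) (hfix (-1))
  have h4 : m ∈ {z | W z = S} := by rw [hτ]; exact h3
  replace h4 : W m = S := h4
  rw [hWb, hm, h2, inner_smul_right, hbb, mul_one] at h4
  have h5 : 2 * α = 1 := by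
    have : (2 * α - 1) * S = 0 := by linarith
    rcases mul_eq_zero.1 this with h | h <;> linarith
  nlinarith

theorem Chart.isPreconnected_hs_eq (C : Chart .hyp d X) (hd : 1 ≤ d) {W : X → ℝ}
    (hW : IsHS .hyp W) (S : ℝ) : IsPreconnected {z | W z = S} := by
  obtain ⟨C, b, hb, hWb⟩ := C.exists_zero_chart hd hW
  have hS : Convex ℝ {v : Vec d | inner ℝ b v = S} := by
    have h4 := convex_hyperplane (𝕜 := ℝ) (innerSL ℝ b).toLinearMap.isLinear S
    exact h4
  have := C.isPreconnected_of_convex (by rintro ⟨⟩) hS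
  simp_rw [hWb]
  exact this

theorem Model.exists_hs (C : Chart .hyp d X) {L : Set X} {c : ℝ} {y : X} {F : X → ℝ}
    (h : Model .hyp L c y F) (hc1 : c ^ 2 < 1) : ∃ W, IsHS .hyp W ∧
      ∀ z, F z = √(1 - c ^ 2) * (c / √(1 - c ^ 2) - W z) := by
  obtain ⟨C, a, ha, hF⟩ := h.exists_chart C
  set q := √(1 - c ^ 2) with hq
  have hq0 : 0 < q := Real.sqrt_pos.2 (by linarith)
  have hq2 : q ^ 2 = 1 - c ^ 2 := Real.sq_sqrt (by linarith)
  refine ⟨C.hs ((-q⁻¹) • a) (c / q), C.isHS_hs ?_, fun z => ?_⟩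
  · rw [norm_smul, ha, mul_one, Real.norm_eq_abs, sq_abs]
    change _ + (-1) * _ = _
    field_simp
    linarith
  · rw [hF, Chart.hs, inner_smul_left, C.t_def]
    change _ = q * (c / q - ((-q⁻¹) * _ + c / q * (1 - (-1) * C.s z)))
    field_simp
    ring

theorem Model.isHypersphere (C : Chart .hyp d X) (hd : 2 ≤ d) {L : Set X} {c : ℝ} {y : X}
    {F : X → ℝ} (h : Model .hyp L c y F) (hc : 0 < c) (hc1 : c < 1) :
    IsPreconnected {z | F z = 0} ∧ IsHypersphere {z | F z = 0}
      (Real.arsinh (c / √(1 - c ^ 2))) := by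
  obtain ⟨W, hW, hF⟩ := h.exists_hs C (by nlinarith)
  have hq0 : 0 < √(1 - c ^ 2) := Real.sqrt_pos.2 (by nlinarith)
  set q := √(1 - c ^ 2)
  have hS : 0 < c / q := div_pos hc hq0
  have hlam : 0 < Real.arsinh (c / q) := Real.arsinh_pos_iff.2 hS
  have e1 : {z | F z = 0} = {z | W z = c / q} := by
    ext z
    change F z = 0 ↔ W z = _
    rw [hF, mul_eq_zero, or_iff_right hq0.ne', sub_eq_zero, eq_comm]
  have e2 : {z | 0 ≤ F z} = {z | W z ≤ c / q} := by
    ext z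
    change 0 ≤ F z ↔ W z ≤ _
    rw [hF, mul_nonneg_iff_of_pos_left hq0, sub_nonneg]
  refine ⟨?_, hlam, ⟨_, C.isHalfspace hW, ?_⟩, ?_⟩
  · rw [e1]; exact C.isPreconnected_hs_eq (by omega) hW _
  · rw [C.infDist_halfspace_le hW hlam, Real.sinh_arsinh, ← e2, h.frontier_superlevel C]
  · rw [e1]; exact C.not_isHyperplane hd hW hS

end

section
variable {g : Geo} {d : ℕ} {X : Type*} [MetricSpace X]

theorem Chart.frontier_closedBall (C : Chart g d X) (p : X) {R : ℝ} (hR : 0 < R)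
    (hRπ : g = .sph → R < Real.pi) : frontier (closedBall p R) = sphere p R := by
  refine Subset.antisymm frontier_closedBall_subset_sphere fun z hz =>
    ⟨subset_closure (sphere_subset_closedBall hz), fun hi => ?_⟩
  have hv : g.Val R := ⟨hR.le, fun h => (hRπ h).le⟩
  obtain ⟨C, hC⟩ := C.exists_at p
  rw [C.sphere_eq p hv] at hz
  replace hz : qd g p z = g.ps R := hz
  rw [← C.s_eq_zero_iff hC] at hz
  obtain ⟨u, hu, rfl⟩ := C.exists_eq_polar hz (g.Sn_pos hR hRπ)
  have h1 := (C.continuous_polar hu).continuousAt.eventually (isOpen_interior.mem_nhds hi)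
  obtain ⟨δ, hδ, h1⟩ := Metric.eventually_nhds_iff.1 h1
  obtain ⟨r, hRr, hrδ, hr⟩ : ∃ r, R < r ∧ r < R + δ ∧ (g = .sph → r ≤ Real.pi) := by
    by_cases h : g = .sph
    · obtain ⟨r, h2, h3⟩ := exists_between (lt_min (lt_add_of_pos_right R hδ) (hRπ h))
      exact ⟨r, h2, h3.trans_le (min_le_left _ _), fun _ => (h3.trans_le (min_le_right _ _)).le⟩
    · exact ⟨R + δ / 2, by linarith, by linarith, fun h' => absurd h' h⟩
  have h2 : C.polar u hu r ∈ closedBall p R := interior_subset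
    (h1 (by rw [Real.dist_eq, abs_of_pos (by linarith)]; linarith))
  rw [C.closedBall_eq p hv] at h2
  replace h2 : qd g p (C.polar u hu r) ≤ g.ps R := h2
  rw [← C.s_eq_zero_iff hC, C.s_polar] at h2
  exact absurd h2 (not_le.2 ((g.ps_lt hv ⟨(hR.trans hRr).le, hr⟩).2 hRr))

theorem Chart.bdryComponents_closedBall (C : Chart g d X) (hd : 2 ≤ d) (p : X) {R : ℝ} (hR : 0 < R)
    (hRπ : g = .sph → R < Real.pi) {D : Set X} (hD : D ∈ bdryComponents (closedBall p R)) :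
    D = sphere p R := by
  obtain ⟨y, hy, rfl⟩ := hD
  rw [C.frontier_closedBall p hR hRπ] at hy ⊢
  exact (C.isPreconnected_sphere hd p hR hRπ).connectedComponentIn hy

theorem Chart.osculated_eq_closedBall (C : Chart g d X) (hd : 2 ≤ d) {K : Set X} (hKc : IsClosed K)
    (hKn : (frontier K).Nonempty) {c : ℝ} (hc : 0 < c) (hg : g = .hyp → 1 < c)
    (hO : Osculated g K c) {R : ℝ} (hR : 0 < R) (hRπ : g = .sph → R ≤ Real.pi / 2)
    (hRc : g.Co R = c * g.Sn R) : ∃ p, K = closedBall p R := by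
  obtain ⟨y, hy⟩ := hKn
  obtain ⟨F, hF⟩ := hO.exists_model hy
  obtain ⟨p, h1, h2⟩ := hF.eq_ball C hR hRπ hRc
  refine ⟨p, ?_⟩
  rw [← h1]
  refine hF.eq_superlevel C hd hKc hc (fun h => (hg h).le) hO hy ?_
  rw [h2]
  exact C.isPreconnected_sphere hd p hR fun h => (hRπ h).trans_lt (by linarith [Real.pi_pos])

theorem Chart.t6Cond4_of_ball (C : Chart g d X) (hd : 2 ≤ d) {K L : Set X} {R : ℝ} (hR : 0 < R)
    (hRπ : g = .sph → R ≤ Real.pi / 2) (hK : ∃ p, K = closedBall p R)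
    (hL : ∃ p, L = closedBall p R) : T6Cond4 d K L := by
  refine Or.inl ⟨R, hR, fun h => ?_, ?_, hK, hL⟩
  · by_cases hg : g = .sph
    · exact hRπ hg
    · exact absurd h (not_isSphereSpace (by omega) hg C)
  · obtain ⟨p, rfl⟩ := hK
    obtain ⟨q, rfl⟩ := hL
    have hRπ' : g = .sph → R < Real.pi := fun h => (hRπ h).trans_lt (by linarith [Real.pi_pos])
    rintro D (hD | hD)
    · exact ⟨p, C.bdryComponents_closedBall hd p hR hRπ' hD⟩
    · exact ⟨q, C.bdryComponents_closedBall hd q hR hRπ' hD⟩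

theorem Chart.osculated_parasphere (C : Chart .hyp d X) (hd : 2 ≤ d) {K : Set X} (hKc : IsClosed K)
    (hKn : (frontier K).Nonempty) (hO : Osculated .hyp K 1) :
    IsParaball K ∧ ∀ D ∈ bdryComponents K, IsParasphere D := by
  have key : ∀ y F, Model .hyp K 1 y F → IsParaball {z | 0 ≤ F z} ∧ IsPreconnected {z | F z = 0} := by
    intro y F hF
    obtain ⟨C, a, ha, h⟩ := hF.exists_chart C
    simp_rw [h, one_mul]
    exact ⟨C.isParaball ha, C.isPreconnected_parasphere ha⟩
  constructor
  · obtain ⟨y, hy⟩ := hKn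
    obtain ⟨F, hF⟩ := hO.exists_model hy
    obtain ⟨h1, h2⟩ := key y F hF
    rw [hF.eq_superlevel C hd hKc one_pos (fun _ => le_rfl) hO hy h2]
    exact h1
  · rintro _ ⟨y, hy, rfl⟩
    obtain ⟨F, hF⟩ := hO.exists_model hy
    obtain ⟨h1, h2⟩ := key y F hF
    refine ⟨_, h1, ?_⟩
    rw [(hF.component C hKc hO hy h2).1, hF.frontier_superlevel C]

theorem Chart.osculated_hypersphere (C : Chart .hyp d X) (hd : 2 ≤ d) {K : Set X} (hKc : IsClosed K)
    {c : ℝ} (hc : 0 < c) (hc1 : c < 1) (hO : Osculated .hyp K c) :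
    ∀ D ∈ bdryComponents K, IsHypersphere D (Real.arsinh (c / √(1 - c ^ 2))) := by
  rintro _ ⟨y, hy, rfl⟩
  obtain ⟨F, hF⟩ := hO.exists_model hy
  obtain ⟨h1, h2⟩ := hF.isHypersphere C hd hc hc1
  rw [(hF.component C hKc hO hy h1).1]
  exact h2

theorem Chart.t6Cond4_of_osculated (C : Chart g d X) (hd : 2 ≤ d) {K L : Set X} (hKc : IsClosed K)
    (hLc : IsClosed L) (hKn : (frontier K).Nonempty) (hLn : (frontier L).Nonempty) {c : ℝ}
    (hc : 0 < c) (hK : Osculated g K c) (hL : Osculated g L c) : T6Cond4 d K L := by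
  by_cases hg : g = .hyp → 1 < c
  · obtain ⟨R, hR, hRπ, hRc⟩ := Geo.exists_radius hc hg
    exact C.t6Cond4_of_ball hd hR hRπ (C.osculated_eq_closedBall hd hKc hKn hc hg hK hR hRπ hRc)
      (C.osculated_eq_closedBall hd hLc hLn hc hg hL hR hRπ hRc)
  · push Not at hg
    obtain ⟨rfl, hc1⟩ := hg
    rcases hc1.lt_or_eq with hc1 | rfl
    · have h1 := C.osculated_hypersphere hd hKc hc hc1 hK
      have h2 := C.osculated_hypersphere hd hLc hc hc1 hL
      refine Or.inr (Or.inr ⟨Real.arsinh (c / √(1 - c ^ 2)),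
        Real.arsinh_pos_iff.2 (div_pos hc (Real.sqrt_pos.2 (by nlinarith))), ?_⟩)
      rintro D (hD | hD)
      exacts [h1 D hD, h2 D hD]
    · obtain ⟨h1, h2⟩ := C.osculated_parasphere hd hKc hKn hK
      obtain ⟨h3, h4⟩ := C.osculated_parasphere hd hLc hLn hL
      refine Or.inr (Or.inl ⟨?_, h1, h3⟩)
      rintro D (hD | hD)
      exacts [h2 D hD, h4 D hD]

theorem Chart.t6Cond4_of_out (C : Chart g d X) (hd : 2 ≤ d) {K L : Set X} (hKc : IsClosed K)
    (hLc : IsClosed L) (hK : GConvex K) (hL : GConvex L) (hKb : CondBallInside K)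
    (hLb : CondBallInside L) (hLn : (frontier L).Nonempty) (h2 : T6Cond2 K L)
    (hout : ∃ x ∈ frontier K, ∃ c > 0, ∃ H, IsHS g H ∧ H x = 0 ∧ OutC g K x H c) :
    T6Cond4 d K L := by
  obtain ⟨x, hx, c₀, hc₀, H, hH, h0, ho⟩ := hout
  obtain ⟨H', cs, hs⟩ := C.exists_supp (by omega) hKc hK hKb hx
  obtain rfl := hs.eq_of_outC C hH h0 ho
  obtain ⟨c, hc, h3, h4⟩ := C.exists_osculated hd hKc hLc hK hL hKb hLb hLn h2 hs hc₀ ho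
  exact C.t6Cond4_of_osculated hd hKc hLc ⟨x, hx⟩ hLn hc h3 h4

theorem T6Cond4.symm {d : ℕ} {K L : Set X} (h : T6Cond4 d K L) : T6Cond4 d L K := by
  unfold T6Cond4 at h ⊢
  rw [union_comm (bdryComponents L), and_comm (a := IsParaball L)]
  simpa only [and_comm (a := ∃ p, L = closedBall p _)] using h

theorem Chart.sph_out_or_hemisphere (C : Chart .sph d X) (hd : 2 ≤ d) {K : Set X}
    (hKc : IsClosed K) (hK : GConvex K) (hKb : CondBallInside K) (hKn : (frontier K).Nonempty)
    (hKp : K ≠ univ) :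
    (∃ x ∈ frontier K, ∃ c > 0, ∃ H, IsHS .sph H ∧ H x = 0 ∧ OutC .sph K x H c) ∨
      ∃ p, K = closedBall p (Real.pi / 2) := by
  by_cases h : ∀ z ∈ K, ∀ z' ∈ K, qd .sph z z' < 2
  · obtain ⟨y, hy⟩ := hKn
    obtain ⟨H, c, hs⟩ := C.exists_supp (by omega) hKc hK hKb hy
    exact Or.inl (C.exists_out_sph hd hKc hK hs h)
  · push Not at h
    obtain ⟨z, hz, z', hz', h⟩ := h
    have h1 := Geo.sph.k_ps_le (dist z z')
    replace h1 : 1 * qd .sph z z' ≤ 2 := h1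
    obtain ⟨p, hp⟩ := C.hemisphere_of_antipodal hd hKc hK hKb hKp hz hz' (by linarith)
    refine Or.inr ⟨p, ?_⟩
    rw [C.closedBall_eq p ⟨by positivity, fun _ => by linarith [Real.pi_pos]⟩, hp]
    change _ = {w | qd .sph p w ≤ 1 - Real.cos (Real.pi / 2)}
    rw [Real.cos_pi_div_two, sub_zero]

end

/-- **Lemma 6.2** ((2) ⟹ (4) in Theorem 6). Under the hypotheses of Theorem 6,
condition (2) (central symmetry of all small intersections satisfying (A), (B), (C))
implies condition (4): the connected components of the boundaries of `K` and `L` are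
congruent spheres (for `S^d` of radius at most `π/2`), paraspheres, or congruent
hyperspheres, with `K`, `L` congruent balls, resp. paraballs, in the first two cases. -/
theorem lemma6_2
    (d : ℕ) (hd : 2 ≤ d)
    (X : Type*) [MetricSpace X] (hX : IsSpaceForm X d)
    (K L : Set X)
    (hKcl : IsClosed K) (hLcl : IsClosed L)
    (hKcv : GConvex K) (hLcv : GConvex L)
    (hKint : (interior K).Nonempty) (hLint : (interior L).Nonempty)
    (hKpr : K ≠ univ) (hLpr : L ≠ univ)
    (hKss : CondBallInside K) (hLss : CondBallInside L)
    (hext : IsEuclideanSpaceForm X d → HasExtremePoint K ∨ HasExtremePoint L)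
    (hKsss : IsHyperbolicSpace X d → CondCurvBound d K)
    (hLsss : IsHyperbolicSpace X d → CondCurvBound d L)
    (h2 : T6Cond2 K L) :
    T6Cond4 d K L := by


  have hconn : ∀ {g : Geo} (C : Chart g d X), (frontier K).Nonempty ∧ (frontier L).Nonempty :=
    fun C => ⟨C.frontier_nonempty (by omega) (hKint.mono interior_subset) hKpr,
      C.frontier_nonempty (by omega) (hLint.mono interior_subset) hLpr⟩
  rcases hX with hX | hX | hX
  · obtain ⟨C⟩ := exists_chart_sph hX
    obtain ⟨hKn, hLn⟩ := hconn C
    rcases C.sph_out_or_hemisphere hd hKcl hKcv hKss hKn hKpr with hK | hK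
    · exact C.t6Cond4_of_out hd hKcl hLcl hKcv hLcv hKss hLss hLn h2 hK
    rcases C.sph_out_or_hemisphere hd hLcl hLcv hLss hLn hLpr with hL | hL
    · exact (C.t6Cond4_of_out hd hLcl hKcl hLcv hKcv hLss hKss hKn h2.symm hL).symm
    · exact C.t6Cond4_of_ball hd (by positivity) (fun _ => le_rfl) hK hL
  · obtain ⟨C, -⟩ := exists_chart_euc hX
    obtain ⟨hKn, hLn⟩ := hconn C
    obtain ⟨x, hx⟩ := id hKn
    obtain ⟨y, hy⟩ := id hLn
    obtain ⟨H, c, hs⟩ := C.exists_supp (by omega) hKcl hKcv hKss hx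
    obtain ⟨G, e, hs'⟩ := C.exists_supp (by omega) hLcl hLcv hLss hy
    rcases hext hX with hE | hE
    · exact C.t6Cond4_of_out hd hKcl hLcl hKcv hLcv hKss hLss hLn h2
        (Chart.exists_out_euc hX (by omega) hKcl hKcv hs hE)
    · exact (C.t6Cond4_of_out hd hLcl hKcl hLcv hKcv hLss hKss hKn h2.symm
        (Chart.exists_out_euc hX (by omega) hLcl hLcv hs' hE)).symm
  · obtain ⟨C⟩ := exists_chart_hyp hX
    obtain ⟨hKn, hLn⟩ := hconn C
    obtain ⟨x, hx⟩ := id hKn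
    exact C.t6Cond4_of_out hd hKcl hLcl hKcv hLcv hKss hLss hLn h2
      ⟨x, hx, C.exists_out_hyp hX (hKsss hX) hx⟩

end BallChar
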